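/- Let k ≥ 2 be an integer, δ > 0, ε > 0 and c₁ ≥ 1. There exists a constant C = C(k,δ,ε,c₁) > 0 such that the following holds. Let Z ≥ 2 and X, Y be reals with 1 ≤ X ≤ Y ≤ c₁·Z^{1/k} and X·Y ≥ Z^{1/k}/c₁, let M be a positive integer with M ≤ Z and log M ≥ max{ (9/2)(1+δ)·log(Z·X^{−k})·log Y / log Z , log Y }, and let s₀ ∈ [0, 2X/Y]. Let ℓ denote the minimum Euclidean norm of a nonzero vector of the lattice Λ = { ( M·(x − s₀·y)/(2Y) , y/(2Y) ) : (x,y) ∈ ℤ² }. Then the number of quadruples of positive integers (a,b,x,y) satisfying a·x^k − b·y^k = 1, X < x ≤ 2X, Y < y ≤ 2Y, Z < b·y^k ≤ 2Z and s₀ < x/y ≤ s₀ + 1/M is at most C·Z^ε·ℓ^{−(1+ε)}. -/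

import Mathlib

namespace PairCount
open Polynomial

/-- Evaluation of an integral bivariate polynomial: the inner variable at `w`,
the outer one at `t`. -/
noncomputable def biEval {R : Type*} [CommRing R] (w t : R) : ℤ[X][X] →+* R :=
  eval₂RingHom (eval₂RingHom (Int.castRingHom R) w) t

/-- The integral bivariate polynomials of bidegree at most `(d, e)`. -/
def BiDegLE (d e : ℕ) (f : ℤ[X][X]) : Prop :=
  f.natDegree ≤ e ∧ ∀ j, (f.coeff j).natDegree ≤ d

/-- Evaluation at `(u, v)` of the homogenization of `r` in degree `n`. -/
noncomputable def homEval (n : ℕ) (r : ℤ[X]) (u v : ℤ) : ℤ :=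
  ∑ i ∈ Finset.range (n + 1), r.coeff i * u ^ i * v ^ (n - i)

lemma cast_homEval {R : Type*} [CommRing R] {n : ℕ} {r : ℤ[X]} (hr : r.natDegree ≤ n)
    {u v : ℤ} {w : R} (h : (u : R) = v * w) :
    (homEval n r u v : R) = (v : R) ^ n * eval₂ (Int.castRingHom R) w r := by
  rw [eval₂_eq_sum_range' _ (Nat.lt_succ_of_le hr), homEval, Finset.mul_sum]
  push_cast
  refine Finset.sum_congr rfl fun i hi => ?_
  have hi' : i ≤ n := Nat.lt_succ_iff.mp (Finset.mem_range.mp hi)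
  rw [h, mul_pow]
  conv_rhs => rw [← Nat.sub_add_cancel hi', pow_add]
  simp only [eq_intCast]
  ring

lemma biEval_apply {R : Type*} [CommRing R] (w t : R) (f : ℤ[X][X]) :
    biEval w t f = eval₂ (eval₂RingHom (Int.castRingHom R) w) t f := rfl

lemma biEval_eq_sum {R : Type*} [CommRing R] (w t : R) {d e : ℕ} {f : ℤ[X][X]}
    (hf : BiDegLE d e f) :
    biEval w t f = ∑ j ∈ Finset.range (e + 1), ∑ i ∈ Finset.range (d + 1),
      (((f.coeff j).coeff i : ℤ) : R) * w ^ i * t ^ j := by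
  rw [biEval_apply, eval₂_eq_sum_range' _ (Nat.lt_succ_of_le hf.1)]
  refine Finset.sum_congr rfl fun j _ => ?_
  rw [coe_eval₂RingHom, eval₂_eq_sum_range' _ (Nat.lt_succ_of_le (hf.2 j)), Finset.sum_mul]
  simp

lemma biEval_C {R : Type*} [CommRing R] (w t : R) (r : ℤ[X]) :
    biEval w t (C r) = eval₂ (Int.castRingHom R) w r := by
  simp [biEval_apply]

lemma map_biEval {R S : Type*} [CommRing R] [CommRing S] (φ : R →+* S) (w t : R)
    (f : ℤ[X][X]) : φ (biEval w t f) = biEval (φ w) (φ t) f := by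
  have : φ.comp (biEval w t) = biEval (φ w) (φ t) := by
    ext <;> simp [biEval]
  exact RingHom.congr_fun this f

/-- The entry with index `(i, j)` of the vector of bihomogeneous monomials of bidegree `(d, e)`. -/
def monoRow (d e : ℕ) (u v a b : ℤ) (n : Fin (d + 1) × Fin (e + 1)) : ℤ :=
  u ^ (n.1 : ℕ) * v ^ (d - n.1) * (b ^ (n.2 : ℕ) * a ^ (e - n.2))

lemma cast_monoRow {R : Type*} [CommRing R] {d e : ℕ} {u v a b : ℤ} {w t : R}
    (hu : (u : R) = v * w) (hb : (b : R) = a * t) (n : Fin (d + 1) × Fin (e + 1)) :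
    (monoRow d e u v a b n : R) = (v : R) ^ d * (a : R) ^ e * (w ^ (n.1 : ℕ) * t ^ (n.2 : ℕ)) := by
  have h1 : (n.1 : ℕ) ≤ d := Nat.lt_succ_iff.mp n.1.2
  have h2 : (n.2 : ℕ) ≤ e := Nat.lt_succ_iff.mp n.2.2
  have e1 : (v : R) ^ d = v ^ (d - n.1) * v ^ (n.1 : ℕ) := by
    rw [← pow_add, Nat.sub_add_cancel h1]
  have e2 : (a : R) ^ e = a ^ (e - n.2) * a ^ (n.2 : ℕ) := by
    rw [← pow_add, Nat.sub_add_cancel h2]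
  simp only [monoRow]
  push_cast
  rw [hu, hb, mul_pow, mul_pow, e1, e2]
  ring

lemma sum_coeff_mul_monoRow {R : Type*} [CommRing R] {d e : ℕ} {u v a b : ℤ} {w t : R}
    (hu : (u : R) = v * w) (hb : (b : R) = a * t) {f : ℤ[X][X]} (hf : BiDegLE d e f) :
    ((∑ n : Fin (d + 1) × Fin (e + 1), (f.coeff n.2).coeff n.1 * monoRow d e u v a b n : ℤ) : R) =
      (v : R) ^ d * (a : R) ^ e * biEval w t f := by
  rw [biEval_eq_sum w t hf, Finset.sum_range, Finset.mul_sum]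
  push_cast
  rw [Fintype.sum_prod_type_right]
  refine Finset.sum_congr rfl fun j _ => ?_
  rw [Finset.sum_range, Finset.mul_sum]
  refine Finset.sum_congr rfl fun i _ => ?_
  rw [cast_monoRow hu hb]
  ring

/-- The bivariate polynomial with coefficients `c`. -/
noncomputable def polyOf {d e : ℕ} (c : Fin (d + 1) × Fin (e + 1) → ℤ) : ℤ[X][X] :=
  ∑ j : Fin (e + 1), monomial (j : ℕ) (∑ i : Fin (d + 1), monomial (i : ℕ) (c (i, j)))

lemma coeff_polyOf {d e : ℕ} (c : Fin (d + 1) × Fin (e + 1) → ℤ) (n : Fin (d + 1) × Fin (e + 1)) :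
    ((polyOf c).coeff n.2).coeff n.1 = c n := by
  simp [polyOf, coeff_monomial, Fin.val_inj]

lemma biDegLE_polyOf {d e : ℕ} (c : Fin (d + 1) × Fin (e + 1) → ℤ) :
    BiDegLE d e (polyOf c) := by
  constructor
  · refine natDegree_sum_le_of_forall_le _ _ fun j _ => ?_
    exact (natDegree_monomial_le _).trans (Nat.lt_succ_iff.mp j.2)
  · intro j
    simp only [polyOf, finsetSum_coeff, coeff_monomial]
    refine natDegree_sum_le_of_forall_le _ _ fun j' _ => ?_
    split_ifs
    · refine natDegree_sum_le_of_forall_le _ _ fun i _ => ?_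
      exact (natDegree_monomial_le _).trans (Nat.lt_succ_iff.mp i.2)
    · simp

lemma polyOf_ne_zero {d e : ℕ} {c : Fin (d + 1) × Fin (e + 1) → ℤ} (hc : c ≠ 0) :
    polyOf c ≠ 0 := by
  intro h
  apply hc
  funext n
  rw [← coeff_polyOf c n, h]
  simp

lemma biEval_polyOf_eq_zero {d e : ℕ} {c : Fin (d + 1) × Fin (e + 1) → ℤ} {u v a b : ℤ}
    (hv : v ≠ 0) (ha : a ≠ 0) (h : ∑ n, c n * monoRow d e u v a b n = 0) :
    biEval ((u : ℚ) / v) ((b : ℚ) / a) (polyOf c) = 0 := by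
  have hv' : (v : ℚ) ≠ 0 := by exact_mod_cast hv
  have ha' : (a : ℚ) ≠ 0 := by exact_mod_cast ha
  have := sum_coeff_mul_monoRow (R := ℚ) (u := u) (v := v) (a := a) (b := b)
    (w := (u : ℚ) / v) (t := (b : ℚ) / a) (by field_simp) (by field_simp) (biDegLE_polyOf c)
  simp only [coeff_polyOf, h, Int.cast_zero] at this
  have h3 : (v : ℚ) ^ d * (a : ℚ) ^ e ≠ 0 := by positivity
  exact (mul_eq_zero.mp this.symm).resolve_left h3

lemma sum_monoRow_eq_zero {d e : ℕ} {f : ℤ[X][X]} (hf : BiDegLE d e f) {u v a b : ℤ}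
    (hv : v ≠ 0) (ha : a ≠ 0) (h : biEval ((u : ℚ) / v) ((b : ℚ) / a) f = 0) :
    ∑ n, (f.coeff n.2).coeff n.1 * monoRow d e u v a b n = 0 := by
  have hv' : (v : ℚ) ≠ 0 := by exact_mod_cast hv
  have ha' : (a : ℚ) ≠ 0 := by exact_mod_cast ha
  have := sum_coeff_mul_monoRow (R := ℚ) (u := u) (v := v) (a := a) (b := b)
    (w := (u : ℚ) / v) (t := (b : ℚ) / a) (by field_simp) (by field_simp) hf
  rw [h, mul_zero] at this
  exact_mod_cast this

lemma natDegree_det_le {n : Type*} [Fintype n] [DecidableEq n] {d : ℕ} (M : Matrix n n ℤ[X])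
    (h : ∀ i j, (M i j).natDegree ≤ d) : M.det.natDegree ≤ Fintype.card n * d := by
  rw [Matrix.det_apply]
  refine natDegree_sum_le_of_forall_le _ _ fun σ _ => ?_
  refine (natDegree_smul_le _ _).trans ?_
  refine (natDegree_prod_le _ _).trans ?_
  exact (Finset.sum_le_card_nsmul _ _ d fun i _ => h _ _).trans (by simp)

lemma sylvester_induction {R : Type*} [CommRing R] {P : R → Prop} (h0 : P 0) (f g : R[X])
    (hf : ∀ j, P (f.coeff j)) (hg : ∀ j, P (g.coeff j)) (m n : ℕ) (i j : Fin (m + n)) :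
    P (sylvester f g m n i j) := by
  rw [sylvester, Matrix.of_apply]
  refine Fin.addCases (fun j => ?_) (fun j => ?_) j
  · rw [Fin.addCases_left]; split_ifs <;> simp [h0, hg]
  · rw [Fin.addCases_right]; split_ifs <;> simp [h0, hf]

lemma resultant_ne_zero_of_irreducible {R : Type*} [CommRing R] [IsDomain R]
    [NormalizedGCDMonoid R]
    {f g : R[X]} (hf : Irreducible f) (hf0 : f.natDegree ≠ 0) (hfg : ¬ f ∣ g) :
    resultant f g ≠ 0 := by
  have hprim : f.IsPrimitive := hf.isPrimitive hf0
  set K := FractionRing R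
  have hirr : Irreducible (f.map (algebraMap R K)) :=
    (hprim.irreducible_iff_irreducible_map_fraction_map (K := K)).mp hf
  have hndvd : ¬ f.map (algebraMap R K) ∣ g.map (algebraMap R K) := by
    intro h
    exact hfg (hprim.dvd_of_fraction_map_dvd_fraction_map h)
  have hcop : IsCoprime (f.map (algebraMap R K)) (g.map (algebraMap R K)) :=
    hirr.coprime_iff_not_dvd.mpr hndvd
  have hinj : Function.Injective (algebraMap R K) := IsFractionRing.injective R K
  have h1 : resultant (f.map (algebraMap R K)) (g.map (algebraMap R K)) ≠ 0 := by
    intro h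
    exact (resultant_eq_zero_iff.mp h).2 hcop
  rw [natDegree_map_eq_of_injective hinj, natDegree_map_eq_of_injective hinj,
    resultant_map_map] at h1
  intro h
  rw [h, map_zero] at h1
  exact h1 rfl

lemma card_le_natDegree_of_eval₂_eq_zero {ι : Type*} {S : Finset ι} {w : ι → ℚ}
    (hw : Set.InjOn w S) {r : ℤ[X]} (hr : r ≠ 0)
    (h : ∀ i ∈ S, eval₂ (Int.castRingHom ℚ) (w i) r = 0) : S.card ≤ r.natDegree := by
  classical
  have hr' : r.map (Int.castRingHom ℚ) ≠ 0 :=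
    (Polynomial.map_ne_zero_iff Int.cast_injective).mpr hr
  calc S.card = (S.image w).card := (Finset.card_image_of_injOn hw).symm
    _ ≤ (r.map (Int.castRingHom ℚ)).natDegree := by
        apply Polynomial.card_le_degree_of_subset_roots
        intro x hx
        obtain ⟨i, hi, rfl⟩ := Finset.mem_image.mp (Finset.mem_def.mpr hx)
        rw [mem_roots hr', IsRoot, eval_map]
        exact h i hi
    _ ≤ r.natDegree := natDegree_map_le

/-- Bézout-type bound for the number of common zeros of an irreducible polynomial and a polynomial
it does not divide. -/
lemma card_common_zeros_le {ι : Type*} {S : Finset ι} {w t : ι → ℚ} (hw : Set.InjOn w S)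
    {f g : ℤ[X][X]} (hf : Irreducible f) (hf0 : f.natDegree ≠ 0) (hfg : ¬ f ∣ g) {d e e' : ℕ}
    (hfd : BiDegLE d e f) (hgd : BiDegLE d e' g)
    (hSf : ∀ i ∈ S, biEval (w i) (t i) f = 0) (hSg : ∀ i ∈ S, biEval (w i) (t i) g = 0) :
    S.card ≤ (e + e') * d := by
  classical
  let : NormalizedGCDMonoid ℤ[X] := Classical.choice inferInstance
  have hR := resultant_ne_zero_of_irreducible hf hf0 hfg
  obtain ⟨p, q, -, -, hpq⟩ := exists_mul_add_mul_eq_C_resultant f g le_rfl le_rfl (Or.inl hf0)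
  have h1 : S.card ≤ (resultant f g).natDegree := by
    refine card_le_natDegree_of_eval₂_eq_zero hw hR fun i hi => ?_
    rw [← biEval_C (w i) (t i), ← hpq, map_add, map_mul, map_mul, hSf i hi, hSg i hi]
    ring
  refine h1.trans ?_
  refine (natDegree_det_le (d := d) _ (sylvester_induction (P := fun r : ℤ[X] => r.natDegree ≤ d)
    (by simp) f g hfd.2 hgd.2 _ _)).trans ?_
  rw [Fintype.card_fin]
  exact Nat.mul_le_mul_right _ (add_le_add hfd.1 hgd.1)

/-- If all maximal minors formed from a family of integer vectors vanish, then the family is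
annihilated by a nonzero integer vector of controlled size. -/
lemma exists_kernel_vector {ι β : Type*} [Fintype β] [DecidableEq β] (S : Finset ι)
    (r : ι → β → ℤ) {Q : ℝ} (hQ : 1 ≤ Q) (hr : ∀ i ∈ S, ∀ n, |(r i n : ℝ)| ≤ Q) [Nonempty β]
    (hdet : ∀ p : β → ι, (∀ n, p n ∈ S) → (Matrix.of fun n => r (p n)).det = 0) :
    ∃ c : β → ℤ, c ≠ 0 ∧ (∀ n, |(c n : ℝ)| ≤ (Fintype.card β * Q) ^ Fintype.card β) ∧
      ∀ i ∈ S, ∑ n, c n * r i n = 0 := by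
  classical
  let ρ : S → β → ℚ := fun i n => (r i n : ℚ)
  obtain ⟨m, hm, g, hgmem, hgspan, hglin⟩ : ∃ m, m = Module.finrank ℚ
      (Submodule.span ℚ (Set.range ρ)) ∧ ∃ g : Fin m → β → ℚ, (∀ i, g i ∈ Set.range ρ) ∧
      Submodule.span ℚ (Set.range g) = Submodule.span ℚ (Set.range ρ) ∧ LinearIndependent ℚ g :=
    ⟨_, rfl, Submodule.exists_fun_fin_finrank_span_eq ℚ (Set.range ρ)⟩
  choose p hp using hgmem
  have hle : m ≤ Fintype.card β := by
    have := Submodule.finrank_le (Submodule.span ℚ (Set.range ρ))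
    rwa [← hm, Module.finrank_fintype_fun_eq_card] at this
  have hlt : m < Fintype.card β := by
    refine lt_of_le_of_ne hle fun heq => ?_
    let eqv : β ≃ Fin m := (Fintype.equivFin β).trans (finCongr heq.symm)
    have h0 := hdet (fun n => (p (eqv n) : ι)) (fun n => (p (eqv n)).2)
    have h1 : (Matrix.of fun n => g (eqv n)).det = 0 := by
      have : (Matrix.of fun n => g (eqv n)) =
          (Matrix.of fun n => r (p (eqv n))).map (Int.castRingHom ℚ) := by
        ext n k
        simp [← hp, ρ]
      rw [this, ← RingHom.mapMatrix_apply, ← RingHom.map_det, h0, map_zero]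
    have h2 : LinearIndependent ℚ (fun n => g (eqv n)) := hglin.comp _ eqv.injective
    have h3 := Matrix.linearIndependent_rows_iff_isUnit (A := Matrix.of fun n => g (eqv n))
    have h4 := (Matrix.isUnit_iff_isUnit_det _).mp (h3.mp h2)
    rw [h1] at h4
    simp at h4
  have key : ∃ c : β → ℤ, c ≠ 0 ∧ (∀ n, |(c n : ℝ)| ≤ (Fintype.card β * Q) ^ Fintype.card β) ∧
      ∀ k : Fin m, ∑ n, c n * r (p k) n = 0 := by
    have hcard : (1 : ℝ) ≤ Fintype.card β := by exact_mod_cast Fintype.card_pos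
    have hb : 1 ≤ (Fintype.card β : ℝ) * Q := by nlinarith
    rcases Nat.eq_zero_or_pos m with h0 | hpos
    · refine ⟨fun _ => 1, fun h => ?_, fun n => ?_, fun k => ?_⟩
      · simpa using congrFun h (Classical.arbitrary β)
      · simpa using one_le_pow₀ hb
      · exact absurd k.2 (by omega)
    · let := Matrix.seminormedAddCommGroup (m := Fin m) (n := β) (α := ℤ)
      obtain ⟨c, hc0, hc, hcn⟩ := Int.Matrix.exists_ne_zero_int_vec_norm_le
        (Matrix.of fun k : Fin m => r (p k)) (by simpa using hlt) (by simpa using hpos)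
      refine ⟨c, hc0, fun n => ?_, fun k => ?_⟩
      · have h1 : |(c n : ℝ)| ≤ ‖c‖ := by
          have := norm_le_pi_norm c n
          rwa [Int.norm_eq_abs] at this
        refine h1.trans (hcn.trans ?_)
        have hA : max 1 ‖(Matrix.of fun k : Fin m => r (p k))‖ ≤ Q := by
          refine max_le hQ ?_
          rw [Matrix.norm_le_iff (by linarith)]
          intro k n
          rw [Int.norm_eq_abs]
          exact hr _ (p k).2 n
        have h2 : (Fintype.card β : ℝ) * max 1 ‖(Matrix.of fun k : Fin m => r (p k))‖ ≤
            Fintype.card β * Q := by gcongr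
        have h3 : (1 : ℝ) ≤ Fintype.card β * max 1 ‖(Matrix.of fun k : Fin m => r (p k))‖ := by
          nlinarith [le_max_left 1 ‖(Matrix.of fun k : Fin m => r (p k))‖]
        have hmr : ((Fintype.card (Fin m) : ℕ) : ℝ) + 1 ≤ Fintype.card β := by
          simp only [Fintype.card_fin]; exact_mod_cast hlt
        calc _ ≤ ((Fintype.card β : ℝ) * Q) ^ ((Fintype.card (Fin m) : ℝ) /
                (Fintype.card β - Fintype.card (Fin m))) := by
              apply Real.rpow_le_rpow (by linarith) h2
              apply div_nonneg <;> [positivity; linarith]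
          _ ≤ ((Fintype.card β : ℝ) * Q) ^ (Fintype.card β : ℝ) := by
              apply Real.rpow_le_rpow_of_exponent_le hb
              rw [div_le_iff₀ (by linarith)]
              nlinarith
          _ = _ := Real.rpow_natCast _ _
      · have := congrFun hc k
        simp only [Matrix.mulVec, dotProduct, Matrix.of_apply, Pi.zero_apply] at this
        rw [← this]
        exact Finset.sum_congr rfl fun n _ => mul_comm _ _
  obtain ⟨c, hc0, hcb, hc⟩ := key
  refine ⟨c, hc0, hcb, fun i hi => ?_⟩
  let φ : (β → ℚ) →ₗ[ℚ] ℚ := ∑ n, (c n : ℚ) • LinearMap.proj n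
  have hφ : ∀ x, φ x = ∑ n, (c n : ℚ) * x n := fun x => by simp [φ]
  have hspan : Submodule.span ℚ (Set.range ρ) ≤ LinearMap.ker φ := by
    rw [← hgspan, Submodule.span_le]
    rintro _ ⟨k, rfl⟩
    rw [SetLike.mem_coe, LinearMap.mem_ker, hφ, ← hp]
    have := hc k
    simp only [ρ]
    exact_mod_cast this
  have hmem : ρ ⟨i, hi⟩ ∈ LinearMap.ker φ := hspan (Submodule.subset_span ⟨_, rfl⟩)
  rw [LinearMap.mem_ker, hφ] at hmem
  simp only [ρ] at hmem
  exact_mod_cast hmem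

lemma card_mul_pred_div_two_le_sum (s : Finset ℕ) : s.card * (s.card - 1) / 2 ≤ ∑ x ∈ s, x := by
  rw [← Finset.sum_range_id_mul_two, Nat.mul_div_cancel _ two_pos]
  induction s using Finset.induction_on_max with
  | empty => simp
  | insert m s hm ih =>
    have hnot : m ∉ s := fun h => lt_irrefl _ (hm m h)
    have hcard : s.card ≤ m := by
      simpa using Finset.card_le_card (t := Finset.range m)
        fun x hx => Finset.mem_range.mpr (hm x hx)
    rw [Finset.sum_insert hnot, Finset.card_insert_of_notMem hnot, Finset.sum_range_succ]
    omega

/-- A determinant of polynomial values at points of one residue class modulo `π` is divisible by a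
large power of `π`. -/
lemma pow_dvd_det_eval {R β : Type*} [CommRing R] [Fintype β] [DecidableEq β] (π ω : R)
    (h : β → R[X]) (w : β → R) (hw : ∀ i, π ∣ w i - ω) :
    π ^ (Fintype.card β * (Fintype.card β - 1) / 2) ∣
      (Matrix.of fun i k => (h k).eval (w i)).det := by
  choose σ hσ using hw
  rw [← Matrix.det_transpose]
  obtain ⟨N, hN⟩ : ∃ N, ∀ k, ((h k).comp (X + C ω)).natDegree < N :=
    ⟨(Finset.univ.sup fun k => ((h k).comp (X + C ω)).natDegree) + 1, fun k =>
      Nat.lt_succ_of_le (Finset.le_sup (f := fun k => ((h k).comp (X + C ω)).natDegree)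
        (Finset.mem_univ k))⟩
  have hrow : (Matrix.of fun i k => (h k).eval (w i)).transpose =
      fun k => ∑ m ∈ Finset.range N,
        (((h k).comp (X + C ω)).coeff m * π ^ m) • (fun i => σ i ^ m) := by
    ext k i
    have : (h k).eval (w i) = ((h k).comp (X + C ω)).eval (π * σ i) := by
      rw [eval_comp, eval_add, eval_X, eval_C, ← hσ]; ring_nf
    rw [Matrix.transpose_apply, Matrix.of_apply, this, eval_eq_sum_range' (hN k)]
    simp [Finset.sum_apply, mul_pow, mul_assoc]
  rw [hrow]
  change _ ∣ (Matrix.detRowAlternating : (β → R) [⋀^β]→ₗ[R] R).toMultilinearMap _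
  rw [MultilinearMap.map_sum_finset]
  refine Finset.dvd_sum fun r _ => ?_
  rw [MultilinearMap.map_smul_univ]
  by_cases hr : Function.Injective r
  · rw [Finset.prod_mul_distrib, Finset.prod_pow_eq_pow_sum, smul_eq_mul]
    refine dvd_mul_of_dvd_left (dvd_mul_of_dvd_right (pow_dvd_pow _ ?_) _) _
    have := card_mul_pred_div_two_le_sum (Finset.univ.image r)
    rwa [Finset.card_image_of_injective _ hr, Finset.card_univ,
      Finset.sum_image (fun x _ y _ hxy => hr hxy)] at this
  · rw [Function.Injective] at hr
    push Not at hr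
    obtain ⟨x, y, hxy, hne⟩ := hr
    rw [AlternatingMap.coe_multilinearMap, AlternatingMap.map_eq_zero_of_eq _ _ (i := x) (j := y) (by simp [hxy]) hne, smul_zero]
    exact dvd_zero _

/-- Hensel parametrization: the simple zeros of a bivariate polynomial in one residue class are
given, to any precision, by a polynomial in the first variable. -/
lemma exists_parametrization {R : Type*} [CommRing R] (π ω τ c : R) (f : ℤ[X][X])
    (hc : π ∣ c * biEval ω τ (derivative f) - 1) (n : ℕ) :
    ∃ ψ : R[X], ∀ w t : R, biEval w t f = 0 → π ∣ w - ω → π ∣ t - τ →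
      π ^ (n + 1) ∣ ψ.eval w - t := by
  induction n with
  | zero =>
    refine ⟨C τ, fun w t _ _ ht => ?_⟩
    rw [zero_add, pow_one, eval_C, ← neg_sub]
    exact (dvd_neg).mpr ht
  | succ n ih =>
    obtain ⟨ψ, hψ⟩ := ih
    refine ⟨ψ - C c * biEval X ψ f, fun w t hf hw ht => ?_⟩
    have h1 := hψ w t hf hw ht
    set T := ψ.eval w
    have hev : (biEval X ψ f).eval w = biEval w T f := by
      have := map_biEval (evalRingHom w) X ψ f
      simpa using this
    rw [eval_sub, eval_mul, eval_C, hev]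
    set F : R[X] := f.map (eval₂RingHom (Int.castRingHom R) w) with hF
    have hFe : ∀ s, biEval w s f = F.eval s := fun s => by rw [biEval_apply, hF, eval_map]
    obtain ⟨q, hq⟩ := F.binomExpansion t (T - t)
    rw [add_sub_cancel, ← hFe, ← hFe, hf] at hq
    have hder : π ∣ biEval w t (derivative f) - biEval ω τ (derivative f) := by
      have h2 : Ideal.Quotient.mk (Ideal.span {π}) w = Ideal.Quotient.mk _ ω := by
        rw [Ideal.Quotient.eq, Ideal.mem_span_singleton]; exact hw
      have h3 : Ideal.Quotient.mk (Ideal.span {π}) t = Ideal.Quotient.mk _ τ := by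
        rw [Ideal.Quotient.eq, Ideal.mem_span_singleton]; exact ht
      rw [← Ideal.mem_span_singleton, ← Ideal.Quotient.eq, map_biEval, map_biEval, h2, h3]
    have hder' : (derivative F).eval t = biEval w t (derivative f) := by
      rw [hF, derivative_map, eval_map, biEval_apply]
    have hT : π ∣ T - t := (dvd_pow_self π n.succ_ne_zero).trans h1
    have hfac : T - c * biEval w T f - t =
        (T - t) * (-(c * (biEval w t (derivative f) - biEval ω τ (derivative f)))
          - (c * biEval ω τ (derivative f) - 1) - c * q * (T - t)) := by
      rw [hq, hder']; ring
    rw [hfac, pow_succ]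
    refine mul_dvd_mul h1 (dvd_sub (dvd_sub ?_ hc) (dvd_mul_of_dvd_right hT _))
    exact (dvd_neg).mpr (dvd_mul_of_dvd_right hder _)

lemma pow_dvd_det_monoRow {ι : Type*} {p : ℕ} (hp : p.Prime) {f : ℤ[X][X]} {d e : ℕ}
    {D E : ℕ} (hf : BiDegLE d e f) (ω τ : ℤ) (hder : ¬ (p : ℤ) ∣ biEval ω τ (derivative f))
    {u v a b : ι → ℤ} (q : Fin (D + 1) × Fin (E + 1) → ι)
    (hv : ∀ n, ¬ (p : ℤ) ∣ v (q n)) (ha : ∀ n, ¬ (p : ℤ) ∣ a (q n))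
    (hu : ∀ n, (p : ℤ) ∣ u (q n) - ω * v (q n)) (hb : ∀ n, (p : ℤ) ∣ b (q n) - τ * a (q n))
    (hv0 : ∀ n, v (q n) ≠ 0) (ha0 : ∀ n, a (q n) ≠ 0)
    (h0 : ∀ n, biEval ((u (q n) : ℚ) / v (q n)) ((b (q n) : ℚ) / a (q n)) f = 0) :
    (p : ℤ) ^ ((D + 1) * (E + 1) * ((D + 1) * (E + 1) - 1) / 2) ∣
      (Matrix.of fun n => monoRow D E (u (q n)) (v (q n)) (a (q n)) (b (q n))).det := by
  set N := (D + 1) * (E + 1) * ((D + 1) * (E + 1) - 1) / 2 with hN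
  let R := ZMod (p ^ N)
  have hunit : ∀ z : ℤ, ¬ (p : ℤ) ∣ z → IsUnit (z : R) := by
    intro z hz
    rw [ZMod.coe_int_isUnit_iff_isCoprime]
    push_cast
    exact IsCoprime.pow_left ((Nat.prime_iff_prime_int.mp hp).coprime_iff_not_dvd.mpr hz)
  have hpN : (p : R) ^ N = 0 := by
    have := ZMod.natCast_self (p ^ N)
    push_cast at this
    exact this
  have hvU := fun n => hunit _ (hv n)
  have haU := fun n => hunit _ (ha n)
  choose v' hv' using fun n => (hvU n).exists_right_inv
  choose a' ha' using fun n => (haU n).exists_right_inv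
  obtain ⟨c, hc⟩ := (hunit _ hder).exists_left_inv
  have hcast : ((biEval ω τ (derivative f) : ℤ) : R) = biEval (ω : R) (τ : R) (derivative f) :=
    map_biEval (Int.castRingHom R) ω τ _
  obtain ⟨ψ, hψ⟩ := exists_parametrization (p : R) ω τ c f
    (by rw [← hcast, hc, sub_self]; exact dvd_zero _) N
  set w : Fin (D + 1) × Fin (E + 1) → R := fun n => u (q n) * v' n with hw
  set t : Fin (D + 1) × Fin (E + 1) → R := fun n => b (q n) * a' n with ht
  have huw : ∀ n, (u (q n) : R) = v (q n) * w n := fun n => by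
    rw [hw]; linear_combination (-(u (q n) : R)) * hv' n
  have hbt : ∀ n, (b (q n) : R) = a (q n) * t n := fun n => by
    rw [ht]; linear_combination (-(b (q n) : R)) * ha' n
  have hwω : ∀ n, (p : R) ∣ w n - ω := fun n => by
    obtain ⟨m, hm⟩ := hu n
    have : (u (q n) : R) - ω * v (q n) = p * m := by
      have := congrArg (Int.cast (R := R)) hm
      push_cast at this
      exact this
    exact ⟨m * v' n, by rw [hw]; linear_combination v' n * this + (ω : R) * hv' n⟩
  have htτ : ∀ n, (p : R) ∣ t n - τ := fun n => by
    obtain ⟨m, hm⟩ := hb n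
    have : (b (q n) : R) - τ * a (q n) = p * m := by
      have := congrArg (Int.cast (R := R)) hm
      push_cast at this
      exact this
    exact ⟨m * a' n, by rw [ht]; linear_combination a' n * this + (τ : R) * ha' n⟩
  have hzero : ∀ n, biEval (w n) (t n) f = 0 := fun n => by
    have h1 := sum_monoRow_eq_zero hf (hv0 n) (ha0 n) (h0 n)
    have h2 := sum_coeff_mul_monoRow (huw n) (hbt n) hf
    rw [h1, Int.cast_zero] at h2
    have h3 : IsUnit ((v (q n) : R) ^ d * (a (q n) : R) ^ e) :=
      ((hvU n).pow _).mul ((haU n).pow _)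
    exact (h3.mul_right_eq_zero).mp h2.symm
  have htψ : ∀ n, t n = ψ.eval (w n) := fun n => by
    have := hψ (w n) (t n) (hzero n) (hwω n) (htτ n)
    rw [pow_succ, hpN, zero_mul, zero_dvd_iff, sub_eq_zero] at this
    exact this.symm
  have key : (((Matrix.of fun n => monoRow D E (u (q n)) (v (q n)) (a (q n)) (b (q n))).det : ℤ) : R)
      = 0 := by
    have h1 : (Matrix.of fun n => monoRow D E (u (q n)) (v (q n)) (a (q n)) (b (q n))).map
        (Int.castRingHom R) = Matrix.of fun n k => ((v (q n) : R) ^ D * (a (q n) : R) ^ E) *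
          (Matrix.of fun n (k : Fin (D + 1) × Fin (E + 1)) =>
            (X ^ (k.1 : ℕ) * ψ ^ (k.2 : ℕ) : R[X]).eval (w n)) n k := by
      ext n k
      simp only [Matrix.map_apply, Matrix.of_apply, eval_mul, eval_pow, eval_X, ← htψ, eq_intCast]
      exact cast_monoRow (huw n) (hbt n) k
    have h2 := pow_dvd_det_eval (p : R) (ω : R)
      (fun k : Fin (D + 1) × Fin (E + 1) => (X ^ (k.1 : ℕ) * ψ ^ (k.2 : ℕ) : R[X])) w hwω
    rw [Fintype.card_prod, Fintype.card_fin, Fintype.card_fin, ← hN, hpN, zero_dvd_iff] at h2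
    have h3 := RingHom.map_det (Int.castRingHom R)
      (Matrix.of fun n => monoRow D E (u (q n)) (v (q n)) (a (q n)) (b (q n)))
    rw [RingHom.mapMatrix_apply, h1, Matrix.det_mul_column, h2, mul_zero] at h3
    exact h3
  have := (ZMod.intCast_zmod_eq_zero_iff_dvd _ _).mp key
  exact_mod_cast this

/-- A finite family of points `(u / v, b / a)`, in lowest terms, with distinct first coordinates,
with heights bounded by `B` and `A` respectively. -/
structure PointFamily {ι : Type*} (S : Finset ι) (u v a b : ι → ℤ) (B A : ℝ) : Prop where
  one_le_B : 1 ≤ B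
  one_le_A : 1 ≤ A
  v_ne : ∀ i ∈ S, v i ≠ 0
  a_ne : ∀ i ∈ S, a i ≠ 0
  coprime_uv : ∀ i ∈ S, IsCoprime (u i) (v i)
  coprime_ab : ∀ i ∈ S, IsCoprime (a i) (b i)
  u_le : ∀ i ∈ S, |(u i : ℝ)| ≤ B
  v_le : ∀ i ∈ S, |(v i : ℝ)| ≤ B
  a_le : ∀ i ∈ S, |(a i : ℝ)| ≤ A
  b_le : ∀ i ∈ S, |(b i : ℝ)| ≤ A
  injOn : Set.InjOn (fun i => (u i : ℚ) / v i) S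

/-- The polynomial `f` vanishes at all the points of the family. -/
def VanishesOn {ι : Type*} (S : Finset ι) (u v a b : ι → ℤ) (f : ℤ[X][X]) : Prop :=
  ∀ i ∈ S, biEval ((u i : ℚ) / v i) ((b i : ℚ) / a i) f = 0

section

variable {ι : Type*} {S : Finset ι} {u v a b : ι → ℤ} {B A : ℝ}

lemma PointFamily.subset (hP : PointFamily S u v a b B A) {T : Finset ι} (hT : T ⊆ S) :
    PointFamily T u v a b B A where
  one_le_B := hP.one_le_B
  one_le_A := hP.one_le_A
  v_ne i hi := hP.v_ne i (hT hi)
  a_ne i hi := hP.a_ne i (hT hi)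
  coprime_uv i hi := hP.coprime_uv i (hT hi)
  coprime_ab i hi := hP.coprime_ab i (hT hi)
  u_le i hi := hP.u_le i (hT hi)
  v_le i hi := hP.v_le i (hT hi)
  a_le i hi := hP.a_le i (hT hi)
  b_le i hi := hP.b_le i (hT hi)
  injOn := hP.injOn.mono (by exact_mod_cast hT)

lemma pow_mul_pow_sub_le {x y B : ℝ} (hx : |x| ≤ B) (hy : |y| ≤ B) {i d : ℕ} (hi : i ≤ d) :
    |x ^ i * y ^ (d - i)| ≤ B ^ d := by
  rw [abs_mul, abs_pow, abs_pow]
  calc |x| ^ i * |y| ^ (d - i) ≤ B ^ i * B ^ (d - i) := by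
        have : 0 ≤ B := (abs_nonneg x).trans hx
        gcongr
    _ = B ^ d := by rw [← pow_add, Nat.add_sub_cancel' hi]

lemma PointFamily.monoRow_le (hP : PointFamily S u v a b B A) {i : ι} (hi : i ∈ S) (d e : ℕ)
    (n : Fin (d + 1) × Fin (e + 1)) :
    |(monoRow d e (u i) (v i) (a i) (b i) n : ℝ)| ≤ B ^ d * A ^ e := by
  rw [monoRow]
  push_cast
  rw [abs_mul]
  have h1 := pow_mul_pow_sub_le (hP.u_le i hi) (hP.v_le i hi) (Nat.lt_succ_iff.mp n.1.2)
  have h2 := pow_mul_pow_sub_le (hP.b_le i hi) (hP.a_le i hi) (Nat.lt_succ_iff.mp n.2.2)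
  have := hP.one_le_B
  gcongr

lemma PointFamily.one_le_pow_mul_pow (hP : PointFamily S u v a b B A) (d e : ℕ) :
    1 ≤ B ^ d * A ^ e :=
  one_le_mul_of_one_le_of_one_le (one_le_pow₀ hP.one_le_B) (one_le_pow₀ hP.one_le_A)

/-- An irreducible polynomial with more zeros than allowed by Bézout's theorem has small
coefficients. -/
lemma PointFamily.card_le_or_coeff_le (hP : PointFamily S u v a b B A) {f : ℤ[X][X]} {d e : ℕ}
    (hf : Irreducible f) (he : f.natDegree = e) (he0 : e ≠ 0) (hfd : BiDegLE d e f)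
    (hd : ∃ j, (f.coeff j).natDegree = d) (h0 : VanishesOn S u v a b f) :
    S.card ≤ 2 * e * d ∨ ∀ i j, |((f.coeff j).coeff i : ℝ)| ≤
      (((d + 1) * (e + 1) : ℕ) * (B ^ d * A ^ e)) ^ ((d + 1) * (e + 1)) := by
  classical
  have hdet : ∀ p : Fin (d + 1) × Fin (e + 1) → ι, (∀ n, p n ∈ S) →
      (Matrix.of fun n => monoRow d e (u (p n)) (v (p n)) (a (p n)) (b (p n))).det = 0 := by
    intro p hp
    rw [← Matrix.exists_mulVec_eq_zero_iff]
    refine ⟨fun n => (f.coeff n.2).coeff n.1, fun h => ?_, ?_⟩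
    · apply hf.ne_zero
      ext j i
      rw [coeff_zero, coeff_zero]
      by_cases hj : j ≤ e
      · by_cases hi : i ≤ d
        · exact congrFun h (⟨i, Nat.lt_succ_iff.mpr hi⟩, ⟨j, Nat.lt_succ_iff.mpr hj⟩)
        · exact coeff_eq_zero_of_natDegree_lt ((hfd.2 j).trans_lt (not_le.mp hi))
      · rw [coeff_eq_zero_of_natDegree_lt (hfd.1.trans_lt (not_le.mp hj)), coeff_zero]
    · funext n
      rw [Matrix.mulVec, dotProduct]
      have := sum_monoRow_eq_zero hfd (hP.v_ne _ (hp n)) (hP.a_ne _ (hp n)) (h0 _ (hp n))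
      rw [Pi.zero_apply, ← this]
      exact Finset.sum_congr rfl fun m _ => by rw [Matrix.of_apply, mul_comm]
  obtain ⟨c, hc, hcQ, hcS⟩ := exists_kernel_vector S
    (fun i => monoRow d e (u i) (v i) (a i) (b i)) (hP.one_le_pow_mul_pow d e)
    (fun i hi n => hP.monoRow_le hi d e n) hdet
  by_cases hfg : f ∣ polyOf c
  · right
    obtain ⟨q, hq⟩ := hfg
    have hg0 := polyOf_ne_zero hc
    have hq0 : q ≠ 0 := by rintro rfl; exact hg0 (by rw [hq, mul_zero])
    have hqd : q.natDegree = 0 := by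
      have := (biDegLE_polyOf c).1
      rw [hq, natDegree_mul hf.ne_zero hq0] at this
      omega
    obtain ⟨q₀, rfl⟩ := natDegree_eq_zero.mp hqd
    have hq₀ : q₀ ≠ 0 := by rintro rfl; exact hq0 C_0
    obtain ⟨j₀, hj₀⟩ := hd
    have hq₀d : q₀.natDegree = 0 := by
      by_cases hz : f.coeff j₀ = 0
      · by_contra hne
        have hl : f.coeff e ≠ 0 := by rw [← he]; exact leadingCoeff_ne_zero.mpr hf.ne_zero
        have := (biDegLE_polyOf c).2 e
        rw [hq, coeff_mul_C, natDegree_mul hl hq₀] at this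
        rw [hz, natDegree_zero] at hj₀
        omega
      · have := (biDegLE_polyOf c).2 j₀
        rw [hq, coeff_mul_C, natDegree_mul hz hq₀] at this
        omega
    obtain ⟨z, rfl⟩ := natDegree_eq_zero.mp hq₀d
    have hz : z ≠ 0 := by rintro rfl; exact hq₀ C_0
    intro i j
    by_cases hij : i ≤ d ∧ j ≤ e
    · have h1 := coeff_polyOf c (⟨i, Nat.lt_succ_iff.mpr hij.1⟩, ⟨j, Nat.lt_succ_iff.mpr hij.2⟩)
      rw [hq, coeff_mul_C, coeff_mul_C] at h1
      have h2 := hcQ (⟨i, Nat.lt_succ_iff.mpr hij.1⟩, ⟨j, Nat.lt_succ_iff.mpr hij.2⟩)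
      rw [← h1, Int.cast_mul, abs_mul, Fintype.card_prod, Fintype.card_fin, Fintype.card_fin] at h2
      refine le_trans ?_ h2
      have : (1 : ℝ) ≤ |(z : ℝ)| := by exact_mod_cast Int.one_le_abs hz
      exact le_mul_of_one_le_right (abs_nonneg _) this
    · have : (f.coeff j).coeff i = 0 := by
        by_cases hj : j ≤ e
        · exact coeff_eq_zero_of_natDegree_lt
            ((hfd.2 j).trans_lt (not_le.mp fun hi => hij ⟨hi, hj⟩))
        · rw [coeff_eq_zero_of_natDegree_lt (hfd.1.trans_lt (not_le.mp hj)), coeff_zero]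
      rw [this, Int.cast_zero, abs_zero]
      have := hP.one_le_pow_mul_pow d e
      positivity
  · left
    have := card_common_zeros_le hP.injOn hf (he ▸ he0) hfg hfd (biDegLE_polyOf c) h0
      fun i hi => biEval_polyOf_eq_zero (hP.v_ne i hi) (hP.a_ne i hi) (hcS i hi)
    rwa [← two_mul] at this

lemma PointFamily.det_monoRow_le (hP : PointFamily S u v a b B A) (d e : ℕ)
    (q : Fin (d + 1) × Fin (e + 1) → ι) (hq : ∀ n, q n ∈ S) :
    |((Matrix.of fun n => monoRow d e (u (q n)) (v (q n)) (a (q n)) (b (q n))).det : ℝ)| ≤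
      ((d + 1) * (e + 1)).factorial * (B ^ d * A ^ e) ^ ((d + 1) * (e + 1)) := by
  have h1 := Matrix.det_le (A := (Matrix.of fun n => monoRow d e (u (q n)) (v (q n)) (a (q n))
    (b (q n))).map (Int.castRingHom ℝ)) (abv := AbsoluteValue.abs) (x := B ^ d * A ^ e)
    (fun i j => by simpa using hP.monoRow_le (hq i) d e j)
  have h2 := RingHom.map_det (Int.castRingHom ℝ)
    (Matrix.of fun n => monoRow d e (u (q n)) (v (q n)) (a (q n)) (b (q n)))
  rw [RingHom.mapMatrix_apply] at h2
  rw [← h2] at h1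
  simpa [Fintype.card_prod] using h1

/-- The zeros of an irreducible polynomial in a nonsingular residue class modulo a large prime are
boundedly many. -/
lemma PointFamily.card_le_of_residue_class (hP : PointFamily S u v a b B A) {f : ℤ[X][X]}
    {d E D : ℕ} (hf : Irreducible f) (he : f.natDegree = E + 1) (hfd : BiDegLE d (E + 1) f)
    (h0 : VanishesOn S u v a b f) {p : ℕ} (hp : p.Prime) (ω τ : ℤ)
    (hder : ¬ (p : ℤ) ∣ biEval ω τ (derivative f))
    (hv : ∀ i ∈ S, ¬ (p : ℤ) ∣ v i) (ha : ∀ i ∈ S, ¬ (p : ℤ) ∣ a i)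
    (hω : ∀ i ∈ S, (p : ℤ) ∣ u i - ω * v i) (hτ : ∀ i ∈ S, (p : ℤ) ∣ b i - τ * a i)
    (hsize : ((D + 1) * (E + 1)).factorial * (B ^ D * A ^ E) ^ ((D + 1) * (E + 1)) <
      (p : ℝ) ^ ((D + 1) * (E + 1) * ((D + 1) * (E + 1) - 1) / 2)) :
    S.card ≤ (2 * E + 1) * max d D := by
  classical
  obtain ⟨c, hc, -, hcS⟩ := exists_kernel_vector S
    (fun i => monoRow D E (u i) (v i) (a i) (b i)) (hP.one_le_pow_mul_pow D E)
    (fun i hi n => hP.monoRow_le hi D E n) (fun q hq => by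
      have h1 := pow_dvd_det_monoRow hp hfd ω τ hder (D := D) (E := E) (u := u) (v := v) (a := a)
        (b := b) q (fun n => hv _ (hq n)) (fun n => ha _ (hq n)) (fun n => hω _ (hq n))
        (fun n => hτ _ (hq n)) (fun n => hP.v_ne _ (hq n)) (fun n => hP.a_ne _ (hq n))
        (fun n => h0 _ (hq n))
      refine Int.eq_zero_of_abs_lt_dvd h1 ?_
      have h2 := (hP.det_monoRow_le D E q hq).trans_lt hsize
      exact_mod_cast h2)
  have hfg : ¬ f ∣ polyOf c := fun h => by
    have h1 := natDegree_le_of_dvd h (polyOf_ne_zero hc)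
    have h2 := (biDegLE_polyOf c).1
    omega
  have := card_common_zeros_le hP.injOn hf (by omega) hfg (d := max d D)
    ⟨hfd.1, fun j => (hfd.2 j).trans (le_max_left _ _)⟩
    ⟨(biDegLE_polyOf c).1, fun j => ((biDegLE_polyOf c).2 j).trans (le_max_right _ _)⟩ h0
    fun i hi => biEval_polyOf_eq_zero (hP.v_ne i hi) (hP.a_ne i hi) (hcS i hi)
  convert this using 2
  ring

end

lemma exists_primes (r : ℕ) : ∀ P : ℕ, P ≠ 0 → ∃ T : Finset ℕ, T.card = r ∧
    ∀ p ∈ T, p.Prime ∧ P < p ∧ p ≤ 2 ^ r * P := by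
  classical
  induction r with
  | zero => exact fun P _ => ⟨∅, by simp⟩
  | succ r ih =>
    intro P hP
    obtain ⟨p, hp, hp1, hp2⟩ := Nat.exists_prime_lt_and_le_two_mul P hP
    obtain ⟨T, hT, hTp⟩ := ih (2 * P) (by omega)
    have hpT : p ∉ T := fun h => by have := (hTp p h).2.1; omega
    refine ⟨insert p T, by rw [Finset.card_insert_of_notMem hpT, hT], fun q hq => ?_⟩
    rcases Finset.mem_insert.mp hq with rfl | hq
    · refine ⟨hp, hp1, hp2.trans ?_⟩
      exact Nat.mul_le_mul_right _ (Nat.le_self_pow (by omega) 2)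
    · obtain ⟨h1, h2, h3⟩ := hTp q hq
      refine ⟨h1, by omega, h3.trans_eq (by ring)⟩

lemma abs_homEval_le {n : ℕ} {r : ℤ[X]} {u v : ℤ} {H B : ℝ} (hr : ∀ i, |(r.coeff i : ℝ)| ≤ H)
    (hu : |(u : ℝ)| ≤ B) (hv : |(v : ℝ)| ≤ B) :
    |(homEval n r u v : ℝ)| ≤ (n + 1) * H * B ^ n := by
  have hH : 0 ≤ H := (abs_nonneg _).trans (hr 0)
  rw [homEval]
  push_cast
  refine (Finset.abs_sum_le_sum_abs _ _).trans ?_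
  refine (Finset.sum_le_card_nsmul _ _ (H * B ^ n) fun i hi => ?_).trans ?_
  · rw [mul_assoc, abs_mul]
    exact mul_le_mul (hr i) (pow_mul_pow_sub_le hu hv (Nat.lt_succ_iff.mp (Finset.mem_range.mp hi)))
      (abs_nonneg _) hH
  · rw [Finset.card_range, nsmul_eq_mul]; push_cast; rw [mul_assoc]

/-- The discriminant (up to normalization) of `f` with respect to the outer variable. -/
noncomputable def discOf (f : ℤ[X][X]) : ℤ[X] :=
  resultant f (derivative f) * f.leadingCoeff

/-- The size of the Sylvester matrix of `f` and its derivative. -/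
noncomputable def discSize (f : ℤ[X][X]) : ℕ := f.natDegree + (derivative f).natDegree

lemma discOf_ne_zero {f : ℤ[X][X]} (hf : Irreducible f) (hf0 : f.natDegree ≠ 0) :
    discOf f ≠ 0 := by
  let : NormalizedGCDMonoid ℤ[X] := Classical.choice inferInstance
  refine mul_ne_zero (resultant_ne_zero_of_irreducible hf hf0 fun h => ?_)
    (leadingCoeff_ne_zero.mpr hf.ne_zero)
  have hne : derivative f ≠ 0 := fun h => hf0 (derivative_eq_zero.mp h)
  have h1 := natDegree_le_of_dvd h hne
  have h2 := natDegree_derivative_lt hf0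
  omega

lemma natDegree_coeff_derivative_le {d e : ℕ} {f : ℤ[X][X]} (hfd : BiDegLE d e f) (j : ℕ) :
    ((derivative f).coeff j).natDegree ≤ d := by
  rw [coeff_derivative]
  have : ((j : ℤ[X]) + 1) = C ((j : ℤ) + 1) := by simp
  rw [this]
  exact (natDegree_mul_C_le _ _).trans (hfd.2 _)

lemma natDegree_discOf_le {d e : ℕ} {f : ℤ[X][X]} (hfd : BiDegLE d e f) :
    (discOf f).natDegree ≤ d * (discSize f + 1) := by
  refine natDegree_mul_le.trans ?_
  have h1 : (resultant f (derivative f)).natDegree ≤ discSize f * d := by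
    have := natDegree_det_le (sylvester f (derivative f) f.natDegree (derivative f).natDegree)
      (d := d) (sylvester_induction (P := fun r => r.natDegree ≤ d) (by simp) f _ hfd.2
        (natDegree_coeff_derivative_le hfd) _ _)
    rwa [Fintype.card_fin] at this
  have h2 : f.leadingCoeff.natDegree ≤ d := hfd.2 _
  calc _ ≤ discSize f * d + d := Nat.add_le_add h1 h2
    _ = _ := by ring

lemma abs_homEval_discOf_le {d e : ℕ} {f : ℤ[X][X]} (hfd : BiDegLE d e f) (he : 1 ≤ e)
    {u v : ℤ} {H B : ℝ}
    (hH : ∀ i j, |((f.coeff j).coeff i : ℝ)| ≤ H) (hv0 : v ≠ 0)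
    (hu : |(u : ℝ)| ≤ B) (hv : |(v : ℝ)| ≤ B) :
    |(homEval (d * (discSize f + 1)) (discOf f) u v : ℝ)| ≤
      (discSize f).factorial * (e * ((d + 1) * H * B ^ d)) ^ (discSize f + 1) := by
  have hv0' : (v : ℝ) ≠ 0 := by exact_mod_cast hv0
  set w : ℝ := u / v with hw
  have huw : (u : ℝ) = v * w := by rw [hw]; field_simp
  set φ := eval₂RingHom (Int.castRingHom ℝ) w with hφ
  set Q := e * ((d + 1) * H * B ^ d) with hQ
  have hH0 : 0 ≤ H := (abs_nonneg _).trans (hH 0 0)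
  have hB0 : 0 ≤ B := (abs_nonneg _).trans hu
  have he' : (1 : ℝ) ≤ e := by exact_mod_cast he
  have hQ0 : (d + 1) * H * B ^ d ≤ Q := le_mul_of_one_le_left (by positivity) he'
  have hQ00 : 0 ≤ Q := by positivity
  have hcoeff : ∀ j, |(v : ℝ) ^ d * φ (f.coeff j)| ≤ (d + 1) * H * B ^ d := fun j => by
    rw [hφ, coe_eval₂RingHom, ← cast_homEval (hfd.2 j) huw]
    exact abs_homEval_le (fun i => hH i j) hu hv
  have hder : ∀ j, |(v : ℝ) ^ d * φ ((derivative f).coeff j)| ≤ Q := fun j => by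
    rw [coeff_derivative, map_mul, ← mul_assoc, abs_mul, mul_comm]
    by_cases hj : j + 1 ≤ e
    · refine mul_le_mul ?_ (hcoeff _) (abs_nonneg _) (by positivity)
      rw [map_add, map_natCast, map_one, abs_of_nonneg (by positivity)]
      exact_mod_cast hj
    · rw [coeff_eq_zero_of_natDegree_lt (by have := hfd.1; omega)]
      simpa using hQ00
  rw [cast_homEval (natDegree_discOf_le hfd) huw, ← coe_eval₂RingHom, ← hφ, discOf, map_mul,
    ← resultant_map_map]
  have hdet : |(v : ℝ) ^ (d * discSize f) * (sylvester (f.map φ) ((derivative f).map φ) f.natDegree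
      (derivative f).natDegree).det| ≤ (discSize f).factorial * Q ^ discSize f := by
    have h1 := Matrix.det_smul (sylvester (f.map φ) ((derivative f).map φ) f.natDegree
      (derivative f).natDegree) ((v : ℝ) ^ d)
    rw [Fintype.card_fin, ← pow_mul] at h1
    have h2 := Matrix.det_le (A := (v : ℝ) ^ d • sylvester (f.map φ) ((derivative f).map φ)
      f.natDegree (derivative f).natDegree) (abv := AbsoluteValue.abs) (x := Q) (fun i j => by
        refine sylvester_induction (P := fun r => |(v : ℝ) ^ d * r| ≤ Q) (by simpa using hQ00) _ _
          (fun j => ?_) (fun j => ?_) _ _ i j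
        · rw [coeff_map]; exact (hcoeff j).trans hQ0
        · rw [coeff_map]; exact hder j)
    rw [h1, Fintype.card_fin] at h2
    simpa [discSize] using h2
  calc _ = |(v : ℝ) ^ (d * discSize f) * (sylvester (f.map φ) ((derivative f).map φ) f.natDegree
      (derivative f).natDegree).det| * |(v : ℝ) ^ d * φ f.leadingCoeff| := by
        rw [← abs_mul, resultant]; congr 1; ring
    _ ≤ (discSize f).factorial * Q ^ discSize f * Q :=
        mul_le_mul hdet ((hcoeff _).trans hQ0) (abs_nonneg _) (by positivity)
    _ = _ := by ring

/-- At a zero whose discriminant is prime to `p`, the leading coefficient and the derivative do not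
vanish modulo `p`. -/
lemma exists_zmod_point {p : ℕ} [Fact p.Prime] {d e : ℕ} {f : ℤ[X][X]} (hf0 : f.natDegree ≠ 0)
    (hfd : BiDegLE d e f) {u v a b : ℤ} (hv0 : v ≠ 0) (ha0 : a ≠ 0) (hab : IsCoprime a b)
    (h0 : biEval ((u : ℚ) / v) ((b : ℚ) / a) f = 0) (hv : ¬ (p : ℤ) ∣ v)
    (hN : ¬ (p : ℤ) ∣ homEval (d * (discSize f + 1)) (discOf f) u v) :
    ¬ (p : ℤ) ∣ a ∧ ∃ ω τ : ZMod p, (u : ZMod p) = v * ω ∧ (b : ZMod p) = a * τ ∧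
      biEval ω τ f = 0 ∧ biEval ω τ (derivative f) ≠ 0 ∧
      f.map (eval₂RingHom (Int.castRingHom (ZMod p)) ω) ≠ 0 := by
  have hv' : (v : ZMod p) ≠ 0 := by rwa [Ne, ZMod.intCast_zmod_eq_zero_iff_dvd]
  set ω : ZMod p := u / v with hω
  have huω : (u : ZMod p) = v * ω := by rw [hω]; field_simp
  set φ := eval₂RingHom (Int.castRingHom (ZMod p)) ω with hφ
  have hD : φ (discOf f) ≠ 0 := fun h => by
    apply hN
    rw [← ZMod.intCast_zmod_eq_zero_iff_dvd, cast_homEval (natDegree_discOf_le hfd) huω,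
      ← coe_eval₂RingHom, ← hφ, h, mul_zero]
  rw [discOf, map_mul] at hD
  have hlc := right_ne_zero_of_mul hD
  have hres := left_ne_zero_of_mul hD
  have hsum : ∑ j ∈ Finset.range (f.natDegree + 1),
      homEval d (f.coeff j) u v * (b ^ j * a ^ (f.natDegree - j)) = 0 := by
    have h1 := sum_monoRow_eq_zero ⟨le_rfl, hfd.2⟩ hv0 ha0 h0
    rw [Fintype.sum_prod_type_right] at h1
    rw [Finset.sum_range, ← h1]
    refine Finset.sum_congr rfl fun j _ => ?_
    rw [homEval, Finset.sum_range, Finset.sum_mul]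
    refine Finset.sum_congr rfl fun i _ => ?_
    rw [monoRow]; ring
  have ha : ¬ (p : ℤ) ∣ a := fun hpa => by
    have hp := Nat.prime_iff_prime_int.mp (Fact.out : p.Prime)
    rw [Finset.sum_range_succ, Nat.sub_self, pow_zero, mul_one] at hsum
    have h1 : (p : ℤ) ∣ homEval d (f.coeff f.natDegree) u v * b ^ f.natDegree := by
      have h2 : (p : ℤ) ∣ ∑ j ∈ Finset.range f.natDegree,
          homEval d (f.coeff j) u v * (b ^ j * a ^ (f.natDegree - j)) :=
        Finset.dvd_sum fun j hj => by
          have : f.natDegree - j ≠ 0 := by have := Finset.mem_range.mp hj; omega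
          exact dvd_mul_of_dvd_right (dvd_mul_of_dvd_right (dvd_pow hpa this) _) _
      exact (Int.dvd_add_right h2).mp (hsum ▸ dvd_zero _)
    rcases hp.dvd_or_dvd h1 with h2 | h2
    · apply hlc
      rw [← ZMod.intCast_zmod_eq_zero_iff_dvd, cast_homEval (hfd.2 _) huω] at h2
      exact (mul_eq_zero.mp h2).resolve_left (pow_ne_zero _ hv')
    · exact hp.not_isUnit (hab.isUnit_of_dvd' hpa (hp.dvd_of_dvd_pow h2))
  have ha' : (a : ZMod p) ≠ 0 := by rwa [Ne, ZMod.intCast_zmod_eq_zero_iff_dvd]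
  set τ : ZMod p := b / a with hτ
  have hbτ : (b : ZMod p) = a * τ := by rw [hτ]; field_simp
  have hzero : biEval ω τ f = 0 := by
    have h1 := sum_monoRow_eq_zero hfd hv0 ha0 h0
    have h2 := sum_coeff_mul_monoRow huω hbτ hfd
    rw [h1, Int.cast_zero] at h2
    exact (mul_eq_zero.mp h2.symm).resolve_left (mul_ne_zero (pow_ne_zero _ hv') (pow_ne_zero _ ha'))
  refine ⟨ha, ω, τ, huω, hbτ, hzero, fun h => hres ?_, fun h => hlc ?_⟩
  · obtain ⟨P, Q, -, -, hPQ⟩ := exists_mul_add_mul_eq_C_resultant f (derivative f) le_rfl le_rfl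
      (Or.inl hf0)
    have := congrArg (biEval ω τ) hPQ
    rw [map_add, map_mul, map_mul, hzero, h, zero_mul, zero_mul, add_zero, biEval_C] at this
    exact this.symm
  · have := congrArg (fun g => g.coeff f.natDegree) h
    simpa [hφ] using this

/-- Counting the zeros with discriminant prime to `p`, by distributing them into residue classes. -/
lemma PointFamily.card_le_of_prime {ι : Type} {S : Finset ι} {u v a b : ι → ℤ} {B A : ℝ}
    (hP : PointFamily S u v a b B A) {f : ℤ[X][X]}
    {d E D : ℕ} (hf : Irreducible f) (he : f.natDegree = E + 1) (hfd : BiDegLE d (E + 1) f)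
    (h0 : VanishesOn S u v a b f) {p : ℕ} (hp : p.Prime) (hBp : B < p)
    (hN : ∀ i ∈ S, ¬ (p : ℤ) ∣ homEval (d * (discSize f + 1)) (discOf f) (u i) (v i))
    (hsize : ((D + 1) * (E + 1)).factorial * (B ^ D * A ^ E) ^ ((D + 1) * (E + 1)) <
      (p : ℝ) ^ ((D + 1) * (E + 1) * ((D + 1) * (E + 1) - 1) / 2)) :
    S.card ≤ (2 * E + 1) * max d D * ((E + 1) * p) := by
  classical
  have : Fact p.Prime := ⟨hp⟩
  have hv : ∀ i ∈ S, ¬ (p : ℤ) ∣ v i := fun i hi h => by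
    have h1 := Int.le_of_dvd (abs_pos.mpr (hP.v_ne i hi)) ((dvd_abs _ _).mpr h)
    have h2 := (hP.v_le i hi).trans_lt hBp
    have h3 : |v i| < p := by exact_mod_cast h2
    omega
  have key := fun i (hi : i ∈ S) => exists_zmod_point (p := p) (by omega) hfd (hP.v_ne i hi)
    (hP.a_ne i hi) (hP.coprime_ab i hi) (h0 i hi) (hv i hi) (hN i hi)
  choose! ω τ hpt using fun i hi => (key i hi).2
  have hfib : ∀ c ∈ S.image fun i => (ω i, τ i),
      (S.filter fun i => (ω i, τ i) = c).card ≤ (2 * E + 1) * max d D := by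
    intro c hc
    obtain ⟨i₀, hi₀, rfl⟩ := Finset.mem_image.mp hc
    have hsub : (S.filter fun i => (ω i, τ i) = (ω i₀, τ i₀)) ⊆ S := Finset.filter_subset _ _
    have hmem : ∀ i ∈ S.filter fun i => (ω i, τ i) = (ω i₀, τ i₀), i ∈ S ∧ ω i = ω i₀ ∧ τ i = τ i₀ :=
      fun i hi => by simpa using hi
    obtain ⟨W, hW⟩ := ZMod.intCast_surjective (ω i₀)
    obtain ⟨T, hT⟩ := ZMod.intCast_surjective (τ i₀)
    refine (hP.subset hsub).card_le_of_residue_class (D := D) hf he hfd (fun i hi => h0 i (hsub hi))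
      hp W T ?_ (fun i hi => hv i (hsub hi)) (fun i hi => (key i (hsub hi)).1) (fun i hi => ?_)
      (fun i hi => ?_) hsize
    · rw [← ZMod.intCast_zmod_eq_zero_iff_dvd, ← eq_intCast (Int.castRingHom (ZMod p)), map_biEval]
      simpa [hW, hT] using (hpt i₀ hi₀).2.2.2.1
    · obtain ⟨hiS, h1, h2⟩ := hmem i hi
      rw [← ZMod.intCast_zmod_eq_zero_iff_dvd]
      push_cast
      rw [hW, (hpt i hiS).1, h1]; ring
    · obtain ⟨hiS, h1, h2⟩ := hmem i hi
      rw [← ZMod.intCast_zmod_eq_zero_iff_dvd]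
      push_cast
      rw [hT, (hpt i hiS).2.1, h2]; ring
  have himg : (S.image fun i => (ω i, τ i)).card ≤ (E + 1) * p := by
    refine (Finset.card_le_mul_card_image (f := Prod.fst) _ (E + 1) fun x hx => ?_).trans ?_
    · obtain ⟨c, hc, rfl⟩ := Finset.mem_image.mp hx
      obtain ⟨i₀, hi₀, rfl⟩ := Finset.mem_image.mp hc
      have h1 := (hpt i₀ hi₀).2.2.2.2
      set F := f.map (eval₂RingHom (Int.castRingHom (ZMod p)) (ω i₀)) with hF
      calc _ ≤ (F.roots.toFinset.image fun t => (ω i₀, t)).card := by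
            refine Finset.card_le_card fun c hc => ?_
            rw [Finset.mem_filter, Finset.mem_image] at hc
            obtain ⟨⟨i, hi, rfl⟩, h2⟩ := hc
            have h2 : ω i = ω i₀ := h2
            refine Finset.mem_image.mpr ⟨τ i, ?_, by rw [h2]⟩
            rw [Multiset.mem_toFinset, mem_roots h1, IsRoot, hF, eval_map, ← h2]
            exact (hpt i hi).2.2.1
        _ ≤ F.roots.toFinset.card := Finset.card_image_le
        _ ≤ F.roots.card := Multiset.toFinset_card_le _
        _ ≤ F.natDegree := card_roots' _
        _ ≤ f.natDegree := natDegree_map_le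
        _ = E + 1 := he
    · refine Nat.mul_le_mul_left _ ((Finset.card_le_univ _).trans_eq (ZMod.card p))
  calc S.card ≤ ((2 * E + 1) * max d D) * (S.image fun i => (ω i, τ i)).card :=
        Finset.card_le_mul_card_image _ _ hfib
    _ ≤ _ := Nat.mul_le_mul_left _ himg

lemma pow_le_rpow_pow {L ε : ℝ} (hL : 1 ≤ L) {c r : ℕ} (h : (c : ℝ) ≤ ε * r) :
    L ^ c ≤ (L ^ ε) ^ r := by
  rw [← Real.rpow_natCast, ← Real.rpow_natCast (L ^ ε), ← Real.rpow_mul (by linarith)]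
  exact Real.rpow_le_rpow_of_exponent_le hL h

lemma exists_nat_le_mul {ε : ℝ} (hε : 0 < ε) (c : ℕ) : ∃ r : ℕ, 1 ≤ r ∧ (c : ℝ) ≤ ε * r := by
  obtain ⟨r, hr⟩ := exists_nat_ge ((c : ℝ) / ε)
  refine ⟨r + 1, by omega, ?_⟩
  rw [div_le_iff₀ hε] at hr
  push_cast
  nlinarith

/-- If `N` is nonzero and small, one of many large primes does not divide it. -/
lemma exists_prime_not_dvd {T : Finset ℕ} {P : ℕ} (hT : ∀ p ∈ T, p.Prime ∧ P < p) {N : ℤ}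
    (hN0 : N ≠ 0) (hN : |N| < (P : ℤ) ^ T.card) : ∃ p ∈ T, ¬ (p : ℤ) ∣ N := by
  by_contra! h
  have h1 : ∏ p ∈ T, p ∣ N.natAbs :=
    Finset.prod_primes_dvd _ (fun p hp => (hT p hp).1.prime) fun p hp =>
      Int.natCast_dvd.mp (h p hp)
  have h2 := Nat.le_of_dvd (Int.natAbs_pos.mpr hN0) h1
  have h3 : P ^ T.card ≤ ∏ p ∈ T, p := Finset.pow_card_le_prod _ _ _ fun p hp => (hT p hp).2.le
  have h4 : (P : ℤ) ^ T.card ≤ N.natAbs := by exact_mod_cast h3.trans h2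
  rw [Int.natCast_natAbs] at h4
  omega

lemma exists_card_le_of_two_le (d E : ℕ) (hE : 1 ≤ E) {ε : ℝ} (hε : 0 < ε) :
    ∃ C : ℝ, 0 < C ∧ ∀ (ι : Type) (S : Finset ι) (u v a b : ι → ℤ) (B A L : ℝ),
      PointFamily S u v a b B A → B ≤ L → A ≤ L → ∀ f : ℤ[X][X], Irreducible f →
      f.natDegree = E + 1 → BiDegLE d (E + 1) f → (∃ j, (f.coeff j).natDegree = d) →
      VanishesOn S u v a b f → (S.card : ℝ) ≤ C * (B * L ^ ε) := by
  classical
  set e := E + 1 with he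
  set n := (d + 1) * (e + 1) with hn
  set c := ((d + e) * n + d) * (2 * e + 1) with hc
  set K₁ : ℕ := (2 * e).factorial * (e * (d + 1) * n ^ n) ^ (2 * e + 1) with hK₁
  obtain ⟨D, hD1, hD⟩ := exists_nat_le_mul hε E
  obtain ⟨r, hr1, hr⟩ := exists_nat_le_mul hε c
  set H := (D + 1) * (E + 1) with hH
  set K : ℕ := K₁ + H.factorial + 1 with hK
  set C₂ : ℕ := (2 * E + 1) * max d D with hC₂
  set C : ℕ := 2 * e * d + d * (2 * e + 1) + r * (C₂ * (e * (2 ^ r * (K + 1)))) + 1 with hC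
  refine ⟨C, by positivity, ?_⟩
  intro ι S u v a b B A L hP hBL hAL f hf hfe hfd hfd' h0
  have hB1 := hP.one_le_B
  have hA1 := hP.one_le_A
  have hL1 : 1 ≤ L := hB1.trans hBL
  have hLε : 1 ≤ L ^ ε := Real.one_le_rpow hL1 hε.le
  have hBL1 : 1 ≤ B * L ^ ε := one_le_mul_of_one_le_of_one_le hB1 hLε
  rcases hP.card_le_or_coeff_le hf hfe (by omega) hfd hfd' h0 with hsmall | hcoeff
  · calc (S.card : ℝ) ≤ (2 * e * d : ℕ) := by exact_mod_cast hsmall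
      _ ≤ C := by rw [hC]; exact_mod_cast (by omega)
      _ ≤ C * (B * L ^ ε) := le_mul_of_one_le_right (by positivity) hBL1
  set P : ℕ := ⌈K * (B * L ^ ε)⌉₊ with hPdef
  have hKP : (K : ℝ) * (B * L ^ ε) ≤ P := Nat.le_ceil _
  have hK1 : (1 : ℝ) ≤ K := by exact_mod_cast (by omega : 1 ≤ K)
  have hP2 : (P : ℝ) ≤ (K + 1) * (B * L ^ ε) := by
    have := (Nat.ceil_lt_add_one (show 0 ≤ (K : ℝ) * (B * L ^ ε) by positivity)).le
    rw [hPdef]; linarith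
  have hBP : B ≤ P := by
    refine le_trans ?_ hKP
    calc B ≤ B * L ^ ε := le_mul_of_one_le_right (by linarith) hLε
      _ ≤ _ := le_mul_of_one_le_left (by positivity) hK1
  have hP0 : P ≠ 0 := by
    rintro h; rw [h] at hBP; norm_num at hBP; linarith
  obtain ⟨T, hTc, hT⟩ := exists_primes r P hP0
  set N : ι → ℤ := fun i => homEval (d * (discSize f + 1)) (discOf f) (u i) (v i) with hN
  have hs : discSize f ≤ 2 * e := by
    rw [discSize]
    have := natDegree_derivative_le f
    omega
  -- the discriminant values are small
  have hNle : ∀ i ∈ S, |N i| < (P : ℤ) ^ T.card := by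
    intro i hi
    have h1 := abs_homEval_discOf_le hfd (by omega) (fun i j => hcoeff i j) (hP.v_ne i hi)
      (hP.u_le i hi) (hP.v_le i hi)
    have h2 : (e * ((d + 1) * ((((d + 1) * (e + 1) : ℕ) * (B ^ d * A ^ e)) ^ ((d + 1) * (e + 1)))
        * B ^ d) : ℝ) ≤ (e * (d + 1) * n ^ n) * L ^ ((d + e) * n + d) := by
      calc _ ≤ (e * ((d + 1) * ((n * (L ^ d * L ^ e)) ^ n) * L ^ d) : ℝ) := by
            rw [← hn]; gcongr
        _ = _ := by rw [← pow_add, mul_pow, ← pow_mul, pow_add L _ d]; ring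
    have h3 : (1 : ℝ) ≤ (e * (d + 1) * n ^ n) * L ^ ((d + e) * n + d) := by
      refine one_le_mul_of_one_le_of_one_le ?_ (one_le_pow₀ hL1)
      have : 1 ≤ e * (d + 1) * n ^ n := Nat.succ_le_of_lt (by positivity)
      exact_mod_cast this
    have h4 : |(N i : ℝ)| ≤ K₁ * L ^ c := by
      refine h1.trans ?_
      calc _ ≤ ((2 * e).factorial : ℝ) *
            ((e * (d + 1) * n ^ n) * L ^ ((d + e) * n + d)) ^ (2 * e + 1) := by
            refine mul_le_mul ?_ ?_ (by positivity) (by positivity)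
            · exact_mod_cast Nat.factorial_le hs
            · refine (pow_le_pow_left₀ (by positivity) h2 _).trans
                (pow_le_pow_right₀ h3 (by omega))
        _ = _ := by rw [mul_pow, ← pow_mul, ← hc, hK₁]; push_cast; ring
    have h5 : (K₁ : ℝ) * L ^ c < (P : ℝ) ^ r := by
      calc (K₁ : ℝ) * L ^ c < K * L ^ c := by
            refine mul_lt_mul_of_pos_right ?_ (by positivity)
            exact_mod_cast (by omega)
        _ ≤ (K : ℝ) ^ r * (L ^ ε) ^ r := by
            refine mul_le_mul (le_self_pow₀ hK1 (by omega)) (pow_le_rpow_pow hL1 hr)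
              (by positivity) (by positivity)
        _ = ((K : ℝ) * L ^ ε) ^ r := (mul_pow _ _ _).symm
        _ ≤ (P : ℝ) ^ r := by
            refine pow_le_pow_left₀ (by positivity) (le_trans ?_ hKP) _
            refine mul_le_mul_of_nonneg_left ?_ (by positivity)
            exact le_mul_of_one_le_left (by positivity) hB1
    rw [hTc]
    exact_mod_cast h4.trans_lt h5
  have hsize : ∀ p ∈ T, ((D + 1) * (E + 1)).factorial * (B ^ D * A ^ E) ^ ((D + 1) * (E + 1)) <
      (p : ℝ) ^ ((D + 1) * (E + 1) * ((D + 1) * (E + 1) - 1) / 2) := by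
    intro p hp
    have hPp : (P : ℝ) ≤ p := by exact_mod_cast (hT p hp).2.1.le
    rw [← hH]
    have h1 : D * H ≤ H * (H - 1) / 2 := by
      rw [Nat.le_div_iff_mul_le two_pos]
      have : 2 * D + 1 ≤ H := by rw [hH]; nlinarith
      have : D * 2 ≤ H - 1 := by omega
      calc D * H * 2 = H * (D * 2) := by ring
        _ ≤ _ := Nat.mul_le_mul_left _ this
    have hp1 : (1 : ℝ) ≤ p := by exact_mod_cast (hT p hp).1.one_le
    have hH1 : H ≠ 0 := by positivity
    calc (H.factorial : ℝ) * (B ^ D * A ^ E) ^ H < K * (B ^ D * A ^ E) ^ H := by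
          refine mul_lt_mul_of_pos_right ?_ (by positivity)
          exact_mod_cast (by omega)
      _ ≤ (K : ℝ) ^ (D * H) * (B ^ D * (L ^ ε) ^ D) ^ H := by
          refine mul_le_mul (le_self_pow₀ hK1 (by positivity)) ?_ (by positivity) (by positivity)
          refine pow_le_pow_left₀ (by positivity) ?_ _
          refine mul_le_mul_of_nonneg_left ?_ (by positivity)
          exact (pow_le_pow_left₀ (by positivity) hAL _).trans (pow_le_rpow_pow hL1 hD)
      _ = ((K : ℝ) * (B * L ^ ε)) ^ (D * H) := by
          rw [← mul_pow B, ← pow_mul, ← mul_pow]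
      _ ≤ (p : ℝ) ^ (D * H) := pow_le_pow_left₀ (by positivity) (hKP.trans hPp) _
      _ ≤ _ := pow_le_pow_right₀ hp1 h1
  set S₀ := S.filter fun i => N i = 0 with hS₀
  set S' : ℕ → Finset ι := fun p => S.filter fun i => ¬ (p : ℤ) ∣ N i with hS'
  have hcover : S ⊆ S₀ ∪ T.biUnion S' := by
    intro i hi
    by_cases h : N i = 0
    · exact Finset.mem_union_left _ (Finset.mem_filter.mpr ⟨hi, h⟩)
    · obtain ⟨p, hp, hpN⟩ := exists_prime_not_dvd (fun p hp => ⟨(hT p hp).1, (hT p hp).2.1⟩) h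
        (hNle i hi)
      exact Finset.mem_union_right _
        (Finset.mem_biUnion.mpr ⟨p, hp, Finset.mem_filter.mpr ⟨hi, hpN⟩⟩)
  have hS₀c : S₀.card ≤ d * (2 * e + 1) := by
    refine (card_le_natDegree_of_eval₂_eq_zero (hP.subset (Finset.filter_subset _ _)).injOn
      (discOf_ne_zero hf (by omega)) fun i hi => ?_).trans ((natDegree_discOf_le hfd).trans
        (Nat.mul_le_mul_left _ (by omega)))
    obtain ⟨hiS, hi0⟩ := Finset.mem_filter.mp hi
    have hv : (v i : ℚ) ≠ 0 := by exact_mod_cast hP.v_ne i hiS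
    have := cast_homEval (R := ℚ) (natDegree_discOf_le hfd) (u := u i) (v := v i)
      (w := (u i : ℚ) / v i) (by field_simp)
    rw [show homEval _ _ (u i) (v i) = 0 from hi0, Int.cast_zero] at this
    exact (mul_eq_zero.mp this.symm).resolve_left (pow_ne_zero _ hv)
  have hS'c : ∀ p ∈ T, (S' p).card ≤ C₂ * (e * (2 ^ r * P)) := by
    intro p hp
    have hsub : S' p ⊆ S := Finset.filter_subset _ _
    have hBp : B < p := hBP.trans_lt (by exact_mod_cast (hT p hp).2.1)
    refine ((hP.subset hsub).card_le_of_prime (D := D) hf hfe hfd (fun i hi => h0 i (hsub hi))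
      (hT p hp).1 hBp (fun i hi => (Finset.mem_filter.mp hi).2) (hsize p hp)).trans ?_
    exact Nat.mul_le_mul_left _ (Nat.mul_le_mul_left _ (hT p hp).2.2)
  have htot : S.card ≤ d * (2 * e + 1) + r * (C₂ * (e * (2 ^ r * P))) := by
    refine (Finset.card_le_card hcover).trans ((Finset.card_union_le _ _).trans ?_)
    refine Nat.add_le_add hS₀c ?_
    exact (Finset.card_biUnion_le_card_mul _ _ _ hS'c).trans_eq (by rw [hTc])
  calc (S.card : ℝ) ≤ (d * (2 * e + 1) : ℕ) + r * (C₂ * (e * (2 ^ r * P))) := by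
        exact_mod_cast htot
    _ ≤ (2 * e * d + d * (2 * e + 1) + 1 : ℕ) * (B * L ^ ε) +
        r * (C₂ * (e * (2 ^ r * ((K + 1) * (B * L ^ ε))))) := by
        refine add_le_add ?_ (by gcongr)
        refine le_trans ?_ (le_mul_of_one_le_right (by positivity) hBL1)
        exact_mod_cast (by omega)
    _ = C * (B * L ^ ε) := by rw [hC]; push_cast; ring

/-- The divisor bound. -/
lemma exists_card_divisors_le {ε : ℝ} (hε : 0 < ε) :
    ∃ C : ℝ, 1 ≤ C ∧ ∀ n : ℕ, n ≠ 0 → (n.divisors.card : ℝ) ≤ C * (n : ℝ) ^ ε := by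
  obtain ⟨P, hP⟩ := exists_nat_ge ((2 : ℝ) ^ (1 / ε))
  obtain ⟨K, hK⟩ := exists_nat_ge (1 / (ε * Real.log 2))
  have hlog2 : 0 < Real.log 2 := Real.log_pos one_lt_two
  set K' : ℝ := K + 1 with hK'
  have hK1 : 1 ≤ K' := by rw [hK']; linarith [Nat.cast_nonneg (α := ℝ) K]
  refine ⟨K' ^ P, one_le_pow₀ hK1, fun n hn => ?_⟩
  have hlarge : ∀ (p a : ℕ), P ≤ p → ((a : ℝ) + 1) ≤ ((p : ℝ) ^ a) ^ ε := by
    intro p a hp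
    have h1 : (2 : ℝ) ≤ (p : ℝ) ^ ε := by
      have : (2 : ℝ) ^ (1 / ε) ≤ p := hP.trans (by exact_mod_cast hp)
      calc (2 : ℝ) = ((2 : ℝ) ^ (1 / ε)) ^ ε := by
            rw [← Real.rpow_mul zero_le_two, one_div_mul_cancel hε.ne', Real.rpow_one]
        _ ≤ _ := Real.rpow_le_rpow (by positivity) this hε.le
    rw [← Real.rpow_natCast, ← Real.rpow_mul (Nat.cast_nonneg _), mul_comm,
      Real.rpow_mul (Nat.cast_nonneg _), Real.rpow_natCast]
    calc (a : ℝ) + 1 ≤ 2 ^ a := by exact_mod_cast Nat.lt_two_pow_self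
      _ ≤ _ := pow_le_pow_left₀ zero_le_two h1 _
  have hsmall : ∀ (p a : ℕ), 2 ≤ p → ((a : ℝ) + 1) ≤ K' * ((p : ℝ) ^ a) ^ ε := by
    intro p a hp
    have h1 : (a : ℝ) * (ε * Real.log 2) + 1 ≤ ((p : ℝ) ^ a) ^ ε := by
      calc (a : ℝ) * (ε * Real.log 2) + 1 ≤ Real.exp (a * (ε * Real.log 2)) :=
            Real.add_one_le_exp _
        _ = ((2 : ℝ) ^ a) ^ ε := by
            rw [Real.rpow_def_of_pos (by positivity), Real.log_pow]; ring_nf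
        _ ≤ _ := by
            refine Real.rpow_le_rpow (by positivity) ?_ hε.le
            exact pow_le_pow_left₀ zero_le_two (by exact_mod_cast hp) _
    have h2 : 1 ≤ K * (ε * Real.log 2) := by
      rwa [div_le_iff₀ (by positivity)] at hK
    have h3 : (a : ℝ) ≤ K * (a * (ε * Real.log 2)) := by
      have := mul_le_mul_of_nonneg_left h2 (Nat.cast_nonneg (α := ℝ) a)
      linarith
    have h4 : 0 ≤ (a : ℝ) * (ε * Real.log 2) := by positivity
    have h5 : K' * (a * (ε * Real.log 2) + 1) ≤ K' * ((p : ℝ) ^ a) ^ ε :=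
      mul_le_mul_of_nonneg_left h1 (by linarith)
    have : (0 : ℝ) ≤ K := Nat.cast_nonneg _
    rw [hK'] at h5 ⊢
    nlinarith
  have hnε : (n : ℝ) ^ ε = ∏ p ∈ n.primeFactors, ((p : ℝ) ^ n.factorization p) ^ ε := by
    rw [Real.finsetProd_rpow _ _ fun p _ => by positivity]
    congr 1
    conv_lhs => rw [← Nat.prod_factorization_pow_eq_self hn]
    rw [Finsupp.prod, Nat.support_factorization]
    push_cast
    rfl
  rw [Nat.card_divisors hn, hnε]
  push_cast
  calc ∏ p ∈ n.primeFactors, ((n.factorization p : ℝ) + 1)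
      ≤ ∏ p ∈ n.primeFactors, ((if p < P then K' else 1) * ((p : ℝ) ^ n.factorization p) ^ ε) := by
        refine Finset.prod_le_prod (fun p _ => by positivity) fun p hp => ?_
        split_ifs with h
        · exact hsmall _ _ (Nat.prime_of_mem_primeFactors hp).two_le
        · rw [one_mul]; exact hlarge _ _ (not_lt.mp h)
    _ = (∏ p ∈ n.primeFactors, (if p < P then K' else 1)) *
        ∏ p ∈ n.primeFactors, ((p : ℝ) ^ n.factorization p) ^ ε := Finset.prod_mul_distrib
    _ ≤ _ := by
        refine mul_le_mul_of_nonneg_right ?_ (Finset.prod_nonneg fun p _ => by positivity)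
        rw [Finset.prod_ite, Finset.prod_const_one, mul_one, Finset.prod_const]
        refine pow_le_pow_right₀ hK1 ?_
        calc _ ≤ (Finset.range P).card := Finset.card_le_card fun p hp =>
              Finset.mem_range.mpr (Finset.mem_filter.mp hp).2
          _ = P := Finset.card_range P

lemma BiDegLE.mul {d e d' e' : ℕ} {f g : ℤ[X][X]} (hf : BiDegLE d e f) (hg : BiDegLE d' e' g) :
    BiDegLE (d + d') (e + e') (f * g) := by
  refine ⟨natDegree_mul_le.trans (Nat.add_le_add hf.1 hg.1), fun j => ?_⟩
  rw [coeff_mul]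
  exact natDegree_sum_le_of_forall_le _ _ fun x _ =>
    natDegree_mul_le.trans (Nat.add_le_add (hf.2 _) (hg.2 _))

lemma BiDegLE.add {d e : ℕ} {f g : ℤ[X][X]} (hf : BiDegLE d e f) (hg : BiDegLE d e g) :
    BiDegLE d e (f + g) := by
  refine ⟨natDegree_add_le_of_degree_le hf.1 hg.1, fun j => ?_⟩
  rw [coeff_add]
  exact natDegree_add_le_of_degree_le (hf.2 _) (hg.2 _)

lemma BiDegLE.mono {d e d' e' : ℕ} {f : ℤ[X][X]} (hf : BiDegLE d e f) (hd : d ≤ d') (he : e ≤ e') :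
    BiDegLE d' e' f := ⟨hf.1.trans he, fun j => (hf.2 j).trans hd⟩

lemma biDegLE_C {d e : ℕ} {r : ℤ[X]} (hr : r.natDegree ≤ d) : BiDegLE d e (C r) := by
  refine ⟨by simp, fun j => ?_⟩
  rw [coeff_C]
  split_ifs <;> simp [hr]

lemma biDegLE_X {d : ℕ} : BiDegLE d 1 X := by
  refine ⟨natDegree_X_le, fun j => ?_⟩
  rw [coeff_X]
  split_ifs <;> simp

lemma BiDegLE.pow {d e : ℕ} {f : ℤ[X][X]} (hf : BiDegLE d e f) (k : ℕ) :
    BiDegLE (k * d) (k * e) (f ^ k) := by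
  induction k with
  | zero => simpa using biDegLE_C (d := 0) (e := 0) (r := 1) (by simp)
  | succ k ih =>
    rw [pow_succ, add_mul, add_mul, one_mul, one_mul]
    exact ih.mul hf

lemma biDegLE_sum {κ : Type*} (s : Finset κ) {d e : ℕ} {f : κ → ℤ[X][X]}
    (hf : ∀ i ∈ s, BiDegLE d e (f i)) : BiDegLE d e (∑ i ∈ s, f i) := by
  refine Finset.sum_induction _ _ (fun _ _ => BiDegLE.add) ?_ hf
  simpa using biDegLE_C (d := d) (e := e) (r := 0) (by simp)

/-- A plane curve has few integral points in a box. -/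
lemma card_integer_zeros_le {F : ℤ[X][X]} (hF : F ≠ 0) {d e : ℕ} (hd : BiDegLE d e F) (N : ℕ)
    (S : Finset (ℤ × ℤ)) (hS : ∀ z ∈ S, |z.1| ≤ N ∧ |z.2| ≤ N) (h0 : ∀ z ∈ S, biEval z.1 z.2 F = 0) :
    S.card ≤ (d + e) * (2 * N + 1) := by
  classical
  set I : Finset ℤ := Finset.Icc (-N : ℤ) N with hI
  have hIc : I.card = 2 * N + 1 := by rw [hI, Int.card_Icc]; omega
  have hmem : ∀ z ∈ S, z.1 ∈ I ∧ z.2 ∈ I := fun z hz =>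
    ⟨Finset.mem_Icc.mpr (abs_le.mp (hS z hz).1), Finset.mem_Icc.mpr (abs_le.mp (hS z hz).2)⟩
  set r := F.leadingCoeff with hr
  have hr0 : r ≠ 0 := leadingCoeff_ne_zero.mpr hF
  set φ : ℤ → ℤ[X] →+* ℤ := fun u => eval₂RingHom (Int.castRingHom ℤ) u with hφ
  set S₁ := S.filter fun z => φ z.1 r = 0
  set S₂ := S.filter fun z => ¬ φ z.1 r = 0
  have h1 : S₁.card ≤ d * (2 * N + 1) := by
    have hsub : S₁ ⊆ r.roots.toFinset ×ˢ I := fun z hz => by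
      obtain ⟨hzS, hz0⟩ := Finset.mem_filter.mp hz
      refine Finset.mem_product.mpr ⟨?_, (hmem z hzS).2⟩
      rw [Multiset.mem_toFinset, mem_roots hr0, IsRoot]
      have hid : Int.castRingHom ℤ = RingHom.id ℤ := RingHom.ext fun _ => rfl
      rwa [hφ, coe_eval₂RingHom, hid, ← eval] at hz0
    refine (Finset.card_le_card hsub).trans ?_
    rw [Finset.card_product, hIc]
    refine Nat.mul_le_mul_right _ ?_
    exact (Multiset.toFinset_card_le _).trans ((card_roots' _).trans (hd.2 _))
  have h2 : S₂.card ≤ e * (2 * N + 1) := by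
    rw [← hIc]
    refine (Finset.card_le_mul_card_image (f := Prod.fst) S₂ e fun x hx => ?_).trans
      (Nat.mul_le_mul_left _ (Finset.card_le_card fun x hx => ?_))
    · obtain ⟨z₀, hz₀, rfl⟩ := Finset.mem_image.mp hx
      have hne : F.map (φ z₀.1) ≠ 0 := fun h => (Finset.mem_filter.mp hz₀).2 (by
        simpa using congrArg (fun g => g.coeff F.natDegree) h)
      calc _ ≤ ((F.map (φ z₀.1)).roots.toFinset.image fun t => (z₀.1, t)).card := by
            refine Finset.card_le_card fun z hz => ?_
            obtain ⟨hz, hzz⟩ := Finset.mem_filter.mp hz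
            refine Finset.mem_image.mpr ⟨z.2, ?_, by rw [← hzz]⟩
            rw [Multiset.mem_toFinset, mem_roots hne, IsRoot, eval_map, ← hzz]
            exact h0 z (Finset.mem_filter.mp hz).1
        _ ≤ _ := Finset.card_image_le
        _ ≤ _ := Multiset.toFinset_card_le _
        _ ≤ _ := card_roots' _
        _ ≤ _ := natDegree_map_le
        _ ≤ e := hd.1
    · obtain ⟨z, hz, rfl⟩ := Finset.mem_image.mp hx
      exact (hmem z (Finset.mem_filter.mp hz).1).1
  rw [← Finset.card_filter_add_card_filter_not (s := S) (fun z => φ z.1 r = 0), add_mul]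
  exact Nat.add_le_add h1 h2

lemma resultant_ne_zero_of_forall_irreducible {R : Type*} [CommRing R] [IsDomain R]
    [UniqueFactorizationMonoid R] (g : R[X]) :
    ∀ f : R[X], f ≠ 0 → (∀ p : R[X], Irreducible p → p ∣ f → ¬ p ∣ g) → resultant f g ≠ 0 := by
  let : NormalizedGCDMonoid R := Classical.choice inferInstance
  have hconst : ∀ c : R, c ≠ 0 → resultant (C c) g ≠ 0 := fun c hc => by
    rw [natDegree_C, resultant_C_zero_left]
    exact pow_ne_zero _ hc
  intro f
  induction f using WfDvdMonoid.induction_on_irreducible with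
  | zero => exact fun h => absurd rfl h
  | unit f hf =>
    obtain ⟨c, hc, rfl⟩ := isUnit_iff.mp hf
    exact fun _ _ => hconst c hc.ne_zero
  | mul f p hf hp ih =>
    intro _ h
    rw [natDegree_mul hp.ne_zero hf, resultant_mul_left _ _ _ _ le_rfl]
    refine mul_ne_zero ?_ (ih hf fun q hq hqf => h q hq (dvd_mul_of_dvd_right hqf _))
    by_cases hp0 : p.natDegree = 0
    · obtain ⟨c, rfl⟩ := natDegree_eq_zero.mp hp0
      exact hconst c fun hc => hp.ne_zero (by rw [hc, C_0])
    · exact resultant_ne_zero_of_irreducible hp hp0 (h p hp (dvd_mul_right _ _))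

lemma homEval_eq (d : ℕ) (r : ℤ[X]) (u v : ℤ) :
    ∃ s, homEval d r u v = r.coeff d * u ^ d + v * s := by
  refine ⟨∑ i ∈ Finset.range d, r.coeff i * u ^ i * v ^ (d - i - 1), ?_⟩
  rw [homEval, Finset.sum_range_succ, Nat.sub_self, pow_zero, mul_one, add_comm, Finset.mul_sum]
  congr 1
  refine Finset.sum_congr rfl fun i hi => ?_
  have : d - i = d - i - 1 + 1 := by have := Finset.mem_range.mp hi; omega
  conv_lhs => rw [this, pow_succ]
  ring

lemma dvd_mul_pow_of_dvd_homEval {d n : ℕ} {r : ℤ[X]} {u v g R : ℤ} (huv : IsCoprime u v)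
    (h1 : g ∣ homEval d r u v) (h2 : g ∣ R * v ^ n) : g ∣ R * r.coeff d ^ n := by
  obtain ⟨s, hs⟩ := homEval_eq d r u v
  have h3 : g ∣ (r.coeff d * u ^ d) ^ n - (-(v * s)) ^ n := by
    refine dvd_trans ?_ (sub_dvd_pow_sub_pow _ _ n)
    rwa [sub_neg_eq_add, ← hs]
  have h4 : g ∣ R * r.coeff d ^ n * u ^ (d * n) := by
    have h5 : g ∣ R * (-(v * s)) ^ n := by
      have : R * (-(v * s)) ^ n = R * v ^ n * (-s) ^ n := by
        rw [← mul_neg, mul_pow]; ring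
      rw [this]
      exact dvd_mul_of_dvd_left h2 _
    have h6 := dvd_add (dvd_mul_of_dvd_right h3 R) h5
    have h7 : R * r.coeff d ^ n * u ^ (d * n) =
        R * ((r.coeff d * u ^ d) ^ n - (-(v * s)) ^ n) + R * (-(v * s)) ^ n := by
      rw [pow_mul]; ring
    rwa [h7]
  have h5 : g ∣ R * r.coeff d ^ n * v ^ n := by
    rw [mul_right_comm]; exact dvd_mul_of_dvd_left h2 _
  obtain ⟨α, β, hαβ⟩ : IsCoprime (u ^ (d * n)) (v ^ n) := huv.pow
  have := dvd_add (dvd_mul_of_dvd_right h4 α) (dvd_mul_of_dvd_right h5 β)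
  have h6 : R * r.coeff d ^ n =
      α * (R * r.coeff d ^ n * u ^ (d * n)) + β * (R * r.coeff d ^ n * v ^ n) := by
    linear_combination (-(R * r.coeff d ^ n)) * hαβ
  rwa [h6]

/-- The values at coprime integers of the two coefficients of an irreducible polynomial of degree
one have common divisors dividing a fixed small integer. -/
lemma exists_common_divisor_bound {d : ℕ} {f : ℤ[X][X]} (hf : Irreducible f)
    (hf1 : f.natDegree = 1) (hfd : BiDegLE d 1 f) (hd : ∃ j, (f.coeff j).natDegree = d) {H : ℝ}
    (hH1 : 1 ≤ H) (hH : ∀ i j, |((f.coeff j).coeff i : ℝ)| ≤ H) :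
    ∃ R : ℤ, R ≠ 0 ∧ |(R : ℝ)| ≤ (2 * d).factorial * H ^ (4 * d + 1) ∧
      ∀ u v g : ℤ, v ≠ 0 → IsCoprime u v → g ∣ homEval d (f.coeff 0) u v →
        g ∣ homEval d (f.coeff 1) u v → g ∣ R := by
  set G := f.coeff 0 with hG
  set K := f.coeff 1 with hK
  have hfeq : f = C K * X + C G := eq_X_add_C_of_natDegree_le_one hf1.le
  have hK0 : K ≠ 0 := by
    rw [hK, ← hf1]; exact leadingCoeff_ne_zero.mpr hf.ne_zero
  have hfac : (1 : ℝ) ≤ (2 * d).factorial := by exact_mod_cast (2 * d).factorial_pos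
  have hKd := hfd.2 1
  have hGd := hfd.2 0
  rw [← hK] at hKd
  rw [← hG] at hGd
  rcases Nat.eq_zero_or_pos d with rfl | hd0
  · refine ⟨K.coeff 0, fun h => hK0 ?_, ?_, fun u v g _ _ _ h => by simpa [homEval] using h⟩
    · rw [eq_C_of_natDegree_le_zero hKd, h, C_0]
    · simpa using hH 0 1
  have hres : resultant K G ≠ 0 := by
    refine resultant_ne_zero_of_forall_irreducible _ _ hK0 fun p hp h1 h2 => hp.not_isUnit ?_
    have h3 : C p ∣ f := by
      rw [hfeq]
      exact dvd_add (dvd_mul_of_dvd_left (_root_.map_dvd C h1) _) (_root_.map_dvd C h2)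
    exact hf.isPrimitive (by omega) p h3
  have hcoeff : ∀ j, (f.coeff j).natDegree = d → f.coeff j = K ∨ f.coeff j = G := by
    intro j hj
    rcases j with _ | _ | j
    · exact Or.inr rfl
    · exact Or.inl rfl
    · rw [coeff_eq_zero_of_natDegree_lt (by omega)] at hj
      simp at hj; omega
  obtain ⟨r, hr, hrd⟩ : ∃ r, (r = K ∨ r = G) ∧ r.natDegree = d := by
    obtain ⟨j, hj⟩ := hd
    exact ⟨_, hcoeff j hj, hj⟩
  have hdeg : K.natDegree ≠ 0 ∨ G.natDegree ≠ 0 := by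
    rcases hr with rfl | rfl
    · left; omega
    · right; omega
  have hrH : |(r.coeff d : ℝ)| ≤ H := by
    rcases hr with rfl | rfl
    · exact hH d 1
    · exact hH d 0
  obtain ⟨P, Q, hP, hQ, hPQ⟩ := exists_mul_add_mul_eq_C_resultant K G le_rfl le_rfl hdeg
  have hPd : P.natDegree ≤ d := natDegree_le_of_degree_le (hP.le.trans (by exact_mod_cast hGd))
  have hQd : Q.natDegree ≤ d := natDegree_le_of_degree_le (hQ.le.trans (by exact_mod_cast hKd))
  refine ⟨resultant K G * r.coeff d ^ (2 * d), mul_ne_zero hres (pow_ne_zero _ ?_), ?_, ?_⟩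
  · rw [← hrd]
    refine leadingCoeff_ne_zero.mpr fun h => ?_
    rw [h] at hrd; simp at hrd; omega
  · push_cast
    rw [abs_mul, abs_pow]
    have h1 : |((resultant K G : ℤ) : ℝ)| ≤ (2 * d).factorial * H ^ (2 * d) := by
      have h2 := Matrix.det_le (A := (sylvester K G K.natDegree G.natDegree).map
        (Int.castRingHom ℝ)) (abv := AbsoluteValue.abs) (x := H) (fun i j =>
          sylvester_induction (P := fun r : ℤ => |(r : ℝ)| ≤ H) (by simpa using by linarith) _ _
            (fun j => hH j 1) (fun j => hH j 0) _ _ i j)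
      have h3 := RingHom.map_det (Int.castRingHom ℝ) (sylvester K G K.natDegree G.natDegree)
      rw [RingHom.mapMatrix_apply] at h3
      rw [← h3, Fintype.card_fin] at h2
      have h4 : K.natDegree + G.natDegree ≤ 2 * d := by omega
      refine le_trans (by simpa [resultant] using h2) ?_
      exact mul_le_mul (Nat.cast_le.mpr (Nat.factorial_le h4)) (pow_le_pow_right₀ hH1 h4)
        (by positivity) (by positivity)
    calc _ ≤ (2 * d).factorial * H ^ (2 * d) * H ^ (2 * d) :=
          mul_le_mul h1 (pow_le_pow_left₀ (abs_nonneg _) hrH _) (by positivity) (by positivity)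
      _ = (2 * d).factorial * H ^ (4 * d) := by rw [mul_assoc, ← pow_add]; ring_nf
      _ ≤ _ := mul_le_mul_of_nonneg_left (pow_le_pow_right₀ hH1 (by omega)) (by positivity)
  · intro u v g hv huv h1 h2
    have h3 : homEval d K u v * homEval d P u v + homEval d G u v * homEval d Q u v =
        resultant K G * v ^ (2 * d) := by
      have hv' : (v : ℚ) ≠ 0 := by exact_mod_cast hv
      have huw : (u : ℚ) = v * ((u : ℚ) / v) := by field_simp
      have h4 := congrArg (eval₂RingHom (Int.castRingHom ℚ) ((u : ℚ) / v)) hPQ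
      rw [map_add, map_mul, map_mul] at h4
      simp only [coe_eval₂RingHom] at h4
      rw [eval₂_C, eq_intCast] at h4
      have : ((homEval d K u v * homEval d P u v + homEval d G u v * homEval d Q u v : ℤ) : ℚ) =
          (resultant K G * v ^ (2 * d) : ℤ) := by
        push_cast
        rw [cast_homEval hKd huw, cast_homEval hPd huw, cast_homEval hGd huw, cast_homEval hQd huw]
        linear_combination (v : ℚ) ^ (2 * d) * h4
      exact_mod_cast this
    refine dvd_mul_pow_of_dvd_homEval huv ?_ (h3 ▸ dvd_add (dvd_mul_of_dvd_left h2 _)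
      (dvd_mul_of_dvd_left h1 _))
    rcases hr with rfl | rfl
    · exact h2
    · exact h1

/-- The homogenization of `r` in degree `d`. -/
noncomputable def homPoly (d : ℕ) (r : ℤ[X]) : ℤ[X][X] :=
  ∑ i ∈ Finset.range (d + 1), C (C (r.coeff i) * X ^ i) * X ^ (d - i)

lemma biEval_X {R : Type*} [CommRing R] (w t : R) : biEval w t X = t := by
  simp [biEval_apply]

lemma biEval_homPoly (d : ℕ) (r : ℤ[X]) (u v : ℤ) :
    biEval u v (homPoly d r) = homEval d r u v := by
  rw [homPoly, map_sum, homEval]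
  refine Finset.sum_congr rfl fun i _ => ?_
  rw [map_mul, map_pow, biEval_C, biEval_X, eval₂_mul, eval₂_C, eval₂_pow, eval₂_X]
  simp

lemma biDegLE_homPoly (d : ℕ) (r : ℤ[X]) : BiDegLE d d (homPoly d r) := by
  refine biDegLE_sum _ fun i hi => ?_
  have hi' : i ≤ d := Nat.lt_succ_iff.mp (Finset.mem_range.mp hi)
  have h1 : BiDegLE d 0 (C (C (r.coeff i) * X ^ i)) :=
    biDegLE_C ((natDegree_C_mul_X_pow_le _ _).trans hi')
  exact (h1.mul (biDegLE_X (d := 0) |>.pow (d - i))).mono (by omega) (by omega)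

/-- The integral linear form `α u + β v`. -/
noncomputable def linPoly (α β : ℤ) : ℤ[X][X] := C (C α * X) + C (C β) * X

lemma biEval_linPoly (α β u v : ℤ) : biEval u v (linPoly α β) = α * u + β * v := by
  rw [linPoly, map_add, map_mul (biEval u v), biEval_C, biEval_C, biEval_X, eval₂_mul, eval₂_C, eval₂_C, eval₂_X]
  simp

lemma biDegLE_linPoly (α β : ℤ) : BiDegLE 1 1 (linPoly α β) := by
  refine BiDegLE.add ?_ ?_
  · exact biDegLE_C ((natDegree_C_mul_le _ _).trans natDegree_X_le)
  · have h1 : BiDegLE 1 0 (C (C β)) := biDegLE_C (by simp)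
    exact (h1.mul (biDegLE_X (d := 0))).mono (by omega) (by omega)

lemma card_dvd_le {ι : Type} (S : Finset ι) (g : ι → ℤ) {R : ℤ} (hR : R ≠ 0)
    (hg : ∀ i ∈ S, g i ∣ R) : (S.image g).card ≤ 2 * R.natAbs.divisors.card := by
  classical
  have hsub : S.image g ⊆ (R.natAbs.divisors.image fun m : ℕ => (m : ℤ)) ∪
      (R.natAbs.divisors.image fun m : ℕ => -(m : ℤ)) := by
    intro z hz
    obtain ⟨i, hi, rfl⟩ := Finset.mem_image.mp hz
    have h1 : (g i).natAbs ∈ R.natAbs.divisors :=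
      Nat.mem_divisors.mpr ⟨Int.natAbs_dvd_natAbs.mpr (hg i hi), Int.natAbs_ne_zero.mpr hR⟩
    rcases Int.natAbs_eq (g i) with h | h
    · exact Finset.mem_union_left _ (Finset.mem_image.mpr ⟨_, h1, h.symm⟩)
    · exact Finset.mem_union_right _ (Finset.mem_image.mpr ⟨_, h1, h.symm⟩)
  refine (Finset.card_le_card hsub).trans ((Finset.card_union_le _ _).trans ?_)
  have h1 := Finset.card_image_le (s := R.natAbs.divisors) (f := fun m : ℕ => (m : ℤ))
  have h2 := Finset.card_image_le (s := R.natAbs.divisors) (f := fun m : ℕ => -(m : ℤ))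
  omega

lemma PointFamily.injOn_pair {ι : Type} {S : Finset ι} {u v a b : ι → ℤ} {B A : ℝ}
    (hP : PointFamily S u v a b B A) : Set.InjOn (fun i => (u i, v i)) S := by
  intro i hi j hj hij
  obtain ⟨h1, h2⟩ := Prod.mk.injEq _ _ _ _ ▸ hij
  exact hP.injOn hi hj (by simp only [h1, h2])

lemma exists_card_le_of_one {k : ℕ} (hk : k ≠ 0) (d : ℕ) {ε : ℝ} (hε : 0 < ε) :
    ∃ C : ℝ, 0 < C ∧ ∀ (ι : Type) (S : Finset ι) (u v a b : ι → ℤ) (B A L : ℝ),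
      PointFamily S u v a b B A → B ≤ L → A ≤ L → ∀ α β γ δ : ℤ,
      (∀ i ∈ S, a i * (α * u i + β * v i) ^ k - b i * (γ * u i + δ * v i) ^ k = 1) →
      ∀ f : ℤ[X][X], Irreducible f →
      f.natDegree = 1 → BiDegLE d 1 f → (∃ j, (f.coeff j).natDegree = d) →
      VanishesOn S u v a b f → (S.card : ℝ) ≤ C * (B * L ^ ε) := by
  classical
  set n := (d + 1) * (1 + 1) with hn
  set c := (d + 1) * n * (4 * d + 1) with hc
  set K₁ : ℕ := (2 * d).factorial * (n ^ n) ^ (4 * d + 1) with hK₁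
  set ε' := ε / (c + 1) with hε'
  have hε'0 : 0 < ε' := by positivity
  have hcε : c * ε' ≤ ε := by
    rw [hε', mul_div_assoc', div_le_iff₀ (by positivity)]
    nlinarith
  obtain ⟨C₁, hC₁, hdiv⟩ := exists_card_divisors_le hε'0
  set C : ℝ := 2 * d + (2 * (d + k) * 3) * (2 * (C₁ * (K₁ : ℝ) ^ ε')) + 1 with hC
  refine ⟨C, by positivity, ?_⟩
  intro ι S u v a b B A L hP hBL hAL α β γ δ hline f hf hf1 hfd hfd' h0
  have hB1 := hP.one_le_B
  have hA1 := hP.one_le_A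
  have hL1 : 1 ≤ L := hB1.trans hBL
  have hLε : 1 ≤ L ^ ε := Real.one_le_rpow hL1 hε.le
  have hBL1 : 1 ≤ B * L ^ ε := one_le_mul_of_one_le_of_one_le hB1 hLε
  rcases hP.card_le_or_coeff_le hf hf1 one_ne_zero hfd hfd' h0 with hsmall | hcoeff
  · calc (S.card : ℝ) ≤ (2 * 1 * d : ℕ) := by exact_mod_cast hsmall
      _ ≤ C := by
        rw [hC]; push_cast
        have : 0 ≤ (2 * (d + k) * 3 : ℝ) * (2 * (C₁ * (K₁ : ℝ) ^ ε')) := by positivity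
        linarith
      _ ≤ C * (B * L ^ ε) := le_mul_of_one_le_right (by positivity) hBL1
  rw [← hn] at hcoeff
  set H : ℝ := (n * (B ^ d * A ^ 1)) ^ n with hH
  have hn1 : (1 : ℝ) ≤ n := by
    have : 1 ≤ n := by rw [hn]; omega
    exact_mod_cast this
  have hH1 : 1 ≤ H := one_le_pow₀ (one_le_mul_of_one_le_of_one_le hn1 (hP.one_le_pow_mul_pow d 1))
  obtain ⟨R, hR0, hRle, hRdvd⟩ := exists_common_divisor_bound hf hf1 hfd hfd' hH1 hcoeff
  have hRL : |(R : ℝ)| ≤ K₁ * L ^ c := by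
    refine hRle.trans ?_
    have : H ≤ n ^ n * L ^ ((d + 1) * n) := by
      calc H ≤ (n * (L ^ d * L ^ 1)) ^ n := by rw [hH]; gcongr
        _ = _ := by rw [← pow_add, mul_pow, ← pow_mul]
    calc _ ≤ ((2 * d).factorial : ℝ) * (n ^ n * L ^ ((d + 1) * n)) ^ (4 * d + 1) := by gcongr
      _ = _ := by rw [mul_pow, ← pow_mul L, ← hc, hK₁]; push_cast; ring
  have hτ : (R.natAbs.divisors.card : ℝ) ≤ C₁ * (K₁ : ℝ) ^ ε' * L ^ ε := by
    refine (hdiv _ (Int.natAbs_ne_zero.mpr hR0)).trans ?_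
    rw [mul_assoc]
    refine mul_le_mul_of_nonneg_left ?_ (by linarith)
    calc ((R.natAbs : ℕ) : ℝ) ^ ε' ≤ (K₁ * L ^ c) ^ ε' := by
          refine Real.rpow_le_rpow (by positivity) ?_ hε'0.le
          rwa [Nat.cast_natAbs, Int.cast_abs]
      _ = (K₁ : ℝ) ^ ε' * L ^ (c * ε') := by
          rw [Real.mul_rpow (by positivity) (by positivity), ← Real.rpow_natCast L,
            ← Real.rpow_mul (by linarith)]
      _ ≤ _ := by
          refine mul_le_mul_of_nonneg_left ?_ (by positivity)
          exact Real.rpow_le_rpow_of_exponent_le hL1 hcε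
  -- the common factor of the two values
  have hg : ∀ i ∈ S, ∃ g : ℤ, homEval d (f.coeff 1) (u i) (v i) = a i * g ∧
      homEval d (f.coeff 0) (u i) (v i) = -(b i) * g := by
    intro i hi
    have h1 := sum_monoRow_eq_zero hfd (hP.v_ne i hi) (hP.a_ne i hi) (h0 i hi)
    have h2 : homEval d (f.coeff 0) (u i) (v i) * a i + homEval d (f.coeff 1) (u i) (v i) * b i
        = 0 := by
      rw [Fintype.sum_prod_type_right, Fin.sum_univ_two] at h1
      rw [homEval, homEval, Finset.sum_range, Finset.sum_range, Finset.sum_mul, Finset.sum_mul,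
        ← h1]
      congr 1 <;> refine Finset.sum_congr rfl fun j _ => ?_ <;> simp [monoRow] <;> ring
    have h3 : a i ∣ homEval d (f.coeff 1) (u i) (v i) * b i :=
      ⟨-homEval d (f.coeff 0) (u i) (v i), by linear_combination h2⟩
    obtain ⟨g, hg⟩ := (hP.coprime_ab i hi).dvd_of_dvd_mul_right h3
    refine ⟨g, hg, ?_⟩
    rw [hg] at h2
    have h4 : a i * (homEval d (f.coeff 0) (u i) (v i) - -(b i) * g) = 0 := by
      linear_combination h2
    exact sub_eq_zero.mp ((mul_eq_zero.mp h4).resolve_left (hP.a_ne i hi))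
  choose! g hg1 hg0 using hg
  have hgR : ∀ i ∈ S, g i ∣ R := fun i hi =>
    hRdvd (u i) (v i) (g i) (hP.v_ne i hi) (hP.coprime_uv i hi)
      (hg0 i hi ▸ dvd_mul_left _ _) (hg1 i hi ▸ dvd_mul_left _ _)
  have hfib : ∀ z ∈ S.image g, (S.filter fun i => g i = z).card ≤
      (d + k + (d + k)) * (2 * ⌊B⌋₊ + 1) := by
    intro z hz
    obtain ⟨i₀, hi₀, hz⟩ := Finset.mem_image.mp hz
    have hz0 : z ≠ 0 := by
      rintro rfl
      have := hgR i₀ hi₀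
      rw [hz, zero_dvd_iff] at this
      exact hR0 this
    set F : ℤ[X][X] := homPoly d (f.coeff 1) * linPoly α β ^ k +
      homPoly d (f.coeff 0) * linPoly γ δ ^ k + Polynomial.C (Polynomial.C (-z)) with hF
    have hFeval : ∀ x y : ℤ, biEval x y F = homEval d (f.coeff 1) x y * (α * x + β * y) ^ k +
        homEval d (f.coeff 0) x y * (γ * x + δ * y) ^ k - z := by
      intro x y
      rw [hF, map_add, map_add, map_mul, map_mul, map_pow, map_pow, biEval_homPoly, biEval_homPoly,
        biEval_linPoly, biEval_linPoly, biEval_C]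
      simp [sub_eq_add_neg]
    have hF0 : F ≠ 0 := fun h => by
      have := hFeval 0 0
      rw [h] at this
      simp [hk] at this
      exact hz0 this
    have hFd : BiDegLE (d + k) (d + k) F := by
      have h1 := fun α β => (biDegLE_linPoly α β).pow k
      rw [mul_one] at h1
      refine BiDegLE.add (BiDegLE.add ?_ ?_) ?_
      · exact (biDegLE_homPoly d _).mul (h1 α β)
      · exact (biDegLE_homPoly d _).mul (h1 γ δ)
      · exact biDegLE_C (by simp)
    have hsub : S.filter (fun i => g i = z) ⊆ S := Finset.filter_subset _ _
    rw [← Finset.card_image_of_injOn (hP.subset hsub).injOn_pair]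
    refine card_integer_zeros_le hF0 hFd ⌊B⌋₊ _ ?_ ?_
    · intro y hy
      obtain ⟨i, hi, rfl⟩ := Finset.mem_image.mp hy
      have hfl : ∀ m : ℤ, |(m : ℝ)| ≤ B → |m| ≤ (⌊B⌋₊ : ℤ) := fun m hm => by
        have : m.natAbs ≤ ⌊B⌋₊ := Nat.le_floor (by rwa [Nat.cast_natAbs, Int.cast_abs])
        rw [← Int.natCast_natAbs]; exact_mod_cast this
      exact ⟨hfl _ (hP.u_le i (hsub hi)), hfl _ (hP.v_le i (hsub hi))⟩
    · intro y hy
      obtain ⟨i, hi, rfl⟩ := Finset.mem_image.mp hy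
      obtain ⟨hiS, hiz⟩ := Finset.mem_filter.mp hi
      simp only
      rw [hFeval, hg1 i hiS, hg0 i hiS, hiz]
      linear_combination z * hline i hiS
  have hcard : S.card ≤ ((d + k + (d + k)) * (2 * ⌊B⌋₊ + 1)) * (2 * R.natAbs.divisors.card) :=
    (Finset.card_le_mul_card_image _ _ hfib).trans
      (Nat.mul_le_mul_left _ (card_dvd_le S g hR0 hgR))
  have hfloor : (⌊B⌋₊ : ℝ) ≤ B := Nat.floor_le (by linarith)
  calc (S.card : ℝ) ≤ ((d + k + (d + k)) * (2 * ⌊B⌋₊ + 1)) * (2 * R.natAbs.divisors.card) := by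
        exact_mod_cast hcard
    _ ≤ ((d + k + (d + k)) * (3 * B)) * (2 * (C₁ * (K₁ : ℝ) ^ ε' * L ^ ε)) := by
        gcongr
        linarith
    _ = ((2 * (d + k) * 3) * (2 * (C₁ * (K₁ : ℝ) ^ ε'))) * (B * L ^ ε) := by ring
    _ ≤ C * (B * L ^ ε) := by
        refine mul_le_mul_of_nonneg_right ?_ (by positivity)
        rw [hC]
        have : (0 : ℝ) ≤ d := Nat.cast_nonneg _
        linarith

lemma coeff_coeff_swap (f : ℤ[X][X]) (i j : ℕ) :
    ((Bivariate.swap f).coeff i).coeff j = (f.coeff j).coeff i := by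
  induction f using Polynomial.induction_on' with
  | add p q hp hq => rw [map_add, coeff_add, coeff_add, hp, hq, coeff_add, coeff_add]
  | monomial n a =>
    induction a using Polynomial.induction_on' with
    | add p q hp hq =>
      rw [map_add, map_add, coeff_add, coeff_add, hp, hq, coeff_add, coeff_add]
    | monomial m r =>
      rw [Bivariate.swap_monomial_monomial]
      simp only [coeff_monomial]
      split_ifs <;> simp [coeff_monomial, *]

/-- The sum of the two partial degrees. -/
noncomputable def totDeg (f : ℤ[X][X]) : ℕ := f.natDegree + (Bivariate.swap f).natDegree

lemma totDeg_mul {f g : ℤ[X][X]} (hf : f ≠ 0) (hg : g ≠ 0) :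
    totDeg (f * g) = totDeg f + totDeg g := by
  have h1 : ∀ {p : ℤ[X][X]}, p ≠ 0 → Bivariate.swap p ≠ 0 := fun hp h =>
    hp ((map_eq_zero_iff _ (Bivariate.swap (R := ℤ)).injective).mp h)
  rw [totDeg, map_mul, natDegree_mul hf hg, natDegree_mul (h1 hf) (h1 hg), totDeg, totDeg]
  omega

lemma natDegree_coeff_le_natDegree_swap (f : ℤ[X][X]) (j : ℕ) :
    (f.coeff j).natDegree ≤ (Bivariate.swap f).natDegree := by
  rw [natDegree_le_iff_coeff_eq_zero]
  intro i hi
  rw [← coeff_coeff_swap, coeff_eq_zero_of_natDegree_lt hi, coeff_zero]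

lemma exists_natDegree_coeff_eq {f : ℤ[X][X]} (hf : f ≠ 0) :
    ∃ j, (f.coeff j).natDegree = (Bivariate.swap f).natDegree := by
  have h1 : Bivariate.swap f ≠ 0 := fun h =>
    hf ((map_eq_zero_iff _ (Bivariate.swap (R := ℤ)).injective).mp h)
  have h2 := leadingCoeff_ne_zero.mpr h1
  obtain ⟨j, hj⟩ : ∃ j, (Bivariate.swap f).leadingCoeff.coeff j ≠ 0 := by
    by_contra! h
    exact h2 (Polynomial.ext (by simpa using h))
  refine ⟨j, le_antisymm (natDegree_coeff_le_natDegree_swap f j) (le_natDegree_of_ne_zero ?_)⟩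
  rwa [← coeff_coeff_swap]

lemma BiDegLE.natDegree_swap_le {d e : ℕ} {f : ℤ[X][X]} (hf : BiDegLE d e f) :
    (Bivariate.swap f).natDegree ≤ d := by
  rw [natDegree_le_iff_coeff_eq_zero]
  intro i hi
  ext j
  rw [coeff_coeff_swap, coeff_eq_zero_of_natDegree_lt ((hf.2 j).trans_lt hi), coeff_zero]

lemma biDegLE_totDeg (f : ℤ[X][X]) : BiDegLE (totDeg f) (totDeg f) f :=
  ⟨Nat.le_add_right _ _, fun j => (natDegree_coeff_le_natDegree_swap f j).trans
    (Nat.le_add_left _ _)⟩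

lemma exists_card_le_of_irreducible {k : ℕ} (hk : k ≠ 0) (D : ℕ) {ε : ℝ} (hε : 0 < ε) :
    ∃ C : ℝ, 0 < C ∧ ∀ (ι : Type) (S : Finset ι) (u v a b : ι → ℤ) (B A L : ℝ),
      PointFamily S u v a b B A → B ≤ L → A ≤ L → ∀ α β γ δ : ℤ,
      (∀ i ∈ S, a i * (α * u i + β * v i) ^ k - b i * (γ * u i + δ * v i) ^ k = 1) →
      ∀ f : ℤ[X][X], Irreducible f → totDeg f ≤ D →
      VanishesOn S u v a b f → (S.card : ℝ) ≤ totDeg f * (C * (B * L ^ ε)) := by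
  choose C₁ hC₁ h₁ using fun d => exists_card_le_of_one hk d hε
  choose C₂ hC₂ h₂ using fun d e : ℕ => exists_card_le_of_two_le d (e + 1) (Nat.le_add_left 1 e) hε
  refine ⟨1 + ∑ d ∈ Finset.range (D + 1), C₁ d +
    ∑ d ∈ Finset.range (D + 1), ∑ e ∈ Finset.range (D + 1), C₂ d e, ?_, ?_⟩
  · have := Finset.sum_nonneg fun d (_ : d ∈ Finset.range (D + 1)) => (hC₁ d).le
    have := Finset.sum_nonneg fun d (_ : d ∈ Finset.range (D + 1)) =>
      Finset.sum_nonneg fun e (_ : e ∈ Finset.range (D + 1)) => (hC₂ d e).le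
    linarith
  intro ι S u v a b B A L hP hBL hAL α β γ δ hline f hf hfD h0
  have hs1 := Finset.sum_nonneg fun d (_ : d ∈ Finset.range (D + 1)) => (hC₁ d).le
  have hs2 := Finset.sum_nonneg fun d (_ : d ∈ Finset.range (D + 1)) =>
      Finset.sum_nonneg fun e (_ : e ∈ Finset.range (D + 1)) => (hC₂ d e).le
  set s₁ := ∑ d ∈ Finset.range (D + 1), C₁ d with hs₁
  set s₂ := ∑ d ∈ Finset.range (D + 1), ∑ e ∈ Finset.range (D + 1), C₂ d e with hs₂
  have hB1 := hP.one_le_B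
  have hL1 : 1 ≤ L := hB1.trans hBL
  have hBL1 : 1 ≤ B * L ^ ε :=
    one_le_mul_of_one_le_of_one_le hB1 (Real.one_le_rpow hL1 hε.le)
  set d := (Bivariate.swap f).natDegree with hd
  have hdD : d ∈ Finset.range (D + 1) := by
    rw [totDeg] at hfD
    exact Finset.mem_range.mpr (by omega)
  have hdeg : BiDegLE d f.natDegree f := ⟨le_rfl, natDegree_coeff_le_natDegree_swap f⟩
  have hex := exists_natDegree_coeff_eq hf.ne_zero
  have hfin : ∀ K : ℝ, 0 ≤ K → K ≤ 1 + s₁ + s₂ → 1 ≤ totDeg f → (S.card : ℝ) ≤ K * (B * L ^ ε) →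
      (S.card : ℝ) ≤ totDeg f * ((1 + s₁ + s₂) * (B * L ^ ε)) := by
    intro K hK hKs ht hc
    have ht' : (1 : ℝ) ≤ totDeg f := by exact_mod_cast ht
    calc (S.card : ℝ) ≤ K * (B * L ^ ε) := hc
      _ ≤ (1 + s₁ + s₂) * (B * L ^ ε) := by gcongr
      _ ≤ _ := le_mul_of_one_le_left (by positivity) ht'
  rcases hE : f.natDegree with _ | _ | e
  · obtain ⟨r, rfl⟩ := natDegree_eq_zero.mp hE
    have hr : r ≠ 0 := by
      rintro rfl
      exact hf.ne_zero (by simp)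
    have h1 := card_le_natDegree_of_eval₂_eq_zero hP.injOn hr fun i hi => by
      have := h0 i hi
      rwa [biEval_C] at this
    have h2 : r.natDegree ≤ totDeg (C r) := by
      simpa using (biDegLE_totDeg (C r)).2 0
    have h3 : 1 ≤ (1 + s₁ + s₂) * (B * L ^ ε) :=
      one_le_mul_of_one_le_of_one_le (by linarith) hBL1
    calc (S.card : ℝ) ≤ totDeg (C r) := by exact_mod_cast h1.trans h2
      _ ≤ _ := le_mul_of_one_le_right (by positivity) h3
  · refine hfin (C₁ d) (hC₁ d).le ?_ (by rw [totDeg]; omega) ?_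
    · have := Finset.single_le_sum (fun d _ => (hC₁ d).le) hdD
      linarith
    · rw [hE] at hdeg
      exact h₁ d ι S u v a b B A L hP hBL hAL α β γ δ hline f hf hE hdeg hex h0
  · have heD : e ∈ Finset.range (D + 1) := by
      rw [totDeg] at hfD
      exact Finset.mem_range.mpr (by omega)
    refine hfin (C₂ d e) (hC₂ d e).le ?_ (by rw [totDeg]; omega) ?_
    · have h3 := Finset.single_le_sum (fun e _ => (hC₂ d e).le) heD
      have h4 := Finset.single_le_sum (f := fun d => ∑ e ∈ Finset.range (D + 1), C₂ d e)
        (fun d _ => Finset.sum_nonneg fun e _ => (hC₂ d e).le) hdD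
      linarith
    · rw [hE] at hdeg
      exact h₂ d e ι S u v a b B A L hP hBL hAL f hf hE hdeg hex h0

/-- The points of a family with `u`, `v` bounded by `B` which lie on a curve of bounded degree
are about `B` in number. -/
theorem exists_card_le_of_vanishesOn {k : ℕ} (hk : k ≠ 0) (D : ℕ) {ε : ℝ} (hε : 0 < ε) :
    ∃ C : ℝ, 0 < C ∧ ∀ (ι : Type) (S : Finset ι) (u v a b : ι → ℤ) (B A L : ℝ),
      PointFamily S u v a b B A → B ≤ L → A ≤ L → ∀ α β γ δ : ℤ,
      (∀ i ∈ S, a i * (α * u i + β * v i) ^ k - b i * (γ * u i + δ * v i) ^ k = 1) →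
      ∀ f : ℤ[X][X], f ≠ 0 → BiDegLE D D f →
      VanishesOn S u v a b f → (S.card : ℝ) ≤ C * (B * L ^ ε) := by
  classical
  obtain ⟨C, hC, h⟩ := exists_card_le_of_irreducible hk (D + D) hε
  refine ⟨(D + D) * C + 1, by positivity, ?_⟩
  intro ι S u v a b B A L hP hBL hAL α β γ δ hline f hf0 hfD h0
  have hB1 := hP.one_le_B
  have hL1 : 1 ≤ L := hB1.trans hBL
  suffices key : ∀ f : ℤ[X][X], f ≠ 0 → totDeg f ≤ D + D → ∀ T ⊆ S, VanishesOn T u v a b f →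
      (T.card : ℝ) ≤ totDeg f * (C * (B * L ^ ε)) by
    have h1 : totDeg f ≤ D + D := Nat.add_le_add hfD.1 hfD.natDegree_swap_le
    have h1' : (totDeg f : ℝ) ≤ D + D := by exact_mod_cast h1
    calc (S.card : ℝ) ≤ totDeg f * (C * (B * L ^ ε)) := key f hf0 h1 S subset_rfl h0
      _ ≤ (D + D) * (C * (B * L ^ ε)) := by gcongr
      _ ≤ _ := by nlinarith [show 0 ≤ B * L ^ ε by positivity]
  intro f
  induction f using WfDvdMonoid.induction_on_irreducible with
  | zero => exact fun h => (h rfl).elim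
  | unit g hg =>
    intro _ _ T _ h0
    have : T = ∅ := by
      refine Finset.eq_empty_of_forall_notMem fun i hi => ?_
      exact (hg.map (biEval ((u i : ℚ) / v i) ((b i : ℚ) / a i))).ne_zero (h0 i hi)
    rw [this, Finset.card_empty, Nat.cast_zero]
    positivity
  | mul g p hg hp ih =>
    intro _ hD T hT h0
    rw [totDeg_mul hp.ne_zero hg] at hD ⊢
    set T₁ := T.filter fun i => biEval ((u i : ℚ) / v i) ((b i : ℚ) / a i) p = 0 with hT₁
    set T₂ := T.filter fun i => ¬ biEval ((u i : ℚ) / v i) ((b i : ℚ) / a i) p = 0 with hT₂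
    have h1 : T₁ ⊆ S := (Finset.filter_subset _ _).trans hT
    have h2 : T₂ ⊆ S := (Finset.filter_subset _ _).trans hT
    have hc1 := h ι T₁ u v a b B A L (hP.subset h1) hBL hAL α β γ δ (fun i hi => hline i (h1 hi))
      p hp (by omega) fun i hi => (Finset.mem_filter.mp hi).2
    have hc2 := ih hg (by omega) T₂ h2 fun i hi => by
      have := h0 i (Finset.mem_filter.mp hi).1
      rw [map_mul] at this
      exact (mul_eq_zero.mp this).resolve_left (Finset.mem_filter.mp hi).2
    have hc3 := Finset.card_filter_add_card_filter_not (s := T)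
      (fun i => biEval ((u i : ℚ) / v i) ((b i : ℚ) / a i) p = 0)
    calc (T.card : ℝ) = T₁.card + T₂.card := by rw [← hc3]; push_cast; rfl
      _ ≤ _ := by push_cast; linarith

lemma abs_det_le_factorial_mul_prod {β : Type*} [Fintype β] [DecidableEq β] {A : Matrix β β ℝ}
    {w : β → ℝ} (hA : ∀ n p, |A n p| ≤ w n) :
    |A.det| ≤ (Fintype.card β).factorial * ∏ n, w n := by
  rw [Matrix.det_apply']
  refine (Finset.abs_sum_le_sum_abs _ _).trans ?_
  have h1 : ∀ σ ∈ (Finset.univ : Finset (Equiv.Perm β)),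
      |((Equiv.Perm.sign σ : ℤ) : ℝ) * ∏ i, A (σ i) i| ≤ ∏ n, w n := by
    intro σ _
    rw [abs_mul, Finset.abs_prod]
    have : |((Equiv.Perm.sign σ : ℤ) : ℝ)| = 1 := by
      rcases Int.units_eq_one_or (Equiv.Perm.sign σ) with h | h <;> simp [h]
    rw [this, one_mul, ← Equiv.prod_comp σ w]
    exact Finset.prod_le_prod (fun i _ => abs_nonneg _) fun i _ => hA _ _
  refine (Finset.sum_le_card_nsmul _ _ _ h1).trans (le_of_eq ?_)
  rw [Finset.card_univ, Fintype.card_perm, nsmul_eq_mul]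

/-- A determinant whose rows are combinations of vectors `V κ` with entries at most `w κ` is
small when all products of distinct `w κ` are. -/
lemma abs_det_le_of_expansion {β κ : Type*} [Fintype β] [DecidableEq β] [Fintype κ]
    {V : κ → β → ℝ} {c : β → κ → ℝ} {w : κ → ℝ} {K ρ : ℝ} (hV : ∀ i p, |V i p| ≤ w i)
    (hK : 0 ≤ K) (hc : ∀ n i, |c n i| ≤ K) (hρ0 : 0 ≤ ρ)
    (hρ : ∀ r : β → κ, Function.Injective r → ∏ n, w (r n) ≤ ρ) :
    |(Matrix.of fun n p => ∑ i, c n i * V i p).det| ≤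
      (Fintype.card κ * K) ^ Fintype.card β * ((Fintype.card β).factorial * ρ) := by
  classical
  have h0 : (Matrix.of fun n p => ∑ i, c n i * V i p) =
      fun n => ∑ i, c n i • V i := by
    ext n p
    simp [Finset.sum_apply]
  have h1 : (Matrix.of fun n p => ∑ i, c n i * V i p).det =
      ∑ r : β → κ, (∏ n, c n (r n)) * (Matrix.of fun n => V (r n)).det := by
    rw [h0]
    change (Matrix.detRowAlternating (n := β) (R := ℝ)).toMultilinearMap _ = _
    rw [MultilinearMap.map_sum]
    refine Finset.sum_congr rfl fun r _ => ?_
    rw [MultilinearMap.map_smul_univ]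
    rfl
  rw [h1]
  have h2 : ∀ r ∈ (Finset.univ : Finset (β → κ)),
      |(∏ n, c n (r n)) * (Matrix.of fun n => V (r n)).det| ≤
        K ^ Fintype.card β * ((Fintype.card β).factorial * ρ) := by
    intro r _
    rw [abs_mul, Finset.abs_prod]
    refine mul_le_mul ?_ ?_ (abs_nonneg _) (by positivity)
    · exact (Finset.prod_le_prod (fun i _ => abs_nonneg _) fun i _ => hc _ _).trans
        (by simp)
    · by_cases hr : Function.Injective r
      · refine (abs_det_le_factorial_mul_prod (w := fun n => w (r n)) fun n p => hV _ _).trans ?_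
        gcongr
        exact hρ r hr
      · rw [Function.Injective] at hr
        push Not at hr
        obtain ⟨i, j, hij, hne⟩ := hr
        rw [Matrix.det_zero_of_row_eq hne (congrArg V hij), abs_zero]
        positivity
  calc _ ≤ ∑ r : β → κ, |(∏ n, c n (r n)) * (Matrix.of fun n => V (r n)).det| :=
        Finset.abs_sum_le_sum_abs _ _
    _ ≤ _ := Finset.sum_le_card_nsmul _ _ _ h2
    _ = _ := by
      rw [Finset.card_univ, Fintype.card_fun, nsmul_eq_mul, mul_pow]
      push_cast
      ring

lemma sum_range_posPart_le (x : ℝ) (b : ℕ) :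
    ∑ l ∈ Finset.range b, max (x - l) 0 ≤ (max (x + 1) 0) ^ 2 / 2 := by
  have h1 : ∀ l ∈ Finset.range b, max (x - l) 0 ≤
      (max (x + 1 - l) 0) ^ 2 / 2 - (max (x + 1 - (l + 1 : ℕ)) 0) ^ 2 / 2 := by
    intro l _
    push_cast
    rcases le_total 0 (x - l) with h | h
    · rw [max_eq_left h, max_eq_left (by linarith), max_eq_left (by linarith)]
      nlinarith
    · rw [max_eq_right h, max_eq_right (a := x + 1 - (l + 1)) (by linarith)]
      simp only [ne_eq, OfNat.ofNat_ne_zero, not_false_eq_true, zero_pow, zero_div, sub_zero]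
      positivity
  refine (Finset.sum_le_sum h1).trans ?_
  rw [Finset.sum_range_sub']
  have : 0 ≤ (max (x + 1 - (b : ℕ)) 0) ^ 2 / 2 := by positivity
  simp only [Nat.cast_zero, sub_zero]
  linarith

lemma sum_range_posPart_sq_le (x : ℝ) {μ : ℝ} (hμ : 0 < μ) (b : ℕ) :
    ∑ m ∈ Finset.range b, (max (x - μ * m) 0) ^ 2 ≤ (max (x + μ) 0) ^ 3 / (3 * μ) := by
  have h1 : ∀ m ∈ Finset.range b, (max (x - μ * m) 0) ^ 2 ≤
      (max (x + μ - μ * m) 0) ^ 3 / (3 * μ) - (max (x + μ - μ * (m + 1 : ℕ)) 0) ^ 3 / (3 * μ) := by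
    intro m _
    push_cast
    rcases le_total 0 (x - μ * m) with h | h
    · rw [max_eq_left h, max_eq_left (by linarith), max_eq_left (by linarith),
        ← sub_div, le_div_iff₀ (by positivity)]
      nlinarith [mul_nonneg h hμ.le, mul_nonneg (mul_nonneg h hμ.le) hμ.le, pow_pos hμ 3]
    · rw [max_eq_right h, max_eq_right (a := x + μ - μ * (m + 1)) (by linarith)]
      simp only [ne_eq, OfNat.ofNat_ne_zero, not_false_eq_true, zero_pow, zero_div, sub_zero]
      positivity
  refine (Finset.sum_le_sum h1).trans ?_
  rw [Finset.sum_range_sub']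
  have : 0 ≤ (max (x + μ - μ * (b : ℕ)) 0) ^ 3 / (3 * μ) := by positivity
  simp only [Nat.cast_zero, mul_zero, sub_zero]
  linarith

lemma le_sum_weight {β : Type*} [Fintype β] {T μ : ℝ} (hT : 0 ≤ T) (hμ : 0 < μ) {p q : ℕ}
    {r : β → Fin p × Fin q} (hr : Function.Injective r) :
    Fintype.card β * T - (T + μ + 1) ^ 3 / (6 * μ) ≤
      ∑ n, (μ * ((r n).1 : ℕ) + ((r n).2 : ℕ)) := by
  have h1 : ∑ n, max (T - (μ * ((r n).1 : ℕ) + ((r n).2 : ℕ))) 0 ≤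
      (T + μ + 1) ^ 3 / (6 * μ) := by
    calc _ ≤ ∑ z : Fin p × Fin q, max (T - (μ * (z.1 : ℕ) + (z.2 : ℕ))) 0 := by
          classical
          rw [← Finset.sum_image (f := fun z : Fin p × Fin q =>
            max (T - (μ * (z.1 : ℕ) + (z.2 : ℕ))) 0) (g := r) (hr.injOn)]
          exact Finset.sum_le_sum_of_subset_of_nonneg (Finset.subset_univ _)
            fun _ _ _ => le_max_right _ _
      _ = ∑ m ∈ Finset.range p, ∑ l ∈ Finset.range q, max (T - μ * m - l) 0 := by
          rw [Fintype.sum_prod_type, Finset.sum_range]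
          refine Finset.sum_congr rfl fun m _ => ?_
          rw [Finset.sum_range]
          simp only [sub_sub]
      _ ≤ ∑ m ∈ Finset.range p, (max (T + 1 - μ * m) 0) ^ 2 / 2 := by
          refine Finset.sum_le_sum fun m _ => (sum_range_posPart_le _ _).trans (le_of_eq ?_)
          ring_nf
      _ ≤ (max (T + 1 + μ) 0) ^ 3 / (3 * μ) / 2 := by
          rw [← Finset.sum_div]
          gcongr
          exact sum_range_posPart_sq_le _ hμ _
      _ = _ := by
          rw [max_eq_left (by linarith), div_div]
          ring_nf
  have h2 : ∑ n, (T - (μ * ((r n).1 : ℕ) + ((r n).2 : ℕ))) ≤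
      ∑ n, max (T - (μ * ((r n).1 : ℕ) + ((r n).2 : ℕ))) 0 :=
    Finset.sum_le_sum fun _ _ => le_max_left _ _
  rw [Finset.sum_sub_distrib, Finset.sum_const, Finset.card_univ, nsmul_eq_mul] at h2
  linarith

/-- The balance of exponents in the determinant method. -/
lemma exists_exponent_lt {η β₀ δ : ℝ} (hη : 0 < η) (hβ₀ : 0 < β₀) (hδ : 0 < δ) :
    ∃ N : ℕ, ∀ α β μ : ℝ, η ≤ α → α ≤ 1 → β₀ ≤ β → β ≤ μ → μ ≤ 1 →
      9 / 2 * (1 + δ) * (α * β) ≤ μ → ∃ T : ℝ, 0 ≤ T ∧ ∃ d ≤ N, ∃ e ≤ N,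
      ((d + 1) * (e + 1) : ℝ) * (d * β + e * α) -
        ((d + 1) * (e + 1) * T - (T + μ + 1) ^ 3 / (6 * μ)) ≤ -1 := by
  set θ := √(1 + δ) - 1 with hθ
  have hs : 1 < √(1 + δ) := by
    rw [Real.lt_sqrt (by norm_num)]
    linarith
  have hs2 : √(1 + δ) ^ 2 = 1 + δ := Real.sq_sqrt (by linarith)
  have hθ0 : 0 < θ := by linarith
  set q₀ := η * β₀ with hq₀
  have hq₀0 : 0 < q₀ := by positivity
  obtain ⟨N, hN⟩ := exists_nat_ge (2 / q₀ + (5 + 6 / β₀) / (2 * q₀ ^ 2 * θ) + 1)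
  have hN1 : 2 ≤ N * q₀ := by
    rw [← div_le_iff₀ hq₀0]
    have : 0 < (5 + 6 / β₀) / (2 * q₀ ^ 2 * θ) := by positivity
    linarith
  have hN2 : 5 + 6 / β₀ ≤ N * (2 * q₀ ^ 2 * θ) := by
    rw [← div_le_iff₀ (by positivity)]
    have : 0 < 2 / q₀ := by positivity
    linarith
  have hN3 : (1 : ℝ) ≤ N := by
    have : 0 < (5 + 6 / β₀) / (2 * q₀ ^ 2 * θ) := by positivity
    have : 0 < 2 / q₀ := by positivity
    linarith
  refine ⟨N, ?_⟩
  intro α β μ hα hα1 hβ hβμ hμ1 hμ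
  have hα0 : 0 < α := hη.trans_le hα
  have hβ0 : 0 < β := hβ₀.trans_le hβ
  have hμ0 : 0 < μ := hβ0.trans_le hβμ
  have hβ1 : β ≤ 1 := hβμ.trans hμ1
  set q := α * β with hq
  have hqq : q₀ ≤ q := by rw [hq, hq₀]; gcongr
  have hq0 : 0 < q := by positivity
  have hq1 : q ≤ 1 := mul_le_one₀ hα1 hβ0.le hβ1
  set T := N * √(2 * q * μ) with hT
  have hT0 : 0 ≤ T := by positivity
  have hT2 : T ^ 2 = N ^ 2 * (2 * q * μ) := by
    rw [hT, mul_pow, Real.sq_sqrt (by positivity)]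
  have hTlow : 3 * √(1 + δ) * (N * q) ≤ T := by
    refine (sq_le_sq₀ (by positivity) hT0).mp ?_
    rw [hT2, mul_pow, mul_pow, hs2]
    have := mul_le_mul_of_nonneg_left hμ (show 0 ≤ (N : ℝ) ^ 2 * q by positivity)
    linarith
  have hd1 : (⌈N * α⌉₊ : ℝ) ≤ N * α + 1 := (Nat.ceil_lt_add_one (by positivity)).le
  have he1 : (⌈N * β⌉₊ : ℝ) ≤ N * β + 1 := (Nat.ceil_lt_add_one (by positivity)).le
  have hd2 : N * α ≤ (⌈N * α⌉₊ : ℝ) := Nat.le_ceil _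
  have he2 : N * β ≤ (⌈N * β⌉₊ : ℝ) := Nat.le_ceil _
  refine ⟨T, hT0, ⌈N * α⌉₊, Nat.ceil_le.mpr (by nlinarith), ⌈N * β⌉₊,
    Nat.ceil_le.mpr (by nlinarith), ?_⟩
  set d : ℝ := (⌈N * α⌉₊ : ℝ) with hd
  set e : ℝ := (⌈N * β⌉₊ : ℝ) with he
  have hH : N ^ 2 * q ≤ (d + 1) * (e + 1) := by
    calc (N : ℝ) ^ 2 * q = (N * α) * (N * β) := by rw [hq]; ring
      _ ≤ (d + 1) * (e + 1) := by gcongr <;> linarith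
  have hlin : d * β + e * α - T ≤ 2 * (N * q) + 2 - T := by
    have h1 : d * β ≤ (N * α + 1) * β := by gcongr
    have h2 : e * α ≤ (N * β + 1) * α := by gcongr
    rw [hq]
    linarith
  have hNq : 2 ≤ N * q := hN1.trans (by gcongr)
  have hneg : 2 * (N * q) + 2 - T ≤ 0 := by
    have : 3 * 1 * (N * q) ≤ 3 * √(1 + δ) * (N * q) := by gcongr
    linarith
  have hmain : ((d + 1) * (e + 1)) * (d * β + e * α - T) ≤
      (N ^ 2 * q) * (2 * (N * q) + 2 - T) := by
    calc _ ≤ ((d + 1) * (e + 1)) * (2 * (N * q) + 2 - T) := by gcongr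
      _ ≤ _ := mul_le_mul_of_nonpos_right hH hneg
  have hTN : T ≤ 2 * N := by
    refine (sq_le_sq₀ hT0 (by positivity)).mp ?_
    rw [hT2]
    have : q * μ ≤ 1 := mul_le_one₀ hq1 hμ0.le hμ1
    have := mul_le_mul_of_nonneg_left this (sq_nonneg (N : ℝ))
    have := sq_nonneg (N : ℝ)
    linarith
  have hμβ : 1 / μ ≤ 1 / β₀ := one_div_le_one_div_of_le hβ₀ (hβ.trans hβμ)
  have hcub : (T + μ + 1) ^ 3 / (6 * μ) ≤ N ^ 2 * q * T / 3 + 2 * N ^ 2 + 6 / β₀ * N ^ 2 := by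
    have h1 : (T + μ + 1) ^ 3 ≤ (T + 2) ^ 3 :=
      pow_le_pow_left₀ (by positivity) (by linarith) 3
    have h2 : (T + 2) ^ 3 ≤ 2 * N ^ 2 * q * μ * T + 12 * N ^ 2 * q * μ + 32 * N ^ 2 := by
      have h3 : (T + 2) ^ 3 = T ^ 2 * T + 6 * T ^ 2 + 12 * T + 8 := by ring
      rw [h3, hT2]
      have : (N : ℝ) ≤ N ^ 2 := le_self_pow₀ hN3 two_ne_zero
      linarith
    rw [div_le_iff₀ (by positivity)]
    have h4 : 36 * (N : ℝ) ^ 2 ≤ 6 / β₀ * N ^ 2 * (6 * μ) := by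
      have : 1 ≤ 1 / β₀ * μ := by
        rw [div_mul_eq_mul_div, one_mul, le_div_iff₀ hβ₀]
        linarith
      have : 36 * (N : ℝ) ^ 2 * 1 ≤ 36 * (N : ℝ) ^ 2 * (1 / β₀ * μ) := by gcongr
      calc _ ≤ 36 * (N : ℝ) ^ 2 * (1 / β₀ * μ) := by linarith
        _ = _ := by ring
    have h5 : 12 * (N : ℝ) ^ 2 * q * μ ≤ 2 * N ^ 2 * (6 * μ) := by
      have : (N : ℝ) ^ 2 * μ * q ≤ N ^ 2 * μ * 1 := by gcongr
      linarith
    have h6 : (N ^ 2 * q * T / 3) * (6 * μ) = 2 * N ^ 2 * q * μ * T := by ring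
    have h7 := sq_nonneg (N : ℝ)
    rw [add_mul, add_mul, h6]
    linarith
  have hsave : N ^ 2 * q * (2 * (N * q) + 2 - T) + N ^ 2 * q * T / 3 ≤
      2 * N ^ 2 - N ^ 2 * (N * (2 * q₀ ^ 2 * θ)) := by
    have h1 : 2 * (N * q) - 2 / 3 * T ≤ - (2 * (N * q) * θ) := by
      rw [hθ]; linarith
    have h2 : N ^ 2 * q * (2 * (N * q) - 2 / 3 * T) ≤ N ^ 2 * q * (- (2 * (N * q) * θ)) := by
      gcongr
    have h3 : (N : ℝ) ^ 2 * (N * (2 * q₀ ^ 2 * θ)) ≤ N ^ 2 * (N * (2 * q ^ 2 * θ)) := by gcongr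
    have h4 : (N : ℝ) ^ 2 * q ≤ N ^ 2 * 1 := by gcongr
    linarith
  have hfin : (N : ℝ) ^ 2 * (5 + 6 / β₀) ≤ N ^ 2 * (N * (2 * q₀ ^ 2 * θ)) := by gcongr
  have hN4 : (1 : ℝ) ≤ N ^ 2 := one_le_pow₀ hN3
  linarith

lemma add_pow_eq_sum_range {R : Type*} [CommRing R] (x y : R) {n P : ℕ} (h : n < P) :
    (x + y) ^ n = ∑ m ∈ Finset.range P, (n.choose m : R) * y ^ (n - m) * x ^ m := by
  rw [add_pow]
  have hsub : Finset.range (n + 1) ⊆ Finset.range P := Finset.range_subset_range.mpr h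
  rw [← Finset.sum_subset hsub]
  · exact Finset.sum_congr rfl fun m _ => by ring
  · intro m _ hm
    rw [Finset.mem_range, not_lt] at hm
    rw [Nat.choose_eq_zero_of_lt (by omega)]
    simp

lemma exists_pow_mul_pow_expansion (k d e : ℕ) {s₀ : ℝ} (hs₀ : |s₀| ≤ 2) :
    ∃ c : Fin (d + 1) × Fin (e + 1) → Fin (d + k * e + 1) × Fin (e + 1) → ℝ,
      (∀ n i, |c n i| ≤ 2 ^ e * (2 ^ (d + k * e) * 2 ^ (d + k * e))) ∧
      ∀ (n) (σ τ : ℝ), (s₀ + σ) ^ (n.1 : ℕ) * ((s₀ + σ) ^ k + τ) ^ (n.2 : ℕ) =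
        ∑ i, c n i * (σ ^ (i.1 : ℕ) * τ ^ (i.2 : ℕ)) := by
  set D := d + k * e with hD
  refine ⟨fun n i => ((n.2 : ℕ).choose i.2 : ℝ) *
    ((((n.1 + k * (n.2 - i.2) : ℕ)).choose i.1 : ℝ) *
      s₀ ^ ((n.1 + k * (n.2 - i.2) : ℕ) - (i.1 : ℕ))), ?_, ?_⟩
  · intro n i
    have h1 : (n.1 : ℕ) ≤ d := Nat.lt_succ_iff.mp n.1.2
    have h2 : (n.2 : ℕ) ≤ e := Nat.lt_succ_iff.mp n.2.2
    have h3 : (n.1 + k * (n.2 - i.2) : ℕ) ≤ D :=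
      Nat.add_le_add h1 (Nat.mul_le_mul_left k ((Nat.sub_le _ _).trans h2))
    have hch : ∀ {p q r : ℕ}, p ≤ r → |(p.choose q : ℝ)| ≤ 2 ^ r := by
      intro p q r hpr
      rw [abs_of_nonneg (by positivity)]
      exact_mod_cast (Nat.choose_le_two_pow p q).trans (Nat.pow_le_pow_right (by norm_num) hpr)
    rw [abs_mul, abs_mul, abs_pow]
    have h4 : |s₀| ^ ((n.1 + k * (n.2 - i.2) : ℕ) - (i.1 : ℕ)) ≤ 2 ^ D := by
      calc _ ≤ (2 : ℝ) ^ ((n.1 + k * (n.2 - i.2) : ℕ) - (i.1 : ℕ)) := by gcongr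
        _ ≤ _ := pow_le_pow_right₀ (by norm_num) ((Nat.sub_le _ _).trans h3)
    have h5 := hch (q := i.2) h2
    have h6 := hch (q := i.1) h3
    gcongr
  · intro n σ τ
    have h1 : (n.1 : ℕ) ≤ d := Nat.lt_succ_iff.mp n.1.2
    have h2 : (n.2 : ℕ) ≤ e := Nat.lt_succ_iff.mp n.2.2
    rw [add_comm _ τ, add_pow_eq_sum_range τ _ n.2.2, Finset.mul_sum, Finset.sum_range,
      Fintype.sum_prod_type_right]
    refine Finset.sum_congr rfl fun l _ => ?_
    have h3 : (n.1 + k * (n.2 - l) : ℕ) < D + 1 :=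
      Nat.lt_succ_of_le (Nat.add_le_add h1 (Nat.mul_le_mul_left k ((Nat.sub_le _ _).trans h2)))
    have h4 : (s₀ + σ) ^ (n.1 : ℕ) * (((n.2 : ℕ).choose l : ℝ) * ((s₀ + σ) ^ k) ^ (n.2 - l : ℕ) *
        τ ^ (l : ℕ)) = ((n.2 : ℕ).choose l : ℝ) * τ ^ (l : ℕ) *
        (s₀ + σ) ^ (n.1 + k * (n.2 - l) : ℕ) := by
      rw [pow_add, pow_mul]
      ring
    rw [h4, add_comm s₀, add_pow_eq_sum_range σ _ h3, Finset.mul_sum, Finset.sum_range]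
    exact Finset.sum_congr rfl fun m _ => by ring

/-- The constant in the estimate for the determinant of the monomials. -/
noncomputable def detConst (k d e : ℕ) : ℝ :=
  (2 ^ d * 3 ^ e) ^ ((d + 1) * (e + 1)) *
    ((((d + k * e + 1) * (e + 1) : ℕ) * (2 ^ e * (2 ^ (d + k * e) * 2 ^ (d + k * e)))) ^
      ((d + 1) * (e + 1)) * (((d + 1) * (e + 1)).factorial *
        ((2 ^ k) ^ e) ^ ((d + 1) * (e + 1))))

lemma detConst_nonneg (k d e : ℕ) : 0 ≤ detConst k d e := by
  rw [detConst]; positivity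

lemma abs_det_monoRow_le {k d e : ℕ} {Z α β μ s₀ T : ℝ} (hZ : 1 ≤ Z) (hμ : 0 < μ)
    (hT : 0 ≤ T) (hs₀ : |s₀| ≤ 2) {x y a b : Fin (d + 1) × Fin (e + 1) → ℤ}
    (hy0 : ∀ p, y p ≠ 0) (ha0 : ∀ p, a p ≠ 0)
    (hy : ∀ p, |(y p : ℝ)| ≤ 2 * Z ^ β) (ha : ∀ p, |(a p : ℝ)| ≤ 3 * Z ^ α)
    (hs : ∀ p, |(x p : ℝ) / y p - s₀| ≤ Z ^ (-μ))
    (ht : ∀ p, |(b p : ℝ) / a p - ((x p : ℝ) / y p) ^ k| ≤ 2 ^ k * Z ^ (-1 : ℝ)) :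
    |((Matrix.of fun p => monoRow d e (x p) (y p) (a p) (b p)).det : ℝ)| ≤
      detConst k d e * Z ^ (((d + 1) * (e + 1) : ℝ) * (d * β + e * α) -
        ((d + 1) * (e + 1) * T - (T + μ + 1) ^ 3 / (6 * μ))) := by
  have hZ0 : 0 < Z := by linarith
  have hcard : Fintype.card (Fin (d + 1) × Fin (e + 1)) = (d + 1) * (e + 1) := by simp
  obtain ⟨c, hc, hexp⟩ := exists_pow_mul_pow_expansion k d e hs₀
  set σ : Fin (d + 1) × Fin (e + 1) → ℝ := fun p => (x p : ℝ) / y p - s₀ with hσ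
  set τ : Fin (d + 1) × Fin (e + 1) → ℝ := fun p => (b p : ℝ) / a p - ((x p : ℝ) / y p) ^ k with hτ
  set V : Fin (d + k * e + 1) × Fin (e + 1) → Fin (d + 1) × Fin (e + 1) → ℝ :=
    fun i p => σ p ^ (i.1 : ℕ) * τ p ^ (i.2 : ℕ) with hV
  set w : Fin (d + k * e + 1) × Fin (e + 1) → ℝ :=
    fun i => (2 ^ k) ^ e * Z ^ (-(μ * (i.1 : ℕ) + (i.2 : ℕ))) with hw
  set E := (d + 1) * (e + 1) * T - (T + μ + 1) ^ 3 / (6 * μ) with hE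
  have hVw : ∀ i p, |V i p| ≤ w i := by
    intro i p
    have h2 : (i.2 : ℕ) ≤ e := Nat.lt_succ_iff.mp i.2.2
    calc |V i p| = |σ p| ^ (i.1 : ℕ) * |τ p| ^ (i.2 : ℕ) := by rw [hV, abs_mul, abs_pow, abs_pow]
      _ ≤ (Z ^ (-μ)) ^ (i.1 : ℕ) * (2 ^ k * Z ^ (-1 : ℝ)) ^ (i.2 : ℕ) := by
        gcongr
        · exact hs p
        · exact ht p
      _ = (2 ^ k) ^ (i.2 : ℕ) * Z ^ (-(μ * (i.1 : ℕ) + (i.2 : ℕ))) := by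
        rw [mul_pow, ← Real.rpow_mul_natCast hZ0.le, ← Real.rpow_mul_natCast hZ0.le,
          neg_add, Real.rpow_add hZ0]
        ring_nf
      _ ≤ _ := by
        change _ ≤ (2 ^ k) ^ e * Z ^ (-(μ * (i.1 : ℕ) + (i.2 : ℕ)))
        have : (1 : ℝ) ≤ 2 ^ k := one_le_pow₀ (by norm_num)
        gcongr
  have hρ : ∀ r : Fin (d + 1) × Fin (e + 1) → Fin (d + k * e + 1) × Fin (e + 1),
      Function.Injective r → ∏ n, w (r n) ≤ ((2 ^ k) ^ e) ^ ((d + 1) * (e + 1)) * Z ^ (-E) := by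
    intro r hr
    rw [Finset.prod_mul_distrib, Finset.prod_const, Finset.card_univ, hcard,
      ← Real.rpow_sum_of_pos hZ0, Finset.sum_neg_distrib]
    gcongr
    have := le_sum_weight hT hμ hr
    rw [hcard] at this
    push_cast at this
    exact this
  have hdet := abs_det_le_of_expansion hVw (by positivity) hc (by positivity) hρ
  rw [hcard, Fintype.card_prod, Fintype.card_fin, Fintype.card_fin] at hdet
  set W : Matrix (Fin (d + 1) × Fin (e + 1)) (Fin (d + 1) × Fin (e + 1)) ℝ :=
    Matrix.of fun n p => ∑ i, c n i * V i p with hW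
  have hfac : ((Matrix.of fun p => monoRow d e (x p) (y p) (a p) (b p)).det : ℝ) =
      (∏ p, ((y p : ℝ) ^ d * (a p : ℝ) ^ e)) * W.det := by
    have h2 := RingHom.map_det (Int.castRingHom ℝ)
      (Matrix.of fun p => monoRow d e (x p) (y p) (a p) (b p))
    rw [eq_intCast] at h2
    rw [h2, ← Matrix.det_transpose W, ← Matrix.det_mul_column]
    congr 1
    ext p n
    have hy' : (y p : ℝ) ≠ 0 := by exact_mod_cast hy0 p
    have ha' : (a p : ℝ) ≠ 0 := by exact_mod_cast ha0 p
    have h3 : ((x p : ℝ)) = y p * (s₀ + σ p) := by rw [hσ]; field_simp; ring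
    have h4 : ((b p : ℝ)) = a p * ((s₀ + σ p) ^ k + τ p) := by
      have : s₀ + σ p = (x p : ℝ) / y p := by rw [hσ]; ring
      rw [this, hτ]; field_simp; ring
    simp only [RingHom.mapMatrix_apply, Matrix.map_apply, Matrix.of_apply, eq_intCast,
      Matrix.transpose_apply, hW, hV]
    rw [cast_monoRow h3 h4, hexp]
  have hprod : |∏ p, ((y p : ℝ) ^ d * (a p : ℝ) ^ e)| ≤
      (2 ^ d * 3 ^ e) ^ ((d + 1) * (e + 1)) * Z ^ (((d + 1) * (e + 1) : ℝ) * (d * β + e * α)) := by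
    rw [Finset.abs_prod]
    calc _ ≤ ∏ _p : Fin (d + 1) × Fin (e + 1), ((2 * Z ^ β) ^ d * (3 * Z ^ α) ^ e) := by
          refine Finset.prod_le_prod (fun _ _ => abs_nonneg _) fun p _ => ?_
          rw [abs_mul, abs_pow, abs_pow]
          have := hy p
          have := ha p
          gcongr
      _ = ((2 ^ d * 3 ^ e) * Z ^ (d * β + e * α)) ^ ((d + 1) * (e + 1)) := by
          rw [Finset.prod_const, Finset.card_univ, hcard, mul_pow 2 (Z ^ β), mul_pow 3 (Z ^ α),
            ← Real.rpow_mul_natCast hZ0.le, ← Real.rpow_mul_natCast hZ0.le, Real.rpow_add hZ0]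
          ring_nf
      _ = _ := by
          rw [mul_pow, ← Real.rpow_mul_natCast hZ0.le]
          push_cast
          ring_nf
  rw [hfac, abs_mul]
  refine (mul_le_mul hprod hdet (abs_nonneg _) (by positivity)).trans (le_of_eq ?_)
  rw [detConst, sub_eq_add_neg _ E, Real.rpow_add hZ0]
  ring

/-- Rational points close to a point of the curve `t = s ^ k` lie on a common curve of bounded
degree. -/
lemma exists_det_monoRow_eq_zero (k : ℕ) {η β₀ δ : ℝ} (hη : 0 < η) (hβ₀ : 0 < β₀) (hδ : 0 < δ) :
    ∃ N : ℕ, ∃ Z₀ : ℝ, 1 ≤ Z₀ ∧ ∀ Z : ℝ, Z₀ ≤ Z → ∀ α β μ s₀ : ℝ, η ≤ α → α ≤ 1 → β₀ ≤ β →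
      β ≤ μ → μ ≤ 1 → 9 / 2 * (1 + δ) * (α * β) ≤ μ → |s₀| ≤ 2 → ∃ d ≤ N, ∃ e ≤ N,
      ∀ x y a b : Fin (d + 1) × Fin (e + 1) → ℤ, (∀ p, y p ≠ 0) → (∀ p, a p ≠ 0) →
      (∀ p, |(y p : ℝ)| ≤ 2 * Z ^ β) → (∀ p, |(a p : ℝ)| ≤ 3 * Z ^ α) →
      (∀ p, |(x p : ℝ) / y p - s₀| ≤ Z ^ (-μ)) →
      (∀ p, |(b p : ℝ) / a p - ((x p : ℝ) / y p) ^ k| ≤ 2 ^ k * Z ^ (-1 : ℝ)) →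
      (Matrix.of fun p => monoRow d e (x p) (y p) (a p) (b p)).det = 0 := by
  obtain ⟨N, hN⟩ := exists_exponent_lt hη hβ₀ hδ
  have hsum : ∀ d ∈ Finset.range (N + 1), 0 ≤ ∑ e ∈ Finset.range (N + 1), detConst k d e :=
    fun d _ => Finset.sum_nonneg fun e _ => detConst_nonneg k d e
  refine ⟨N, 1 + ∑ d ∈ Finset.range (N + 1), ∑ e ∈ Finset.range (N + 1), detConst k d e,
    by linarith [Finset.sum_nonneg hsum], ?_⟩
  intro Z hZ α β μ s₀ hα hα1 hβ hβμ hμ1 hμ hs₀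
  obtain ⟨T, hT, d, hd, e, he, hle⟩ := hN α β μ hα hα1 hβ hβμ hμ1 hμ
  refine ⟨d, hd, e, he, ?_⟩
  intro x y a b hy0 ha0 hy ha hs ht
  have hZ1 : 1 ≤ Z := by linarith [Finset.sum_nonneg hsum]
  have hμ0 : 0 < μ := by linarith
  have h1 := abs_det_monoRow_le hZ1 hμ0 hT hs₀ hy0 ha0 hy ha hs ht
  have h2 : detConst k d e < Z := by
    have h3 := Finset.single_le_sum (fun e _ => detConst_nonneg k d e)
      (Finset.mem_range.mpr (Nat.lt_succ_of_le he))
    have h4 := Finset.single_le_sum hsum (Finset.mem_range.mpr (Nat.lt_succ_of_le hd))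
    linarith
  refine Int.abs_lt_one_iff.mp ?_
  have h5 : |((Matrix.of fun p => monoRow d e (x p) (y p) (a p) (b p)).det : ℝ)| < 1 := by
    calc _ ≤ _ := h1
      _ ≤ detConst k d e * Z ^ (-1 : ℝ) := by
        have := detConst_nonneg k d e
        gcongr
      _ < 1 := by
        rw [Real.rpow_neg_one, ← div_eq_mul_inv, div_lt_one (by linarith)]
        exact h2
  exact_mod_cast h5

/-- Vanishing of the determinant of the monomials is preserved by a linear substitution. -/
lemma det_monoRow_eq_zero_of_linear {d e : ℕ} {x y u v a b : Fin (d + 1) × Fin (e + 1) → ℤ}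
    (hy : ∀ p, y p ≠ 0) {p₁ q₁ p₂ q₂ : ℤ} (hu : ∀ p, u p = p₁ * x p + q₁ * y p)
    (hv : ∀ p, v p = p₂ * x p + q₂ * y p)
    (h0 : (Matrix.of fun p => monoRow d e (x p) (y p) (a p) (b p)).det = 0) :
    (Matrix.of fun p => monoRow d e (u p) (v p) (a p) (b p)).det = 0 := by
  set q : ℕ → ℤ[X] := fun i => (C p₁ * X + C q₁) ^ i * (C p₂ * X + C q₂) ^ (d - i) with hq
  have hdeg : ∀ i ≤ d, (q i).natDegree ≤ d := by
    intro i hi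
    refine natDegree_mul_le.trans ?_
    have h1 := natDegree_pow_le_of_le i (natDegree_linear_le (a := p₁) (b := q₁))
    have h2 := natDegree_pow_le_of_le (d - i) (natDegree_linear_le (a := p₂) (b := q₂))
    omega
  have hval : ∀ i ≤ d, ∀ p, homEval d (q i) (x p) (y p) = u p ^ i * v p ^ (d - i) := by
    intro i hi p
    have hy' : (y p : ℚ) ≠ 0 := by exact_mod_cast hy p
    have h1 := cast_homEval (R := ℚ) (hdeg i hi) (u := x p) (v := y p) (w := (x p : ℚ) / y p)
      (by field_simp)
    have h2 : ((y p : ℚ)) ^ d = (y p : ℚ) ^ i * (y p : ℚ) ^ (d - i) := by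
      rw [← pow_add, Nat.add_sub_cancel' hi]
    have h3 : ∀ r s : ℤ, (y p : ℚ) * (r * ((x p : ℚ) / y p) + s) = r * x p + s * y p := by
      intro r s
      field_simp
    have h4 : eval₂ (Int.castRingHom ℚ) ((x p : ℚ) / y p) (q i) =
        (p₁ * ((x p : ℚ) / y p) + q₁) ^ i * (p₂ * ((x p : ℚ) / y p) + q₂) ^ (d - i) := by
      rw [hq, eval₂_mul, eval₂_pow, eval₂_pow, eval₂_add, eval₂_add, eval₂_mul, eval₂_mul,
        eval₂_C, eval₂_C, eval₂_C, eval₂_C, eval₂_X]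
      simp only [eq_intCast]
    rw [h2, h4] at h1
    rw [mul_mul_mul_comm, ← mul_pow, ← mul_pow, h3, h3] at h1
    rw [hu, hv]
    exact_mod_cast h1
  have hmul : (Matrix.of fun p => monoRow d e (u p) (v p) (a p) (b p)) =
      (Matrix.of fun p => monoRow d e (x p) (y p) (a p) (b p)) *
        Matrix.of fun m n => if m.2 = n.2 then (q n.1).coeff m.1 else 0 := by
    ext p n
    have hn : (n.1 : ℕ) ≤ d := Nat.lt_succ_iff.mp n.1.2
    rw [Matrix.mul_apply, Fintype.sum_prod_type]
    simp only [Matrix.of_apply, mul_ite, mul_zero, Finset.sum_ite_eq', Finset.mem_univ, if_true]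
    rw [monoRow, ← hval n.1 hn, homEval, Finset.sum_range, Finset.sum_mul]
    refine Finset.sum_congr rfl fun m _ => ?_
    rw [monoRow]
    ring
  rw [hmul, Matrix.det_mul, h0, zero_mul]

/-- The squared length of a lattice vector. -/
noncomputable def latSq (M Y s₀ : ℝ) (x y : ℤ) : ℝ :=
  (M * (x - s₀ * y) / (2 * Y)) ^ 2 + (y / (2 * Y)) ^ 2

lemma latSq_nonneg (M Y s₀ : ℝ) (x y : ℤ) : 0 ≤ latSq M Y s₀ x y := by
  rw [latSq]; positivity

/-- The lattice has a basis in which the coordinates of a vector are controlled by its length. -/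
lemma exists_reduced_basis {M Y : ℝ} (hM : 0 < M) (hY : 0 < Y) (s₀ : ℝ) :
    ∃ a b c d : ℤ, a * d - b * c = 1 ∧ ∀ u v : ℤ,
      3 * (latSq M Y s₀ d c * u ^ 2) ≤ 4 * latSq M Y s₀ (d * u + b * v) (c * u + a * v) ∧
      3 * (latSq M Y s₀ d c * v ^ 2) ≤ 4 * latSq M Y s₀ (d * u + b * v) (c * u + a * v) := by
  have him : 0 < (⟨-s₀, 1 / M⟩ : ℂ).im := by simpa using hM
  obtain ⟨g, hg⟩ := ModularGroup.exists_smul_mem_fd ⟨⟨-s₀, 1 / M⟩, him⟩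
  set a := g 0 0 with ha
  set b := g 0 1 with hb
  set c := g 1 0 with hc
  set d := g 1 1 with hd
  have hdet : a * d - b * c = 1 := by
    have := Matrix.SpecialLinearGroup.det_coe g
    rwa [Matrix.det_fin_two] at this
  refine ⟨a, b, c, d, hdet, ?_⟩
  obtain ⟨h1, h2⟩ := hg
  rw [UpperHalfPlane.specialLinearGroup_apply] at h1 h2
  change |Complex.re (_ / _)| ≤ _ at h2
  simp only [algebraMap_int_eq, eq_intCast, ← ha, ← hb, ← hc, ← hd] at h1 h2
  set D : ℂ := ((c : ℝ) : ℂ) * (⟨-s₀, 1 / M⟩ : ℂ) + ((d : ℝ) : ℂ) with hD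
  set A : ℂ := ((a : ℝ) : ℂ) * (⟨-s₀, 1 / M⟩ : ℂ) + ((b : ℝ) : ℂ) with hA
  set τ : ℂ := A / D with hτ
  have hre : ∀ p q : ℤ, (((p : ℝ) : ℂ) * (⟨-s₀, 1 / M⟩ : ℂ) + ((q : ℝ) : ℂ)).re = q - s₀ * p := by
    intro p q
    rw [Complex.add_re, Complex.re_ofReal_mul, Complex.ofReal_re]
    ring
  have him : ∀ p q : ℤ, (((p : ℝ) : ℂ) * (⟨-s₀, 1 / M⟩ : ℂ) + ((q : ℝ) : ℂ)).im = p / M := by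
    intro p q
    rw [Complex.add_im, Complex.im_ofReal_mul, Complex.ofReal_im]
    ring
  have hD0 : D ≠ 0 := by
    intro h
    have h3 : D.im = c / M := him c d
    have h4 : D.re = d - s₀ * c := hre c d
    rw [h, Complex.zero_im] at h3
    have hc0 : (c : ℝ) = 0 := by
      rcases div_eq_zero_iff.mp h3.symm with h | h
      · exact h
      · exact absurd h hM.ne'
    rw [h, Complex.zero_re, hc0, mul_zero, sub_zero] at h4
    have hc0' : c = 0 := by exact_mod_cast hc0
    have hd0' : d = 0 := by exact_mod_cast h4.symm
    rw [hc0', hd0'] at hdet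
    simp at hdet
  have hτD : τ * D = A := div_mul_cancel₀ _ hD0
  have e1 : τ.re * D.re - τ.im * D.im = A.re := by rw [← hτD, Complex.mul_re]
  have e2 : τ.re * D.im + τ.im * D.re = A.im := by rw [← hτD, Complex.mul_im]
  have hDre : D.re = d - s₀ * c := hre c d
  have hDim : D.im = c / M := him c d
  have hAre : A.re = b - s₀ * a := hre a b
  have hAim : A.im = a / M := him a b
  rw [Complex.normSq_apply] at h1
  have hlat : ∀ x y : ℤ, latSq M Y s₀ x y =
      (M / (2 * Y)) ^ 2 * ((x - s₀ * y) ^ 2 + (y / M) ^ 2) := by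
    intro x y
    rw [latSq]
    field_simp
  intro u v
  have hN : 0 ≤ D.re ^ 2 + D.im ^ 2 := by positivity
  have hkey : ((d * u + b * v : ℤ) - s₀ * (c * u + a * v : ℤ)) ^ 2 +
      ((c * u + a * v : ℤ) / M) ^ 2 =
      (D.re ^ 2 + D.im ^ 2) * (u ^ 2 + 2 * u * v * τ.re + v ^ 2 * (τ.re * τ.re + τ.im * τ.im)) := by
    have h3 : ((d * u + b * v : ℤ) - s₀ * (c * u + a * v : ℤ)) = u * D.re + v * A.re := by
      rw [hDre, hAre]; push_cast; ring
    have h4 : (c * u + a * v : ℤ) / M = u * D.im + v * A.im := by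
      rw [hDim, hAim]; push_cast; ring
    rw [h3, h4, ← e1, ← e2]
    ring
  have hab : |(u : ℝ) * v * τ.re| ≤ |(u : ℝ)| * |(v : ℝ)| * (1 / 2) := by
    rw [abs_mul, abs_mul]
    gcongr
  have hab' := (abs_le.mp hab).1
  have hlow : (u : ℝ) ^ 2 - |(u : ℝ)| * |(v : ℝ)| + v ^ 2 ≤
      u ^ 2 + 2 * u * v * τ.re + v ^ 2 * (τ.re * τ.re + τ.im * τ.im) := by
    have := mul_le_mul_of_nonneg_left h1 (sq_nonneg (v : ℝ))
    linarith
  have hu : 3 * (u : ℝ) ^ 2 ≤ 4 * ((u : ℝ) ^ 2 - |(u : ℝ)| * |(v : ℝ)| + v ^ 2) := by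
    rw [← sq_abs (u : ℝ), ← sq_abs (v : ℝ)]
    nlinarith [sq_nonneg (|(u : ℝ)| - 2 * |(v : ℝ)|)]
  have hv : 3 * (v : ℝ) ^ 2 ≤ 4 * ((u : ℝ) ^ 2 - |(u : ℝ)| * |(v : ℝ)| + v ^ 2) := by
    rw [← sq_abs (u : ℝ), ← sq_abs (v : ℝ)]
    nlinarith [sq_nonneg (2 * |(u : ℝ)| - |(v : ℝ)|)]
  rw [hlat, hlat, hkey, ← hDre, ← hDim]
  have hK : 0 ≤ (M / (2 * Y)) ^ 2 * (D.re ^ 2 + D.im ^ 2) := by positivity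
  constructor
  · have := mul_le_mul_of_nonneg_left (hu.trans (mul_le_mul_of_nonneg_left hlow (by norm_num))) hK
    linarith
  · have := mul_le_mul_of_nonneg_left (hv.trans (mul_le_mul_of_nonneg_left hlow (by norm_num))) hK
    linarith

/-- The length of a shortest nonzero lattice vector. -/
noncomputable def latMin (M Y s₀ : ℝ) : ℝ :=
  sInf {r : ℝ | ∃ x y : ℤ, ¬(x = 0 ∧ y = 0) ∧ r = √(latSq M Y s₀ x y)}

lemma latMin_le (M Y s₀ : ℝ) {x y : ℤ} (h : ¬(x = 0 ∧ y = 0)) :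
    latMin M Y s₀ ≤ √(latSq M Y s₀ x y) := by
  refine csInf_le ⟨0, ?_⟩ ⟨x, y, h, rfl⟩
  rintro _ ⟨x, y, -, rfl⟩
  exact Real.sqrt_nonneg _

lemma le_latMin {M Y : ℝ} (hM : 1 ≤ M) (hY : 0 < Y) (s₀ : ℝ) : 1 / (2 * Y) ≤ latMin M Y s₀ := by
  refine le_csInf ⟨_, 1, 0, by simp, rfl⟩ ?_
  rintro _ ⟨x, y, h, rfl⟩
  refine Real.le_sqrt_of_sq_le ?_
  rw [latSq]
  have hone : ∀ z : ℤ, z ≠ 0 → 1 ≤ (z : ℝ) ^ 2 := by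
    intro z hz
    have : (1 : ℤ) ≤ z ^ 2 := by
      have := sq_nonneg z
      have := pow_ne_zero 2 hz
      omega
    exact_mod_cast this
  by_cases hy : y = 0
  · have hx : x ≠ 0 := fun hx => h ⟨hx, hy⟩
    have h1 : 1 ≤ (M * x) ^ 2 := by
      rw [mul_pow]
      exact one_le_mul_of_one_le_of_one_le (one_le_pow₀ hM) (hone x hx)
    rw [hy]
    simp only [Int.cast_zero, mul_zero, sub_zero, zero_div, ne_eq, OfNat.ofNat_ne_zero,
      not_false_eq_true, zero_pow, add_zero]
    rw [div_pow, div_pow, one_pow]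
    gcongr
  · have h1 := hone y hy
    have h2 : (1 / (2 * Y)) ^ 2 ≤ (y / (2 * Y)) ^ 2 := by
      rw [div_pow, div_pow, one_pow]
      gcongr
    have := sq_nonneg (M * (x - s₀ * y) / (2 * Y))
    linarith

lemma abs_le_two_div_latMin {M Y s₀ : ℝ} (hM : 1 ≤ M) (hY : 0 < Y) {x y d c : ℤ} {u : ℤ}
    (hdc : ¬(d = 0 ∧ c = 0)) (h : 3 * (latSq M Y s₀ d c * u ^ 2) ≤ 4 * latSq M Y s₀ x y)
    (hxy : latSq M Y s₀ x y ≤ 2) : |(u : ℝ)| ≤ 2 / latMin M Y s₀ := by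
  have h0 : 0 < latMin M Y s₀ := (by positivity : 0 < 1 / (2 * Y)).trans_le (le_latMin hM hY s₀)
  have h1 : latMin M Y s₀ ^ 2 ≤ latSq M Y s₀ d c := by
    rw [← Real.le_sqrt h0.le (latSq_nonneg _ _ _ _ _)]
    exact latMin_le _ _ _ hdc
  rw [le_div_iff₀ h0]
  refine abs_le_of_sq_le_sq' ?_ (by norm_num) |>.2
  rw [mul_pow, sq_abs]
  have := mul_le_mul_of_nonneg_right h1 (sq_nonneg (u : ℝ))
  linarith

/-- The solutions `(a, b, x, y)` of `a x ^ k - b y ^ k = 1` in the given ranges. -/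
def IsSol (k : ℕ) (Z X Y : ℝ) (M : ℕ) (s₀ : ℝ) (q : ℕ × ℕ × ℕ × ℕ) : Prop :=
  0 < q.1 ∧ 0 < q.2.1 ∧ 0 < q.2.2.1 ∧ 0 < q.2.2.2 ∧
    (q.1 : ℤ) * (q.2.2.1 : ℤ) ^ k - (q.2.1 : ℤ) * (q.2.2.2 : ℤ) ^ k = 1 ∧
    X < (q.2.2.1 : ℝ) ∧ (q.2.2.1 : ℝ) ≤ 2 * X ∧
    Y < (q.2.2.2 : ℝ) ∧ (q.2.2.2 : ℝ) ≤ 2 * Y ∧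
    Z < (q.2.1 : ℝ) * (q.2.2.2 : ℝ) ^ k ∧
    (q.2.1 : ℝ) * (q.2.2.2 : ℝ) ^ k ≤ 2 * Z ∧
    s₀ < (q.2.2.1 : ℝ) / (q.2.2.2 : ℝ) ∧
    (q.2.2.1 : ℝ) / (q.2.2.2 : ℝ) ≤ s₀ + 1 / (M : ℝ)

section

variable {k : ℕ} {Z X Y : ℝ} {M : ℕ} {s₀ : ℝ} {a b x y : ℕ}

lemma IsSol.eq_real (h : IsSol k Z X Y M s₀ (a, b, x, y)) :
    (a : ℝ) * x ^ k = 1 + b * y ^ k := by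
  have h1 : (a : ℤ) * (x : ℤ) ^ k - (b : ℤ) * (y : ℤ) ^ k = 1 := h.2.2.2.2.1
  have h2 : (a : ℝ) * (x : ℝ) ^ k - (b : ℝ) * (y : ℝ) ^ k = 1 := by exact_mod_cast h1
  linarith

lemma IsSol.coprime_xy (hk : k ≠ 0) (h : IsSol k Z X Y M s₀ (a, b, x, y)) :
    IsCoprime (x : ℤ) y := by
  have h1 : (a : ℤ) * (x : ℤ) ^ k - (b : ℤ) * (y : ℤ) ^ k = 1 := h.2.2.2.2.1
  exact (IsCoprime.pow_iff (Nat.pos_of_ne_zero hk) (Nat.pos_of_ne_zero hk)).mp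
    ⟨a, -b, by linear_combination h1⟩

lemma IsSol.coprime_ab (h : IsSol k Z X Y M s₀ (a, b, x, y)) : IsCoprime (a : ℤ) b := by
  have h1 : (a : ℤ) * (x : ℤ) ^ k - (b : ℤ) * (y : ℤ) ^ k = 1 := h.2.2.2.2.1
  exact ⟨(x : ℤ) ^ k, -(y : ℤ) ^ k, by linear_combination h1⟩

lemma IsSol.a_mul_le (hZ : 1 ≤ Z) (h : IsSol k Z X Y M s₀ (a, b, x, y)) :
    (a : ℝ) * x ^ k ≤ 3 * Z := by
  have h1 := h.eq_real
  obtain ⟨-, -, -, -, -, -, -, -, -, -, h2, -⟩ := h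
  simp only at h2
  linarith

lemma IsSol.a_le (hZ : 1 ≤ Z) (hX : 1 ≤ X) (h : IsSol k Z X Y M s₀ (a, b, x, y)) :
    (a : ℝ) ≤ 3 * (Z / X ^ k) := by
  have h1 := h.a_mul_le hZ
  have h2 : X < x := h.2.2.2.2.2.1
  rw [← mul_div_assoc, le_div_iff₀ (by positivity)]
  refine le_trans ?_ h1
  gcongr

lemma IsSol.le_of_sol (hk : k ≠ 0) (hZ : 1 ≤ Z) (h : IsSol k Z X Y M s₀ (a, b, x, y)) :
    (a : ℝ) ≤ 3 * Z ∧ (b : ℝ) ≤ 3 * Z ∧ (x : ℝ) ≤ 3 * Z ∧ (y : ℝ) ≤ 3 * Z := by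
  have h1 := h.a_mul_le hZ
  have h2 : (b : ℝ) * y ^ k ≤ 3 * Z := by
    have := h.eq_real
    linarith
  obtain ⟨ha, hb, hx, hy, -⟩ := h
  have ha' : (1 : ℝ) ≤ a := by exact_mod_cast ha
  have hb' : (1 : ℝ) ≤ b := by exact_mod_cast hb
  have hx' : (1 : ℝ) ≤ x := by exact_mod_cast hx
  have hy' : (1 : ℝ) ≤ y := by exact_mod_cast hy
  have hxk : (x : ℝ) ≤ x ^ k := le_self_pow₀ hx' hk
  have hyk : (y : ℝ) ≤ y ^ k := le_self_pow₀ hy' hk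
  exact ⟨(le_mul_of_one_le_right (by linarith) (hx'.trans hxk)).trans h1,
    (le_mul_of_one_le_right (by linarith) (hy'.trans hyk)).trans h2,
    (hxk.trans (le_mul_of_one_le_left (by linarith) ha')).trans h1,
    (hyk.trans (le_mul_of_one_le_left (by linarith) hb')).trans h2⟩

lemma IsSol.abs_sub_pow_le (hZ : 1 ≤ Z) (hXY : X ≤ Y)
    (h : IsSol k Z X Y M s₀ (a, b, x, y)) :
    |(b : ℝ) / a - ((x : ℝ) / y) ^ k| ≤ 2 ^ k * Z ^ (-1 : ℝ) := by
  have h1 := h.eq_real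
  obtain ⟨ha, hb, hx, hy, -, hx1, hx2, hy1, hy2, hz1, hz2, -⟩ := h
  simp only at ha hb hx hy hx1 hx2 hy1 hy2 hz1 hz2
  have ha' : (0 : ℝ) < a := by exact_mod_cast ha
  have hy' : (0 : ℝ) < y := by exact_mod_cast hy
  have h2 : (b : ℝ) / a - ((x : ℝ) / y) ^ k = -(1 / (a * y ^ k)) := by
    rw [div_pow]
    field_simp
    linarith
  rw [h2, abs_neg, abs_of_pos (by positivity), Real.rpow_neg_one, ← div_eq_mul_inv,
    div_le_div_iff₀ (by positivity) (by linarith), one_mul]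
  have h3 : (x : ℝ) ^ k ≤ (2 * y) ^ k := by
    gcongr
    linarith
  calc Z ≤ a * (x : ℝ) ^ k := by linarith
    _ ≤ a * (2 * y) ^ k := by gcongr
    _ = _ := by rw [mul_pow]; ring

lemma IsSol.abs_sub_le (h : IsSol k Z X Y M s₀ (a, b, x, y)) :
    |(x : ℝ) / y - s₀| ≤ 1 / M := by
  obtain ⟨-, -, -, -, -, -, -, -, -, -, -, h1, h2⟩ := h
  simp only at h1 h2
  rw [abs_of_nonneg (by linarith)]
  linarith

lemma IsSol.latSq_le (hM : 0 < M) (h : IsSol k Z X Y M s₀ (a, b, x, y)) (hY : 0 < Y) :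
    latSq M Y s₀ x y ≤ 2 := by
  have h1 := h.abs_sub_le
  obtain ⟨-, -, -, hy, -, -, -, hy1, hy2, -⟩ := h
  simp only at hy hy1 hy2
  have hy' : (0 : ℝ) < y := by exact_mod_cast hy
  have hM' : (0 : ℝ) < M := by exact_mod_cast hM
  rw [latSq]
  push_cast
  have h2 : |M * ((x : ℝ) - s₀ * y) / (2 * Y)| ≤ 1 := by
    have h3 : M * ((x : ℝ) - s₀ * y) / (2 * Y) = M * (y / (2 * Y)) * ((x : ℝ) / y - s₀) := by
      field_simp
    rw [h3, abs_mul, abs_of_pos (by positivity)]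
    calc _ ≤ M * ((y : ℝ) / (2 * Y)) * (1 / M) := by gcongr
      _ = (y : ℝ) / (2 * Y) := by field_simp
      _ ≤ 1 := by rw [div_le_one (by positivity)]; exact hy2
  have h4 : |(y : ℝ) / (2 * Y)| ≤ 1 := by
    rw [abs_of_pos (by positivity), div_le_one (by positivity)]
    exact hy2
  have h5 := (sq_le_one_iff_abs_le_one _).mpr h2
  have h6 := (sq_le_one_iff_abs_le_one _).mpr h4
  linarith

lemma eq_of_mul_eq_mul_of_coprime {x y x' y' : ℕ} (h : IsCoprime (x : ℤ) y)
    (h' : IsCoprime (x' : ℤ) y') (hx : 0 < x) (he : (x : ℤ) * y' = x' * y) : x = x' ∧ y = y' := by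
  have he' : x * y' = x' * y := by exact_mod_cast he
  have hxx : x = x' := by
    refine Nat.dvd_antisymm ?_ ?_
    · exact (Nat.isCoprime_iff_coprime.mp h).dvd_of_dvd_mul_right ⟨y', he'.symm⟩
    · exact (Nat.isCoprime_iff_coprime.mp h').dvd_of_dvd_mul_right ⟨y, he'⟩
  subst hxx
  exact ⟨rfl, (Nat.eq_of_mul_eq_mul_left hx he').symm⟩

/-- Given `x` and `y`, there are few pairs `(a, b)`. -/
lemma card_fiber_le (hk : k ≠ 0) {c₁ : ℝ} (hc₁ : 0 < c₁) (hX : 1 ≤ X)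
    (hXY : X ≤ Y) (hZ : 0 ≤ Z)
    (hZXY : Z ^ (1 / (k : ℝ)) / c₁ ≤ X * Y) (Q : Finset (ℕ × ℕ × ℕ × ℕ))
    (hQ : ∀ q ∈ Q, IsSol k Z X Y M s₀ q) (z : ℕ × ℕ) :
    (Q.filter fun q => q.2.2 = z).card ≤ ⌊2 * c₁ ^ k⌋₊ + 1 := by
  obtain ⟨x, y⟩ := z
  rw [← Finset.card_range (⌊2 * c₁ ^ k⌋₊ + 1)]
  refine Finset.card_le_card_of_injOn (fun q => q.2.1 / x ^ k) ?_ ?_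
  · rintro ⟨a, b, x', y'⟩ hq
    simp only [Finset.coe_filter, Set.mem_ofPred_eq, Prod.mk.injEq] at hq
    obtain ⟨hq, rfl, rfl⟩ := hq
    obtain ⟨-, -, hx, hy, -, hx1, -, hy1, -, -, hz2, -⟩ := hQ _ hq
    simp only at hx hy hx1 hy1 hz2
    simp only [Finset.coe_range, Set.mem_Iio]
    refine Nat.lt_succ_of_le (Nat.le_floor ?_)
    refine Nat.cast_div_le.trans ?_
    push_cast
    have hxpos : (0 : ℝ) < x' := by exact_mod_cast hx
    rw [div_le_iff₀ (by positivity)]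
    have h1 : Z ≤ c₁ ^ k * (x' * y') ^ k := by
      have h2 : Z ^ (1 / (k : ℝ)) ≤ c₁ * (x' * y') := by
        rw [div_le_iff₀ hc₁] at hZXY
        have hY0 : 0 ≤ Y := by linarith
        have : X * Y ≤ x' * y' := by gcongr
        nlinarith
      calc Z = (Z ^ (1 / (k : ℝ))) ^ k := by
            rw [one_div, Real.rpow_inv_natCast_pow hZ hk]
        _ ≤ (c₁ * (x' * y')) ^ k := by gcongr
        _ = _ := mul_pow _ _ _
    have hypos : (0 : ℝ) < (y' : ℝ) ^ k := by
      have : (0 : ℝ) < y' := by exact_mod_cast hy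
      positivity
    refine le_of_mul_le_mul_right ?_ hypos
    calc (b : ℝ) * y' ^ k ≤ 2 * Z := hz2
      _ ≤ 2 * (c₁ ^ k * (x' * y') ^ k) := by gcongr
      _ = _ := by rw [mul_pow]; ring
  · rintro ⟨a, b, x', y'⟩ hq ⟨a₂, b₂, x₂, y₂⟩ hq₂ hbb
    simp only [Finset.coe_filter, Set.mem_ofPred_eq, Prod.mk.injEq] at hq hq₂
    obtain ⟨hq, rfl, rfl⟩ := hq
    obtain ⟨hq₂, rfl, rfl⟩ := hq₂
    simp only at hbb
    have hxy := (hQ _ hq).coprime_xy hk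
    obtain ⟨-, -, hx, hy, h1, -⟩ := hQ _ hq
    obtain ⟨-, -, -, -, h2, -⟩ := hQ _ hq₂
    simp only at h1 h2 hx hy
    have h3 : ((x₂ : ℤ) ^ k) ∣ ((b₂ : ℤ) - b) := by
      refine (hxy.pow (m := k) (n := k)).dvd_of_dvd_mul_right ⟨(a₂ : ℤ) - a, ?_⟩
      linear_combination h1 - h2
    have h4 : b % x₂ ^ k = b₂ % x₂ ^ k :=
      (Nat.modEq_iff_dvd.mpr (by push_cast; exact h3))
    have h5 : b = b₂ := by
      rw [← Nat.div_add_mod b (x₂ ^ k), ← Nat.div_add_mod b₂ (x₂ ^ k), hbb, h4]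
    subst h5
    have h6 : ((a : ℤ) - a₂) * (x₂ : ℤ) ^ k = 0 := by linear_combination h1 - h2
    have h7 : (x₂ : ℤ) ^ k ≠ 0 := pow_ne_zero _ (by exact_mod_cast hx.ne')
    have h8 : (a : ℤ) = a₂ := sub_eq_zero.mp ((mul_eq_zero.mp h6).resolve_right h7)
    have h9 : a = a₂ := by exact_mod_cast h8
    rw [h9]

end

/-- The exponents of the various parameters with respect to `Z`. -/
lemma exists_exponents {k M : ℕ} {δ c₁ Z X Y : ℝ} (hk : k ≠ 0) (hδ : 0 < δ) (hc₁ : 1 ≤ c₁)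
    (hZ : 2 ≤ Z) (hZc : c₁ ^ (2 * k) ≤ Z) (hX : 1 ≤ X) (hXY : X ≤ Y)
    (hZXY : Z ^ (1 / (k : ℝ)) / c₁ ≤ X * Y) (hM : 0 < M) (hMZ : (M : ℝ) ≤ Z)
    (hlog : max (9 / 2 * (1 + δ) * Real.log (Z / X ^ k) * Real.log Y / Real.log Z)
      (Real.log Y) ≤ Real.log M) :
    ∃ α β μ : ℝ, 2 / (9 * (1 + δ)) ≤ α ∧ α ≤ 1 ∧ 1 / (4 * k) ≤ β ∧ β ≤ μ ∧ μ ≤ 1 ∧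
      9 / 2 * (1 + δ) * (α * β) ≤ μ ∧ Z ^ β = Y ∧ Z ^ (-μ) = 1 / M ∧ Z / X ^ k ≤ Z ^ α := by
  have hZ0 : 0 < Z := by linarith
  have hZ1 : Z ≠ 1 := by linarith
  have hM0 : (0 : ℝ) < M := by exact_mod_cast hM
  have hY0 : 0 < Y := by linarith
  have hl : 0 < Real.log Z := Real.log_pos (by linarith)
  have hk0 : (0 : ℝ) < k := by positivity
  have hXk : 1 ≤ X ^ k := one_le_pow₀ hX
  have hzx : 0 < Z / X ^ k := by positivity
  have hpow : ∀ t : ℝ, 0 < t → Z ^ (Real.log t / Real.log Z) = t := by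
    intro t ht
    have := Real.rpow_logb hZ0 hZ1 ht
    rwa [Real.logb] at this
  have hβ0 : 0 ≤ Real.log Y / Real.log Z := div_nonneg (Real.log_nonneg (by linarith)) hl.le
  have hβμ : Real.log Y / Real.log Z ≤ Real.log M / Real.log Z := by
    exact div_le_div_of_nonneg_right ((le_max_right _ _).trans hlog) hl.le
  refine ⟨max (Real.log (Z / X ^ k) / Real.log Z) (2 / (9 * (1 + δ))), Real.log Y / Real.log Z,
    Real.log M / Real.log Z, le_max_right _ _, ?_, ?_, hβμ, ?_, ?_, hpow Y hY0, ?_, ?_⟩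
  · refine max_le ?_ ?_
    · rw [div_le_one hl]
      exact Real.log_le_log hzx (div_le_self hZ0.le hXk)
    · rw [div_le_one (by positivity)]
      linarith
  · rw [le_div_iff₀ hl]
    have h1 : Real.log (Z ^ (1 / (k : ℝ)) / c₁) ≤ Real.log (Y * Y) :=
      Real.log_le_log (by positivity) (hZXY.trans (by gcongr))
    rw [Real.log_div (by positivity) (by positivity), Real.log_rpow hZ0,
      Real.log_mul hY0.ne' hY0.ne'] at h1
    have h2 := Real.log_le_log (by positivity) hZc
    rw [Real.log_pow] at h2
    push_cast at h2
    have h3 : Real.log c₁ ≤ 1 / (2 * k) * Real.log Z := by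
      rw [div_mul_eq_mul_div, one_mul, le_div_iff₀ (by positivity)]
      linarith
    have h4 : 1 / (k : ℝ) * Real.log Z = 4 * (1 / (4 * k) * Real.log Z) := by field_simp
    have h5 : 1 / (2 * (k : ℝ)) * Real.log Z = 2 * (1 / (4 * k) * Real.log Z) := by
      field_simp
      norm_num
    linarith
  · rw [div_le_one hl]
    exact Real.log_le_log hM0 hMZ
  · rcases max_cases (Real.log (Z / X ^ k) / Real.log Z) (2 / (9 * (1 + δ))) with h | h
    · rw [h.1]
      calc _ = 9 / 2 * (1 + δ) * Real.log (Z / X ^ k) * Real.log Y / Real.log Z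
            / Real.log Z := by field_simp
        _ ≤ _ := by
            gcongr
            exact (le_max_left _ _).trans hlog
    · rw [h.1]
      refine le_trans (le_of_eq ?_) hβμ
      field_simp
  · rw [Real.rpow_neg hZ0.le, hpow M hM0, one_div]
  · calc Z / X ^ k = Z ^ (Real.log (Z / X ^ k) / Real.log Z) := (hpow _ hzx).symm
      _ ≤ _ := Real.rpow_le_rpow_of_exponent_le (by linarith) (le_max_left _ _)

/-- The points all lie on curves of bounded degree, provided `Z` is large. -/
lemma exists_det_monoRow_eq_zero_of_isSol {k : ℕ} {δ c₁ : ℝ} (hk : k ≠ 0) (hδ : 0 < δ)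
    (hc₁ : 1 ≤ c₁) : ∃ N : ℕ, ∃ Z₁ : ℝ, 1 ≤ Z₁ ∧ ∀ (Z X Y : ℝ) (M : ℕ) (s₀ : ℝ), Z₁ ≤ Z →
      2 ≤ Z → 1 ≤ X → X ≤ Y → Z ^ (1 / (k : ℝ)) / c₁ ≤ X * Y → 0 < M → (M : ℝ) ≤ Z →
      max (9 / 2 * (1 + δ) * Real.log (Z / X ^ k) * Real.log Y / Real.log Z)
        (Real.log Y) ≤ Real.log M →
      0 ≤ s₀ → s₀ ≤ 2 * X / Y → ∃ d ≤ N, ∃ e ≤ N,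
      ∀ q : Fin (d + 1) × Fin (e + 1) → ℕ × ℕ × ℕ × ℕ, (∀ p, IsSol k Z X Y M s₀ (q p)) →
      (Matrix.of fun p => monoRow d e ((q p).2.2.1 : ℤ) ((q p).2.2.2 : ℤ) ((q p).1 : ℤ)
        ((q p).2.1 : ℤ)).det = 0 := by
  have hk0 : (0 : ℝ) < k := by positivity
  obtain ⟨N, Z₀, hZ₀, h⟩ := exists_det_monoRow_eq_zero k (η := 2 / (9 * (1 + δ)))
    (β₀ := 1 / (4 * k)) (by positivity) (by positivity) hδ
  refine ⟨N, max Z₀ (c₁ ^ (2 * k)), hZ₀.trans (le_max_left _ _), ?_⟩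
  intro Z X Y M s₀ hZZ hZ hX hXY hZXY hM hMZ hlog hs0 hs1
  obtain ⟨α, β, μ, h1, h2, h3, h4, h5, h6, hβ, hμ, hα⟩ := exists_exponents hk hδ hc₁ hZ
    ((le_max_right _ _).trans hZZ) hX hXY hZXY hM hMZ hlog
  have hs₀ : |s₀| ≤ 2 := by
    rw [abs_of_nonneg hs0]
    refine hs1.trans ?_
    rw [div_le_iff₀ (by linarith)]
    linarith
  obtain ⟨d, hd, e, he, hdet⟩ := h Z ((le_max_left _ _).trans hZZ) α β μ s₀ h1 h2 h3 h4 h5 h6 hs₀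
  refine ⟨d, hd, e, he, fun q hq => hdet _ _ _ _ ?_ ?_ ?_ ?_ ?_ ?_⟩
  · intro p
    exact_mod_cast (hq p).2.2.2.1.ne'
  · intro p
    exact_mod_cast (hq p).1.ne'
  · intro p
    rw [hβ, Int.cast_natCast, Nat.abs_cast]
    exact (hq p).2.2.2.2.2.2.2.2.1
  · intro p
    rw [Int.cast_natCast, Nat.abs_cast]
    refine ((hq p).a_le (by linarith) hX).trans ?_
    gcongr
  · intro p
    rw [hμ]
    simpa only [Int.cast_natCast] using (hq p).abs_sub_le
  · intro p
    simpa only [Int.cast_natCast] using (hq p).abs_sub_pow_le (by linarith) hXY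

/-- The number of pairs `(x, y)` is bounded, provided `Z` is large. -/
lemma exists_card_points_le {k : ℕ} {δ ε c₁ : ℝ} (hk : k ≠ 0) (hδ : 0 < δ) (hε : 0 < ε)
    (hc₁ : 1 ≤ c₁) : ∃ C : ℝ, 0 < C ∧ ∃ Z₁ : ℝ, 1 ≤ Z₁ ∧
      ∀ (Z X Y : ℝ) (M : ℕ) (s₀ : ℝ), Z₁ ≤ Z →
      2 ≤ Z → 1 ≤ X → X ≤ Y → Z ^ (1 / (k : ℝ)) / c₁ ≤ X * Y → 0 < M → (M : ℝ) ≤ Z →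
      max (9 / 2 * (1 + δ) * Real.log (Z / X ^ k) * Real.log Y / Real.log Z)
        (Real.log Y) ≤ Real.log M →
      0 ≤ s₀ → s₀ ≤ 2 * X / Y → ∀ P : Finset (ℕ × ℕ × ℕ × ℕ),
      (∀ q ∈ P, IsSol k Z X Y M s₀ q) → Set.InjOn (fun q => q.2.2) (P : Set (ℕ × ℕ × ℕ × ℕ)) →
      latMin M Y s₀ ≤ 2 → (P.card : ℝ) ≤ C * (1 / latMin M Y s₀ * Z ^ ε) := by
  classical
  obtain ⟨N, Z₁, hZ₁, hdet⟩ := exists_det_monoRow_eq_zero_of_isSol hk hδ hc₁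
  obtain ⟨C₀, hC₀, hcount⟩ := exists_card_le_of_vanishesOn hk N hε
  refine ⟨C₀ * 2 * 4 ^ ε + 2, by positivity, Z₁, hZ₁, ?_⟩
  intro Z X Y M s₀ hZZ hZ hX hXY hZXY hM hMZ hlog hs0 hs1 P hP hinj hℓ2
  obtain ⟨d, hd, e, he, hdet⟩ := hdet Z X Y M s₀ hZZ hZ hX hXY hZXY hM hMZ hlog hs0 hs1
  have hM1 : (1 : ℝ) ≤ M := by exact_mod_cast hM
  have hM0 : (0 : ℝ) < M := by linarith
  have hY0 : 0 < Y := by linarith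
  have hYM : Y ≤ M := (Real.log_le_log_iff hY0 hM0).mp ((le_max_right _ _).trans hlog)
  have hℓ := le_latMin hM1 hY0 s₀
  have hℓ0 : 0 < latMin M Y s₀ := (by positivity : 0 < 1 / (2 * Y)).trans_le hℓ
  obtain ⟨g₁, g₂, g₃, g₄, hg, hred⟩ := exists_reduced_basis hM0 hY0 s₀
  have hg0 : ¬(g₄ = 0 ∧ g₃ = 0) := by
    rintro ⟨rfl, rfl⟩
    simp at hg
  let u : ℕ × ℕ × ℕ × ℕ → ℤ := fun q => g₁ * (q.2.2.1 : ℤ) + -g₂ * (q.2.2.2 : ℤ)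
  let v : ℕ × ℕ × ℕ × ℕ → ℤ := fun q => -g₃ * (q.2.2.1 : ℤ) + g₄ * (q.2.2.2 : ℤ)
  have hx : ∀ q, g₄ * u q + g₂ * v q = (q.2.2.1 : ℤ) := by
    intro q
    linear_combination (q.2.2.1 : ℤ) * hg
  have hy : ∀ q, g₃ * u q + g₁ * v q = (q.2.2.2 : ℤ) := by
    intro q
    linear_combination (q.2.2.2 : ℤ) * hg
  have huv : ∀ q ∈ P, |(u q : ℝ)| ≤ 2 / latMin M Y s₀ ∧ |(v q : ℝ)| ≤ 2 / latMin M Y s₀ := by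
    intro q hq
    have h1 := (hP q hq).latSq_le hM hY0
    have h2 := hred (u q) (v q)
    rw [hx, hy] at h2
    exact ⟨abs_le_two_div_latMin hM1 hY0 hg0 h2.1 h1, abs_le_two_div_latMin hM1 hY0 hg0 h2.2 h1⟩
  have heq : ∀ q ∈ P, ∀ q' ∈ P, u q * v q' = u q' * v q → q = q' := by
    intro q hq q' hq' h
    refine hinj hq hq' (Prod.ext_iff.mpr ?_)
    refine eq_of_mul_eq_mul_of_coprime ((hP q hq).coprime_xy hk) ((hP q' hq').coprime_xy hk)
      (hP q hq).2.2.1 ?_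
    rw [← hx, ← hx, ← hy, ← hy]
    linear_combination (g₁ * g₄ - g₂ * g₃) * h
  set S := P.filter fun q => v q ≠ 0 with hS
  have hSP : ∀ q ∈ S, q ∈ P ∧ v q ≠ 0 := fun q hq => Finset.mem_filter.mp hq
  have hfam : PointFamily S u v (fun q => (q.1 : ℤ)) (fun q => (q.2.1 : ℤ))
      (2 / latMin M Y s₀) (3 * Z) :=
    { one_le_B := by rwa [one_le_div₀ hℓ0]
      one_le_A := by linarith
      v_ne := fun q hq => (hSP q hq).2
      a_ne := fun q hq => by
        have := (hP q (hSP q hq).1).1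
        positivity
      coprime_uv := fun q hq => by
        obtain ⟨r, s, hrs⟩ := (hP q (hSP q hq).1).coprime_xy hk
        rw [← hx, ← hy] at hrs
        exact ⟨r * g₄ + s * g₃, r * g₂ + s * g₁, by linear_combination hrs⟩
      coprime_ab := fun q hq => (hP q (hSP q hq).1).coprime_ab
      u_le := fun q hq => (huv q (hSP q hq).1).1
      v_le := fun q hq => (huv q (hSP q hq).1).2
      a_le := fun q hq => by
        rw [Int.cast_natCast, Nat.abs_cast]
        exact ((hP q (hSP q hq).1).le_of_sol hk (by linarith)).1
      b_le := fun q hq => by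
        rw [Int.cast_natCast, Nat.abs_cast]
        exact ((hP q (hSP q hq).1).le_of_sol hk (by linarith)).2.1
      injOn := by
        intro q hq q' hq' h
        obtain ⟨h1, h2⟩ := hSP q hq
        obtain ⟨h1', h2'⟩ := hSP q' hq'
        refine heq q h1 q' h1' ?_
        have h3 : (v q : ℚ) ≠ 0 := by exact_mod_cast h2
        have h3' : (v q' : ℚ) ≠ 0 := by exact_mod_cast h2'
        exact_mod_cast (div_eq_div_iff h3 h3').mp h }
  obtain ⟨c, hc0, -, hc⟩ := exists_kernel_vector S
    (fun q => monoRow d e (u q) (v q) (q.1 : ℤ) (q.2.1 : ℤ)) (hfam.one_le_pow_mul_pow d e)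
    (fun q hq n => hfam.monoRow_le hq d e n) (fun p hp =>
      det_monoRow_eq_zero_of_linear
        (fun n => by exact_mod_cast (hP _ (hSP _ (hp n)).1).2.2.2.1.ne') (fun n => rfl)
        (fun n => rfl) (hdet p fun n => hP _ (hSP _ (hp n)).1))
  have hB : 2 / latMin M Y s₀ ≤ 4 * Z := by
    rw [div_le_iff₀ hℓ0]
    rw [div_le_iff₀ (by positivity)] at hℓ
    have : latMin M Y s₀ * Y ≤ latMin M Y s₀ * Z := by
      gcongr
      exact hYM.trans hMZ
    linarith
  have h1 := hcount _ S u v _ _ _ _ (4 * Z) hfam hB (by linarith) g₄ g₂ g₃ g₁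
    (fun q hq => by
      rw [hx, hy]
      exact (hP q (hSP q hq).1).2.2.2.2.1)
    (polyOf c) (polyOf_ne_zero hc0) ((biDegLE_polyOf c).mono hd he)
    (fun q hq => biEval_polyOf_eq_zero (hfam.v_ne q hq) (hfam.a_ne q hq) (hc q hq))
  have h2 : (P.filter fun q => ¬ v q ≠ 0).card ≤ 1 := by
    refine Finset.card_le_one.mpr fun q hq q' hq' => ?_
    simp only [ne_eq, not_not, Finset.mem_filter] at hq hq'
    refine heq q hq.1 q' hq'.1 ?_
    rw [hq.2, hq'.2, mul_zero, mul_zero]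
  have h3 : (P.card : ℝ) ≤ S.card + 1 := by
    have := Finset.card_filter_add_card_filter_not (s := P) fun q => v q ≠ 0
    rw [← this]
    push_cast
    gcongr
    exact_mod_cast h2
  have h4 : 1 ≤ Z ^ ε := Real.one_le_rpow (by linarith) hε.le
  have h5 : 1 ≤ 2 * (1 / latMin M Y s₀) := by
    rw [mul_one_div, one_le_div₀ hℓ0]
    exact hℓ2
  have h6 : 1 ≤ 2 * (1 / latMin M Y s₀) * Z ^ ε := one_le_mul_of_one_le_of_one_le h5 h4
  rw [Real.mul_rpow (by norm_num) (by linarith)] at h1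
  calc (P.card : ℝ) ≤ C₀ * (2 / latMin M Y s₀ * (4 ^ ε * Z ^ ε)) +
        2 * (1 / latMin M Y s₀) * Z ^ ε := by linarith
    _ = _ := by ring

/-- All solutions lie in a box. -/
lemma setOf_isSol_subset {k M : ℕ} {Z X Y s₀ W : ℝ} (hk : k ≠ 0) (hZ : 1 ≤ Z) (hZW : Z ≤ W) :
    {q | IsSol k Z X Y M s₀ q} ⊆
      ((Finset.range (⌊3 * W⌋₊ + 1) ×ˢ Finset.range (⌊3 * W⌋₊ + 1) ×ˢ
        Finset.range (⌊3 * W⌋₊ + 1) ×ˢ Finset.range (⌊3 * W⌋₊ + 1) :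
          Finset (ℕ × ℕ × ℕ × ℕ)) : Set (ℕ × ℕ × ℕ × ℕ)) := by
  intro q hq
  have hW : 3 * Z ≤ 3 * W := by linarith
  obtain ⟨h1, h2, h3, h4⟩ := IsSol.le_of_sol hk hZ hq
  simp only [Finset.coe_product, Set.mem_prod, Finset.coe_range, Set.mem_Iio, Nat.lt_succ_iff]
  exact ⟨Nat.le_floor (h1.trans hW), Nat.le_floor (h2.trans hW), Nat.le_floor (h3.trans hW),
    Nat.le_floor (h4.trans hW)⟩

lemma ncard_setOf_isSol_le {k M : ℕ} {Z X Y s₀ W : ℝ} (hk : k ≠ 0) (hZ : 1 ≤ Z) (hZW : Z ≤ W) :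
    ({q | IsSol k Z X Y M s₀ q}.ncard : ℝ) ≤ (⌊3 * W⌋₊ + 1) ^ 4 := by
  have h := Set.ncard_le_ncard (setOf_isSol_subset (X := X) (Y := Y) (M := M) (s₀ := s₀) hk hZ hZW)
    (Finset.finite_toSet _)
  rw [Set.ncard_coe_finset] at h
  simp only [Finset.card_product, Finset.card_range] at h
  calc ({q | IsSol k Z X Y M s₀ q}.ncard : ℝ) ≤ _ := Nat.cast_le.mpr h
    _ = _ := by push_cast; ring

theorem exists_ncard_isSol_le {k : ℕ} {δ ε c₁ : ℝ} (hk : k ≠ 0) (hδ : 0 < δ) (hε : 0 < ε)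
    (hc₁ : 1 ≤ c₁) : ∃ C : ℝ, 0 < C ∧ ∀ (Z X Y : ℝ) (M : ℕ) (s₀ : ℝ),
      2 ≤ Z → 1 ≤ X → X ≤ Y → Z ^ (1 / (k : ℝ)) / c₁ ≤ X * Y → 0 < M → (M : ℝ) ≤ Z →
      max (9 / 2 * (1 + δ) * Real.log (Z / X ^ k) * Real.log Y / Real.log Z)
        (Real.log Y) ≤ Real.log M → 0 ≤ s₀ → s₀ ≤ 2 * X / Y →
      ({q | IsSol k Z X Y M s₀ q}.ncard : ℝ) ≤ C * Z ^ ε * latMin M Y s₀ ^ (-(1 + ε)) := by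
  classical
  obtain ⟨C, hC, Z₁, hZ₁, h⟩ := exists_card_points_le hk hδ hε hc₁
  set K : ℝ := (⌊3 * Z₁⌋₊ + 1) ^ 4 with hK
  have hK0 : 0 < K := by positivity
  refine ⟨(⌊2 * c₁ ^ k⌋₊ + 1) * C * 2 ^ ε + K * 2 ^ (1 + ε), by positivity, ?_⟩
  intro Z X Y M s₀ hZ hX hXY hZXY hM hMZ hlog hs0 hs1
  have hM1 : (1 : ℝ) ≤ M := by exact_mod_cast hM
  have hY0 : 0 < Y := by linarith
  have hℓ0 : 0 < latMin M Y s₀ :=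
    (by positivity : 0 < 1 / (2 * Y)).trans_le (le_latMin hM1 hY0 s₀)
  have hZ0 : 0 < Z := by linarith
  rcases Set.eq_empty_or_nonempty {q | IsSol k Z X Y M s₀ q} with he | ⟨q₀, hq₀⟩
  · rw [he, Set.ncard_empty, Nat.cast_zero]
    positivity
  have hℓ2 : latMin M Y s₀ ≤ 2 := by
    have h1 : ¬((q₀.2.2.1 : ℤ) = 0 ∧ (q₀.2.2.2 : ℤ) = 0) := fun h1 =>
      hq₀.2.2.1.ne' (by exact_mod_cast h1.1)
    refine (latMin_le M Y s₀ h1).trans (Real.sqrt_le_iff.mpr ⟨by norm_num, ?_⟩)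
    exact (IsSol.latSq_le hM hq₀ hY0).trans (by norm_num)
  have hZε : 1 ≤ Z ^ ε := Real.one_le_rpow (by linarith) hε.le
  rcases lt_or_ge Z Z₁ with hlt | hge
  · have h1 : 1 ≤ 2 ^ (1 + ε) * latMin M Y s₀ ^ (-(1 + ε)) := by
      rw [Real.rpow_neg hℓ0.le, ← div_eq_mul_inv, one_le_div₀ (by positivity)]
      exact Real.rpow_le_rpow hℓ0.le hℓ2 (by linarith)
    calc _ ≤ K := ncard_setOf_isSol_le hk (by linarith) hlt.le
      _ ≤ K * (2 ^ (1 + ε) * latMin M Y s₀ ^ (-(1 + ε)) * Z ^ ε) :=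
          le_mul_of_one_le_right hK0.le (one_le_mul_of_one_le_of_one_le h1 hZε)
      _ = K * 2 ^ (1 + ε) * Z ^ ε * latMin M Y s₀ ^ (-(1 + ε)) := by ring
      _ ≤ _ := by
          gcongr
          exact le_add_of_nonneg_left (by positivity)
  · have hfin : {q | IsSol k Z X Y M s₀ q}.Finite :=
      (Finset.finite_toSet _).subset (setOf_isSol_subset hk (by linarith) le_rfl)
    set Q := hfin.toFinset with hQ
    have hQsol : ∀ q ∈ Q, IsSol k Z X Y M s₀ q := fun q hq => hfin.mem_toFinset.mp hq
    obtain ⟨P, hPQ, hinj, himg⟩ := Finset.exists_subset_injOn_image_eq_of_surjOn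
      (f := fun q : ℕ × ℕ × ℕ × ℕ => q.2.2) (Q : Set (ℕ × ℕ × ℕ × ℕ))
      (Q.image fun q => q.2.2) (by rw [Finset.coe_image]; exact Set.surjOn_image _ _)
    have h1 := h Z X Y M s₀ hge hZ hX hXY hZXY hM hMZ hlog hs0 hs1 P
      (fun q hq => hQsol q (hPQ hq)) hinj hℓ2
    have h2 := Finset.card_le_mul_card_image (f := fun q : ℕ × ℕ × ℕ × ℕ => q.2.2) Q
      (⌊2 * c₁ ^ k⌋₊ + 1) fun z _ =>
        card_fiber_le hk (by linarith) hX hXY hZ0.le hZXY Q hQsol z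
    rw [← himg, Finset.card_image_of_injOn hinj] at h2
    have h3 : 1 / latMin M Y s₀ ≤ 2 ^ ε * latMin M Y s₀ ^ (-(1 + ε)) := by
      rw [neg_add, Real.rpow_add hℓ0, Real.rpow_neg_one, ← one_div]
      have h4 : 1 ≤ 2 ^ ε * latMin M Y s₀ ^ (-ε) := by
        rw [Real.rpow_neg hℓ0.le, ← div_eq_mul_inv, one_le_div₀ (by positivity)]
        exact Real.rpow_le_rpow hℓ0.le hℓ2 hε.le
      calc 1 / latMin M Y s₀ ≤ 1 / latMin M Y s₀ * (2 ^ ε * latMin M Y s₀ ^ (-ε)) :=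
            le_mul_of_one_le_right (by positivity) h4
        _ = _ := by ring
    rw [Set.ncard_eq_toFinset_card _ hfin]
    calc (Q.card : ℝ) ≤ (⌊2 * c₁ ^ k⌋₊ + 1) * P.card := by exact_mod_cast h2
      _ ≤ (⌊2 * c₁ ^ k⌋₊ + 1) *
          (C * (2 ^ ε * latMin M Y s₀ ^ (-(1 + ε)) * Z ^ ε)) := by
          gcongr
          exact h1.trans (by gcongr)
      _ = (⌊2 * c₁ ^ k⌋₊ + 1) * C * 2 ^ ε * Z ^ ε * latMin M Y s₀ ^ (-(1 + ε)) := by ring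
      _ ≤ _ := by
          gcongr
          exact le_add_of_nonneg_right (by positivity)

end PairCount

theorem stmt_10 (k : ℕ) (hk : 2 ≤ k) (δ ε c₁ : ℝ) (hδ : 0 < δ) (hε : 0 < ε)
    (hc₁ : 1 ≤ c₁) :
    ∃ C : ℝ, 0 < C ∧ ∀ (Z X Y : ℝ) (M : ℕ) (s₀ : ℝ),
      2 ≤ Z → 1 ≤ X → X ≤ Y → Y ≤ c₁ * Z ^ (1 / (k : ℝ)) →
      Z ^ (1 / (k : ℝ)) / c₁ ≤ X * Y →
      0 < M → (M : ℝ) ≤ Z →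
      max ((9 / 2) * (1 + δ) * Real.log (Z / X ^ k) * Real.log Y / Real.log Z)
        (Real.log Y) ≤ Real.log M →
      0 ≤ s₀ → s₀ ≤ 2 * X / Y →
      ({q : ℕ × ℕ × ℕ × ℕ | 0 < q.1 ∧ 0 < q.2.1 ∧ 0 < q.2.2.1 ∧ 0 < q.2.2.2 ∧
          (q.1 : ℤ) * (q.2.2.1 : ℤ) ^ k - (q.2.1 : ℤ) * (q.2.2.2 : ℤ) ^ k = 1 ∧
          X < (q.2.2.1 : ℝ) ∧ (q.2.2.1 : ℝ) ≤ 2 * X ∧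
          Y < (q.2.2.2 : ℝ) ∧ (q.2.2.2 : ℝ) ≤ 2 * Y ∧
          Z < (q.2.1 : ℝ) * (q.2.2.2 : ℝ) ^ k ∧
          (q.2.1 : ℝ) * (q.2.2.2 : ℝ) ^ k ≤ 2 * Z ∧
          s₀ < (q.2.2.1 : ℝ) / (q.2.2.2 : ℝ) ∧
          (q.2.2.1 : ℝ) / (q.2.2.2 : ℝ) ≤ s₀ + 1 / (M : ℝ)}.ncard : ℝ)
        ≤ C * Z ^ ε *
          (sInf {r : ℝ | ∃ x y : ℤ, ¬(x = 0 ∧ y = 0) ∧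
              r = Real.sqrt (((M : ℝ) * ((x : ℝ) - s₀ * (y : ℝ)) / (2 * Y)) ^ 2
                + ((y : ℝ) / (2 * Y)) ^ 2)}) ^ (-(1 + ε)) := by
  obtain ⟨C, hC, h⟩ := PairCount.exists_ncard_isSol_le (k := k) (by omega) hδ hε hc₁
  refine ⟨C, hC, ?_⟩
  intro Z X Y M s₀ hZ hX hXY _ hZXY hM hMZ hlog hs0 hs1
  exact h Z X Y M s₀ hZ hX hXY hZXY hM hMZ hlog hs0 hs1
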